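/- Let φ be an anisotropic nonquasilinear quadratic form of type (r,s) over F, with dim φ = 2^n + m for integers n ≥ 0 and 1 ≤ m ≤ 2^n. If φ is a Pfister neighbour, then r + s ≤ 2^n, and the following are equivalent: (1) h_nd(φ) = 1; (2) r + s = 2^n; (3) dim φ = 2^{n+1} − s. -/

import Mathlib

/-!  Common framework: quadratic forms over a field of characteristic 2, presented by
coefficient matrices, together with the standard invariants used in the paper
"Rationality of cycles modulo 2 on products of generically smooth quadrics in
characteristic 2" by S. Scully and G. Zhu. -/

open scoped TensorProduct

/-- A quadratic form of dimension `n` over `F`, presented by an `n × n` coefficient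
matrix `q`: the associated quadratic form is `x ↦ ∑ i j, q i j * x i * x j`. -/
abbrev QF (F : Type) (n : ℕ) := Matrix (Fin n) (Fin n) F

namespace QF

section Basic

variable {F : Type} [Field F]

/-- The value of a quadratic form at a vector. -/
def eval {n : ℕ} (q : QF F n) (x : Fin n → F) : F := ∑ i, ∑ j, q i j * x i * x j

/-- The polar bilinear form of `q`. -/
def polar {n : ℕ} (q : QF F n) (x y : Fin n → F) : F :=
  eval q (x + y) - eval q x - eval q y

/-- `q` is isotropic: it vanishes at some nonzero vector. -/
def Isotropic {n : ℕ} (q : QF F n) : Prop := ∃ x, x ≠ 0 ∧ eval q x = 0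

/-- `q` is anisotropic: it vanishes only at `0`. -/
def Anisotropic {n : ℕ} (q : QF F n) : Prop := ∀ x, eval q x = 0 → x = 0

/-- The zero form `d ⬝ ⟨0⟩` of dimension `d`. -/
def zeroForm (d : ℕ) : QF F d := 0

/-- Isometry of quadratic forms. -/
def Isom {n m : ℕ} (q : QF F n) (q' : QF F m) : Prop :=
  ∃ e : (Fin n → F) ≃ₗ[F] (Fin m → F), ∀ x, eval q' (e x) = eval q x

/-- Orthogonal sum of quadratic forms. -/
def orthSum {n m : ℕ} (q : QF F n) (q' : QF F m) : QF F (n + m) :=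
  Matrix.reindex finSumFinEquiv finSumFinEquiv (Matrix.fromBlocks q 0 0 q')

/-- The binary quadratic form `[a, b] : (x, y) ↦ a x² + x y + b y²`. -/
def binary (a b : F) : QF F 2 := !![a, 1; 0, b]

/-- The orthogonal sum of the binary forms `[a i, b i]`, `i = 0, …, r - 1`. -/
def binSum {r : ℕ} (a b : Fin r → F) : QF F (r + r) :=
  Matrix.reindex finSumFinEquiv finSumFinEquiv
    (Matrix.fromBlocks (Matrix.diagonal a) 1 0 (Matrix.diagonal b))

/-- The split form `w ⬝ ℍ`, the orthogonal sum of `w` hyperbolic planes. -/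
def hyper (w : ℕ) : QF F (w + w) := binSum 0 0

/-- The quasilinear (diagonal) quadratic form `⟨c 0, …, c (s - 1)⟩`. -/
def diag {s : ℕ} (c : Fin s → F) : QF F s := Matrix.diagonal c

/-- `q` has type `(r, s)` with quasilinear part `⟨c⟩`, i.e.
`q ≃ [a 0, b 0] ⊥ ⋯ ⊥ [a (r-1), b (r-1)] ⊥ ⟨c⟩` for some `a b`. -/
def HasTypeWith {n : ℕ} (q : QF F n) (r s : ℕ) (c : Fin s → F) : Prop :=
  ∃ a b : Fin r → F, Isom q (orthSum (binSum a b) (diag c))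

/-- `q` has type `(r, s)`. -/
def HasType {n : ℕ} (q : QF F n) (r s : ℕ) : Prop := ∃ c : Fin s → F, HasTypeWith q r s c

/-- `q` is quasilinear, i.e. isometric to a diagonal form. -/
def IsQuasilinear {n : ℕ} (q : QF F n) : Prop := ∃ c : Fin n → F, Isom q (diag c)

/-- The isotropy index `i₀(q)`: the maximal dimension of a totally isotropic subspace. -/
noncomputable def i0 {n : ℕ} (q : QF F n) : ℕ :=
  sSup {d | ∃ W : Submodule F (Fin n → F), Module.finrank F W = d ∧ ∀ x ∈ W, eval q x = 0}

/-- The defect index `i_d(q)`: the maximal dimension of a totally isotropic subspace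
contained in the radical of the polar form (equivalently, the isotropy index of the
quasilinear part of `q`, in characteristic 2). -/
noncomputable def defect {n : ℕ} (q : QF F n) : ℕ :=
  sSup {d | ∃ W : Submodule F (Fin n → F), Module.finrank F W = d ∧
    (∀ x ∈ W, eval q x = 0) ∧ ∀ x ∈ W, ∀ y, polar q x y = 0}

/-- `q` is nondefective. -/
def Nondefective {n : ℕ} (q : QF F n) : Prop := defect q = 0

/-- The Witt index `i_W(q)`: the maximal number of hyperbolic planes splitting off `q`. -/
noncomputable def wittIndex {n : ℕ} (q : QF F n) : ℕ :=
  sSup {w | ∃ (m : ℕ) (q' : QF F m), Isom q (orthSum q' (hyper w))}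

/-- `qa` is the anisotropic part of `q`: `qa` is anisotropic and
`q ≃ qa ⊥ w ⬝ ℍ ⊥ d ⬝ ⟨0⟩` (Witt decomposition). -/
def IsAnisotropicPart {n m : ℕ} (q : QF F n) (qa : QF F m) : Prop :=
  Anisotropic qa ∧ ∃ w d : ℕ, Isom q (orthSum (orthSum qa (hyper w)) (zeroForm d))

/-- Witt equivalence: `q` and `q'` have isometric anisotropic parts. -/
def WittEquiv {n m : ℕ} (q : QF F n) (q' : QF F m) : Prop :=
  ∃ (k : ℕ) (qa : QF F k), IsAnisotropicPart q qa ∧ IsAnisotropicPart q' qa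

/-- `p` is dominated by `q` (`p ≺ q`): `p` is isometric to the restriction of `q` to a
subspace of the underlying space of `q`. -/
def Dominated {m n : ℕ} (p : QF F m) (q : QF F n) : Prop :=
  ∃ f : (Fin m → F) →ₗ[F] (Fin n → F), Function.Injective f ∧ ∀ x, eval q (f x) = eval p x

/-- `p` is a subform (orthogonal direct summand) of `q`. -/
def Subform {m n : ℕ} (p : QF F m) (q : QF F n) : Prop :=
  ∃ (k : ℕ) (p' : QF F k), Isom q (orthSum p p')

/-- Base change of a quadratic form along a field extension `K/F`. -/
def baseChange {n : ℕ} (q : QF F n) (K : Type) [Field K] [Algebra F K] : QF K n :=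
  q.map (algebraMap F K)

/-- Transport a quadratic form along an equality of dimensions. -/
def castQF {n m : ℕ} (h : n = m) (q : QF F n) : QF F m :=
  Matrix.reindex (finCongr h) (finCongr h) q

/-- The orthogonal sum of the first `h` members of a family of quadratic forms. -/
noncomputable def sumFam {D : ℕ → ℕ} (f : ∀ i, QF F (D i)) :
    (h : ℕ) → QF F (∑ i ∈ Finset.range h, D i)
  | 0 => castQF (by simp) (zeroForm 0)
  | h + 1 => castQF (Finset.sum_range_succ D h).symm (orthSum (sumFam f h) (f h))

/-- The Gram matrix of the `k`-fold bilinear Pfister form `⟪a 0, …, a (k-1)⟫_b`. -/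
noncomputable def bPfister {k : ℕ} (a : Fin k → F) :
    Matrix (Fin (2 ^ k)) (Fin (2 ^ k)) F :=
  Matrix.reindex finFunctionFinEquiv finFunctionFinEquiv
    (Matrix.diagonal fun f : Fin k → Fin 2 => ∏ i, if f i = 1 then a i else 1)

/-- The `(k+1)`-fold quadratic Pfister form `⟪a 0, …, a (k-1)⟫_b ⊗ [1, c]`. -/
noncomputable def qPfister {k : ℕ} (a : Fin k → F) (c : F) : QF F (2 ^ k * 2) :=
  Matrix.reindex finProdFinEquiv finProdFinEquiv
    (Matrix.kroneckerMap (· * ·) (bPfister a) (binary 1 c))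

/-- `π` is a `(k+1)`-fold quadratic Pfister form. -/
def IsPfister {m : ℕ} (k : ℕ) (π : QF F m) : Prop :=
  ∃ (a : Fin k → F) (c : F), Isom π (qPfister a c)

/-- `π` is a general `(k+1)`-fold Pfister form: a nonzero scalar multiple of a
`(k+1)`-fold quadratic Pfister form. -/
def IsGenPfister {m : ℕ} (k : ℕ) (π : QF F m) : Prop :=
  ∃ d : F, d ≠ 0 ∧ ∃ (a : Fin k → F) (c : F), Isom π (d • qPfister a c)

/-- `q` is a Pfister neighbour: `2 ^ k < dim q ≤ 2 ^ (k + 1)` and `q` is dominated by a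
general `(k+1)`-fold Pfister form (domination forces `dim q ≤ 2 ^ (k + 1)`). -/
def IsPfisterNeighbour {n : ℕ} (q : QF F n) : Prop :=
  ∃ (k : ℕ) (π : QF F (2 ^ k * 2)), 2 ^ k < n ∧ IsGenPfister k π ∧ Dominated q π

/-- `qc` is the complementary form of the Pfister neighbour `q` in its ambient general
Pfister form `π`: it is the nondefective form of dimension `2 ^ (k + 1) - dim q` which is
Witt equivalent to `q ⊥ π` (this pins down `qc` up to isometry). -/
def IsComplement {n k m : ℕ} (q : QF F n) (π : QF F (2 ^ k * 2)) (qc : QF F m) : Prop :=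
  m = 2 ^ k * 2 - n ∧ Nondefective qc ∧ WittEquiv (orthSum q π) qc

/-- `qc` is the complementary form of the Pfister neighbour `q`. -/
def IsComplementOf {n m : ℕ} (q : QF F n) (qc : QF F m) : Prop :=
  ∃ (k : ℕ) (π : QF F (2 ^ k * 2)), 2 ^ k < n ∧ IsGenPfister k π ∧ Dominated q π ∧
    IsComplement q π qc

/-- The polynomial of the quadric `{q = 0}` in the affine chart where the last
projective coordinate equals `1`. -/
noncomputable def affinePoly {n : ℕ} (q : QF F n) : MvPolynomial (Fin (n - 1)) F :=
  ∑ i : Fin n, ∑ j : Fin n,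
    MvPolynomial.C (q i j) *
      (if h : (i : ℕ) < n - 1 then MvPolynomial.X (⟨(i : ℕ), h⟩ : Fin (n - 1)) else 1) *
      (if h : (j : ℕ) < n - 1 then MvPolynomial.X (⟨(j : ℕ), h⟩ : Fin (n - 1)) else 1)

/-- `K` is a model of the function field `F(q)` of the projective quadric `{q = 0}`:
`K` is the fraction field of the affine coordinate ring of the (dense) standard affine
chart of the quadric. -/
def IsFunctionField {n : ℕ} (q : QF F n) (K : Type) [Field K] [Algebra F K] : Prop :=
  ∃ f : MvPolynomial (Fin (n - 1)) F →ₐ[F] K,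
    RingHom.ker f = Ideal.span {affinePoly q} ∧
    IntermediateField.adjoin F (Set.range fun i => f (MvPolynomial.X i)) = ⊤

end Basic

/-- A bundled field extension of `F`. -/
structure FieldExt (F : Type) [Field F] : Type 1 where
  carrier : Type
  [fieldInst : Field carrier]
  [algInst : Algebra F carrier]

attribute [instance] FieldExt.fieldInst FieldExt.algInst

/-- `K/F` is a separable field extension (MacLane's criterion: `K ⊗_F L` is reduced for
every purely inseparable extension `L/F`). -/
def IsSepExt (F : Type) [Field F] (K : Type) [Field K] [Algebra F K] : Prop :=
  ∀ (L : Type) [Field L] [Algebra F L], IsPurelyInseparable F L → IsReduced (K ⊗[F] L)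

/-- `K/F` is purely transcendental: `K` is generated over `F` by an algebraically
independent subset. -/
def IsPurelyTranscendentalExt (F : Type) [Field F] (K : Type) [Field K] [Algebra F K] :
    Prop :=
  ∃ s : Set K, AlgebraicIndependent F (fun x : s => (x : K)) ∧
    IntermediateField.adjoin F s = ⊤

section Invariants

variable {F : Type} [Field F]

/-- `p` and `q` are stably birationally equivalent: over every field extension of `F`,
`p` is isotropic if and only if `q` is (for anisotropic forms of dimension at least 2
this is equivalent to stable birationality of the associated projective quadrics). -/
def SBEquiv {m n : ℕ} (p : QF F m) (q : QF F n) : Prop :=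
  ∀ (K : Type) [Field K] [Algebra F K],
    (Isotropic (baseChange p K) ↔ Isotropic (baseChange q K))

/-- The first higher isotropy index `i₁(q)` of an anisotropic form: the minimal positive
isotropy index attained over field extensions of `F`. -/
noncomputable def i1 {n : ℕ} (q : QF F n) : ℕ :=
  sInf {i | 0 < i ∧ ∃ K : FieldExt F, i0 (baseChange q K.carrier) = i}

/-- The Izhboldin dimension `dim q - i₁(q)`. -/
noncomputable def izh {n : ℕ} (q : QF F n) : ℕ := n - i1 q

/-- The nondefective splitting pattern of a nondefective form `q`: the set of Witt
indices attained by `q` over separable field extensions of `F`. -/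
def splittingPattern {n : ℕ} (q : QF F n) : Set ℕ :=
  {w | ∃ K : FieldExt F, IsSepExt F K.carrier ∧ wittIndex (baseChange q K.carrier) = w}

/-- The nondefective height `h_nd(q)`. -/
noncomputable def hnd {n : ℕ} (q : QF F n) : ℕ := (splittingPattern q).ncard - 1

/-- `jrel q t = j_t(q)`: the `t`-th value (in increasing order) of the nondefective
splitting pattern of `q`. -/
noncomputable def jrel {n : ℕ} (q : QF F n) (t : ℕ) : ℕ :=
  sInf {w | w ∈ splittingPattern q ∧ {w' | w' ∈ splittingPattern q ∧ w' < w}.ncard = t}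

/-- `irel q t = i_t(q) = j_t(q) - j_(t-1)(q)`: the `t`-th higher Witt index of `q`. -/
noncomputable def irel {n : ℕ} (q : QF F n) (t : ℕ) : ℕ := jrel q t - jrel q (t - 1)

/-- `q` is a virtual Pfister neighbour: it becomes an anisotropic Pfister neighbour
over some field extension of `F`. -/
def IsVirtualPfisterNeighbour {n : ℕ} (q : QF F n) : Prop :=
  ∃ K : FieldExt F, Anisotropic (baseChange q K.carrier) ∧
    IsPfisterNeighbour (baseChange q K.carrier)

end Invariants

/-! ### The combinatorics of `Λ(X)` and the motivic decomposition type -/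

/-- Formal symbols `i_lo` and `iᵘᵖ` indexing the Tate motives of a split quadric. -/
inductive Sym : Type
  | lo : ℤ → Sym
  | up : ℤ → Sym
  deriving DecidableEq

/-- Shift of a symbol by `j`. -/
def Sym.shift (j : ℤ) : Sym → Sym
  | .lo i => .lo (i + j)
  | .up i => .up (i + j)

/-- The shift `Λ[j]` of a set of symbols. -/
def shiftSet (Λ : Set Sym) (j : ℤ) : Set Sym := Sym.shift j '' Λ

/-- The set `Λ(X)` for a quadric `X` of dimension `d` attached to a form of type
`(r, s)`: the symbols `i_lo` for `0 ≤ i < r` and `iᵘᵖ` for `d - r < i ≤ d`. -/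
def LamSet (r d : ℤ) : Set Sym :=
  {x | (∃ i : ℤ, x = Sym.lo i ∧ 0 ≤ i ∧ i < r) ∨ ∃ i : ℤ, x = Sym.up i ∧ d - r < i ∧ i ≤ d}

/-- `a(Λ) = m`: `m` is the least index `i` with `i_lo ∈ Λ`. -/
def IsALower (Λ : Set Sym) (m : ℤ) : Prop :=
  Sym.lo m ∈ Λ ∧ ∀ i : ℤ, Sym.lo i ∈ Λ → m ≤ i

/-- `b(Λ) = m`: `m` is the largest index `i` with `iᵘᵖ ∈ Λ`. -/
def IsBUpper (Λ : Set Sym) (m : ℤ) : Prop :=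
  Sym.up m ∈ Λ ∧ ∀ i : ℤ, Sym.up i ∈ Λ → i ≤ m

/-- The member of a partition `M` of `Λ(X)` containing `0_lo`: the upper connected
component `Λᵁ(X)`. -/
def upperComp (M : Set (Set Sym)) : Set Sym := ⋃₀ {Λ | Λ ∈ M ∧ Sym.lo 0 ∈ Λ}

/-- An abstract theory of `F`-rational algebraic cycles modulo 2 of middle dimension on
the squares of generically smooth nondefective quadrics, as constructed in §§4–7 of the
paper: `RatCyc K q` is the family of subsets `Λ ⊆ Λ(X_q)` whose associated cycle
`α_Λ = ∑_{λ ∈ Λ} α_λ` is an `F`-rational element of `Ch̄_{d_X}(X_q²)` (the image of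
`CH_{d_X}(X_q²)/2 → CH_{d_X}((X_q²)_F̄)/2`).  The formal properties recorded here are
those established in the paper: the family is an `𝔽₂`-subspace (closed under symmetric
difference), is closed under intersections, consists of subsets of `Λ(X_q)`, and
contains `Λ(X_q)` itself. -/
structure MDTTheory : Type 1 where
  RatCyc : ∀ (K : Type) [Field K] {n : ℕ} (q : QF K n), Set (Set Sym)
  inter_mem : ∀ (K : Type) [Field K] {n : ℕ} (q : QF K n),
    ∀ Λ₁ ∈ RatCyc K q, ∀ Λ₂ ∈ RatCyc K q, Λ₁ ∩ Λ₂ ∈ RatCyc K q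
  symmDiff_mem : ∀ (K : Type) [Field K] {n : ℕ} (q : QF K n),
    ∀ Λ₁ ∈ RatCyc K q, ∀ Λ₂ ∈ RatCyc K q, symmDiff Λ₁ Λ₂ ∈ RatCyc K q
  subset_lam : ∀ (K : Type) [Field K] {n : ℕ} (q : QF K n) (r s : ℕ),
    HasType q r s → ∀ Λ ∈ RatCyc K q, Λ ⊆ LamSet (r : ℤ) ((n : ℤ) - 2)
  lam_mem : ∀ (K : Type) [Field K] {n : ℕ} (q : QF K n) (r s : ℕ),
    HasType q r s → LamSet (r : ℤ) ((n : ℤ) - 2) ∈ RatCyc K q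

/-- The motivic decomposition type `MDT(q)`: the partition of `Λ(X_q)` into the supports
of the indecomposable rational cycles, i.e. the minimal nonempty members of the family
of rational subsets. -/
def MDTTheory.MDT (T : MDTTheory) (K : Type) [Field K] {n : ℕ} (q : QF K n) :
    Set (Set Sym) :=
  {Λ | Λ ∈ T.RatCyc K q ∧ Λ.Nonempty ∧
    ∀ Λ' ∈ T.RatCyc K q, Λ' ⊆ Λ → Λ' = ∅ ∨ Λ' = Λ}

end QF

namespace QX

section Ring
variable {R S : Type} [CommRing R] [CommRing S] {ι κ : Type} [Fintype ι] [Fintype κ]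

/-- quadratic value -/
def ev (q : Matrix ι ι R) (x : ι → R) : R := ∑ i, ∑ j, q i j * x i * x j
/-- the coefficient bilinear form -/
def bl (q : Matrix ι ι R) (x y : ι → R) : R := ∑ i, ∑ j, q i j * x i * y j
/-- polar form -/
def pl (q : Matrix ι ι R) (x y : ι → R) : R := bl q x y + bl q y x

lemma ev_eq_bl (q : Matrix ι ι R) (x : ι → R) : ev q x = bl q x x := rfl

lemma bl_add_left (q : Matrix ι ι R) (x y z : ι → R) : bl q (x+y) z = bl q x z + bl q y z := by
  simp only [bl, Pi.add_apply, mul_add, add_mul, Finset.sum_add_distrib]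
lemma bl_add_right (q : Matrix ι ι R) (x y z : ι → R) : bl q z (x+y) = bl q z x + bl q z y := by
  simp only [bl, Pi.add_apply, mul_add, Finset.sum_add_distrib]
lemma bl_smul_left (q : Matrix ι ι R) (c : R) (x z : ι → R) : bl q (c • x) z = c * bl q x z := by
  simp only [bl, Pi.smul_apply, smul_eq_mul, Finset.mul_sum]
  refine Finset.sum_congr rfl fun i _ => Finset.sum_congr rfl fun j _ => by ring
lemma bl_smul_right (q : Matrix ι ι R) (c : R) (x z : ι → R) : bl q z (c • x) = c * bl q z x := by
  simp only [bl, Pi.smul_apply, smul_eq_mul, Finset.mul_sum]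
  refine Finset.sum_congr rfl fun i _ => Finset.sum_congr rfl fun j _ => by ring

lemma pl_comm (q : Matrix ι ι R) (x y : ι → R) : pl q x y = pl q y x := by
  simp only [pl, add_comm]
lemma pl_add_left (q : Matrix ι ι R) (x y z : ι → R) : pl q (x+y) z = pl q x z + pl q y z := by
  simp only [pl, bl_add_left, bl_add_right]; ring
lemma pl_add_right (q : Matrix ι ι R) (x y z : ι → R) : pl q z (x+y) = pl q z x + pl q z y := by
  simp only [pl, bl_add_left, bl_add_right]; ring
lemma pl_smul_left (q : Matrix ι ι R) (c : R) (x z : ι → R) : pl q (c • x) z = c * pl q x z := by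
  simp only [pl, bl_smul_left, bl_smul_right]; ring
lemma pl_smul_right (q : Matrix ι ι R) (c : R) (x z : ι → R) : pl q z (c • x) = c * pl q z x := by
  simp only [pl, bl_smul_left, bl_smul_right]; ring
lemma ev_add (q : Matrix ι ι R) (x y : ι → R) : ev q (x+y) = ev q x + ev q y + pl q x y := by
  simp only [ev_eq_bl, pl, bl_add_left, bl_add_right]; ring
lemma ev_smul (q : Matrix ι ι R) (c : R) (x : ι → R) : ev q (c • x) = c^2 * ev q x := by
  simp only [ev_eq_bl, bl_smul_left, bl_smul_right]; ring
lemma pl_self (q : Matrix ι ι R) (x : ι → R) : pl q x x = 2 * ev q x := by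
  simp only [ev_eq_bl, pl]; ring
@[simp] lemma ev_zero (q : Matrix ι ι R) : ev q 0 = 0 := by simp [ev]
@[simp] lemma pl_zero_left (q : Matrix ι ι R) (x : ι → R) : pl q 0 x = 0 := by simp [pl, bl]
@[simp] lemma pl_zero_right (q : Matrix ι ι R) (x : ι → R) : pl q x 0 = 0 := by simp [pl, bl]
lemma pl_neg_left (q : Matrix ι ι R) (x y : ι → R) : pl q (-x) y = - pl q x y := by
  have := pl_smul_left q (-1) x y; simpa using this
lemma pl_neg_right (q : Matrix ι ι R) (x y : ι → R) : pl q x (-y) = - pl q x y := by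
  have := pl_smul_right q (-1) y x; simpa using this
lemma ev_neg (q : Matrix ι ι R) (x : ι → R) : ev q (-x) = ev q x := by
  have := ev_smul q (-1) x; simpa using this
lemma pl_sub_left (q : Matrix ι ι R) (x y z : ι → R) : pl q (x-y) z = pl q x z - pl q y z := by
  rw [sub_eq_add_neg, pl_add_left, pl_neg_left]; ring
lemma pl_sub_right (q : Matrix ι ι R) (x y z : ι → R) : pl q z (x-y) = pl q z x - pl q z y := by
  rw [sub_eq_add_neg, pl_add_right, pl_neg_right]; ring

/-- polar form as a bilinear form -/
def plB (q : Matrix ι ι R) : LinearMap.BilinForm R (ι → R) :=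
  LinearMap.mk₂ R (pl q) (pl_add_left q) (pl_smul_left q) (fun z x y => pl_add_right q x y z)
    (fun c z x => pl_smul_right q c x z)
@[simp] lemma plB_apply (q : Matrix ι ι R) (x y : ι → R) : plB q x y = pl q x y := rfl
lemma plB_refl (q : Matrix ι ι R) : (plB q).IsRefl := by
  intro x y h; simpa [pl_comm] using h
lemma plB_symm (q : Matrix ι ι R) : (plB q).IsSymm := ⟨fun x y => by simp [pl_comm q x y]⟩

lemma pl_sum_left {α : Type*} (s : Finset α) (q : Matrix ι ι R) (f : α → ι → R) (z : ι → R) :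
    pl q (∑ a ∈ s, f a) z = ∑ a ∈ s, pl q (f a) z := by
  classical
  induction s using Finset.induction_on with
  | empty => simp
  | insert a s ha ih => rw [Finset.sum_insert ha, Finset.sum_insert ha, pl_add_left, ih]
lemma pl_sum_right {α : Type*} (s : Finset α) (q : Matrix ι ι R) (f : α → ι → R) (z : ι → R) :
    pl q z (∑ a ∈ s, f a) = ∑ a ∈ s, pl q z (f a) := by
  rw [pl_comm, pl_sum_left]; simp only [pl_comm]

lemma map_ev (f : R →+* S) (q : Matrix ι ι R) (x : ι → R) : f (ev q x) = ev (q.map f) (fun i => f (x i)) := by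
  simp [ev, map_sum, map_mul]
lemma map_bl (f : R →+* S) (q : Matrix ι ι R) (x y : ι → R) :
    f (bl q x y) = bl (q.map f) (fun i => f (x i)) (fun i => f (y i)) := by
  simp [bl, map_sum, map_mul]
lemma map_pl (f : R →+* S) (q : Matrix ι ι R) (x y : ι → R) :
    f (pl q x y) = pl (q.map f) (fun i => f (x i)) (fun i => f (y i)) := by
  simp [pl, map_bl]

lemma ev_smul_mat (c : R) (q : Matrix ι ι R) (x : ι → R) : ev (c • q) x = c * ev q x := by
  simp only [ev, Matrix.smul_apply, smul_eq_mul, Finset.mul_sum]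
  refine Finset.sum_congr rfl fun i _ => Finset.sum_congr rfl fun j _ => by ring
lemma pl_smul_mat (c : R) (q : Matrix ι ι R) (x y : ι → R) : pl (c • q) x y = c * pl q x y := by
  simp only [pl, bl, Matrix.smul_apply, smul_eq_mul, Finset.mul_sum, mul_add]
  congr 1 <;> refine Finset.sum_congr rfl fun i _ => Finset.sum_congr rfl fun j _ => by ring

lemma bl_eq_dot (q : Matrix ι ι R) (x y : ι → R) : bl q x y = x ⬝ᵥ (q.mulVec y) := by
  simp only [bl, dotProduct, Matrix.mulVec, Finset.mul_sum]
  refine Finset.sum_congr rfl fun i _ => Finset.sum_congr rfl fun j _ => by ring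

lemma bl_conj (q : Matrix ι ι R) (G : Matrix ι κ R) (x y : κ → R) :
    bl (G.transpose * q * G) x y = bl q (G.mulVec x) (G.mulVec y) := by
  rw [bl_eq_dot, bl_eq_dot, ← Matrix.mulVec_mulVec, ← Matrix.mulVec_mulVec,
    Matrix.dotProduct_mulVec, Matrix.vecMul_transpose]
lemma ev_conj (q : Matrix ι ι R) (G : Matrix ι κ R) (x : κ → R) :
    ev (G.transpose * q * G) x = ev q (G.mulVec x) := bl_conj q G x x
lemma pl_conj (q : Matrix ι ι R) (G : Matrix ι κ R) (x y : κ → R) :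
    pl (G.transpose * q * G) x y = pl q (G.mulVec x) (G.mulVec y) := by
  simp only [pl, bl_conj]

lemma ev_reindex (e : ι ≃ κ) (q : Matrix ι ι R) (x : κ → R) :
    ev (Matrix.reindex e e q) x = ev q (x ∘ e) := by
  simp only [ev, Matrix.reindex_apply, Matrix.submatrix_apply, Function.comp]
  rw [← Equiv.sum_comp e]
  refine Finset.sum_congr rfl fun i _ => ?_
  rw [← Equiv.sum_comp e]
  simp
lemma bl_reindex (e : ι ≃ κ) (q : Matrix ι ι R) (x y : κ → R) :
    bl (Matrix.reindex e e q) x y = bl q (x ∘ e) (y ∘ e) := by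
  simp only [bl, Matrix.reindex_apply, Matrix.submatrix_apply, Function.comp]
  rw [← Equiv.sum_comp e]
  refine Finset.sum_congr rfl fun i _ => ?_
  rw [← Equiv.sum_comp e]
  simp

lemma pl_reindex (e : ι ≃ κ) (q : Matrix ι ι R) (x y : κ → R) :
    pl (Matrix.reindex e e q) x y = pl q (x ∘ e) (y ∘ e) := by
  simp only [pl, bl_reindex]

/-- Gram lemma -/
lemma gram {α : Type*} (s : Finset α) (q : Matrix ι ι R) (q' : Matrix κ κ R)
    (v : α → ι → R) (v' : α → κ → R)
    (h1 : ∀ a, ev q (v a) = ev q' (v' a))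
    (h2 : ∀ a b, pl q (v a) (v b) = pl q' (v' a) (v' b)) (c : α → R) :
    ev q (∑ a ∈ s, c a • v a) = ev q' (∑ a ∈ s, c a • v' a) := by
  classical
  induction s using Finset.induction_on with
  | empty => simp
  | insert a s ha ih =>
    rw [Finset.sum_insert ha, Finset.sum_insert ha, ev_add, ev_add, ih, ev_smul, ev_smul, h1,
      pl_sum_right, pl_sum_right]
    simp only [pl_smul_left, pl_smul_right, h2]

lemma ev_single [DecidableEq ι] (q : Matrix ι ι R) (i : ι) : ev q (Pi.single i 1) = q i i := by
  simp [ev, Pi.single_apply]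
lemma pl_single [DecidableEq ι] (q : Matrix ι ι R) (i j : ι) :
    pl q (Pi.single i 1) (Pi.single j 1) = q i j + q j i := by
  simp [pl, bl, Pi.single_apply]

/-- gram of a family versus a matrix form -/
lemma gram_mat [DecidableEq ι] (p : Matrix ι ι R) (q : Matrix κ κ R) (v : ι → κ → R)
    (h1 : ∀ a, ev q (v a) = p a a) (h2 : ∀ a b, a ≠ b → pl q (v a) (v b) = p a b + p b a) (x : ι → R) :
    ev q (∑ a, x a • v a) = ev p x := by
  have := gram Finset.univ q p v (fun a => Pi.single a 1) (fun a => by rw [h1, ev_single])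
    (fun a b => by
      by_cases hab : a = b
      · subst hab; rw [pl_self, h1, pl_single]; ring
      · rw [h2 a b hab, pl_single]) x
  rw [this]
  congr 1
  ext i; simp [Finset.sum_apply, Pi.single_apply]

end Ring

section Field
variable {K L : Type} [Field K] [Field L] {ι : Type} [Fintype ι]
/-- anisotropy -/
def An (q : Matrix ι ι K) : Prop := ∀ x, ev q x = 0 → x = 0
/-- isotropy -/
def Is (q : Matrix ι ι K) : Prop := ∃ x, x ≠ 0 ∧ ev q x = 0
lemma not_an {q : Matrix ι ι K} : ¬ An q ↔ Is q := by
  simp only [An, Is]; push Not; exact ⟨fun ⟨x, a, b⟩ => ⟨x, b, a⟩, fun ⟨x, a, b⟩ => ⟨x, b, a⟩⟩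
lemma not_is {q : Matrix ι ι K} : ¬ Is q ↔ An q := by rw [← not_an, not_not]
lemma Is.map {q : Matrix ι ι K} (h : Is q) (f : K →+* L) : Is (q.map f) := by
  obtain ⟨x, hx, h⟩ := h
  refine ⟨fun i => f (x i), fun h0 => hx ?_, ?_⟩
  · ext i; simpa using congrFun h0 i
  · rw [← map_ev, h, map_zero]
lemma An.of_map {q : Matrix ι ι K} {f : K →+* L} (h : An (q.map f)) : An q := by
  rw [← not_is] at *; exact fun h' => h (h'.map f)
lemma two_map (f : K →+* L) (h : (2:K) = 0) : (2:L) = 0 := by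
  have := congrArg f h; rwa [map_ofNat, map_zero] at this
end Field

end QX

set_option linter.all false
namespace QX
open QuadraticMap

section Abs
variable {K : Type} [Field K] {V : Type} [AddCommGroup V] [Module K V]

/-- roundness with adjoints -/
def Rd (Q : QuadraticForm K V) : Prop :=
  ∀ x, ∃ A A' : V →ₗ[K] V, (∀ y, Q (A y) = Q x * Q y) ∧ (∀ y, Q (A' y) = Q x * Q y) ∧
    ∀ y z, polar Q (A y) z = polar Q y (A' z)

/-- Lagrangian property -/
def Lg (Q : QuadraticForm K V) : Prop :=
  (∃ x, x ≠ 0 ∧ Q x = 0) → ∃ W : Submodule K V, 2 * Module.finrank K W = Module.finrank K V ∧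
    ∀ x ∈ W, Q x = 0

/-- the form `Q ⊥ aQ` -/
def dbl (a : K) (Q : QuadraticForm K V) : QuadraticForm K (V × V) := QuadraticMap.prod Q (a • Q)

lemma dbl_apply (a : K) (Q : QuadraticForm K V) (x : V × V) : dbl a Q x = Q x.1 + a * Q x.2 := by
  simp [dbl, QuadraticMap.prod_apply]

lemma dbl_polar (a : K) (Q : QuadraticForm K V) (x y : V × V) :
    polar (dbl a Q) x y = polar Q x.1 y.1 + a * polar Q x.2 y.2 := by
  simp only [polar, dbl_apply, Prod.fst_add, Prod.snd_add]; ring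

lemma Rd.dbl (h2 : (2:K) = 0) {Q : QuadraticForm K V} (h : Rd Q) (a : K) : Rd (dbl a Q) := by
  rintro ⟨X, Y⟩
  obtain ⟨A, A', hA, hA', hAA⟩ := h X
  obtain ⟨D, D', hD, hD', hDD⟩ := h Y
  by_cases hY : Q Y = 0
  · refine ⟨A.prodMap A, A'.prodMap A', ?_, ?_, ?_⟩
    · rintro ⟨P, R⟩; simp [dbl_apply, hA, hY]; ring
    · rintro ⟨P, R⟩; simp [dbl_apply, hA', hY]; ring
    · rintro ⟨P, R⟩ ⟨P2, R2⟩; simp [dbl_polar, hAA]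
  by_cases hX : Q X = 0
  · refine ⟨(a • D ∘ₗ LinearMap.snd K V V).prod (D ∘ₗ LinearMap.fst K V V),
      (a • D' ∘ₗ LinearMap.snd K V V).prod (D' ∘ₗ LinearMap.fst K V V), ?_, ?_, ?_⟩
    · rintro ⟨P, R⟩; simp [dbl_apply, hD, hX, QuadraticMap.map_smul]; ring
    · rintro ⟨P, R⟩; simp [dbl_apply, hD', hX, QuadraticMap.map_smul]; ring
    · rintro ⟨P, R⟩ ⟨P2, R2⟩
      simp [dbl_polar, hDD, polar_smul_left, polar_smul_right]; ring
  set T : V →ₗ[K] V := (Q X)⁻¹ • (D ∘ₗ A) with hT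
  set T' : V →ₗ[K] V := (Q X)⁻¹ • (A' ∘ₗ D') with hT'
  have t1 : ∀ y, Q X * Q (T y) = Q Y * Q y := by
    intro y; simp [hT, QuadraticMap.map_smul, hD, hA]; field_simp
  have t2 : ∀ y, Q X * Q (T' y) = Q Y * Q y := by
    intro y; simp [hT', QuadraticMap.map_smul, hD', hA']; field_simp
  have t3 : ∀ y z, polar Q (T y) z = polar Q y (T' z) := by
    intro y z; simp [hT, hT', polar_smul_left, polar_smul_right, hDD, hAA]
  have t4 : ∀ y z, polar Q (T' y) z = polar Q y (T z) := by
    intro y z; rw [polar_comm, ← t3, polar_comm]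
  have key : ∀ P R, Q X * (Q (P + a • T' R) + a * Q (T P + R)) =
      (Q X + a * Q Y) * (Q P + a * Q R) := by
    intro P R
    rw [QuadraticMap.map_add Q, QuadraticMap.map_add Q, QuadraticMap.map_smul Q, polar_smul_right,
      t3, smul_eq_mul, smul_eq_mul]
    linear_combination a * t1 P + a * a * t2 R + Q X * a * polar Q P (T' R) * h2
  let U : V × V →ₗ[K] V × V := (LinearMap.fst K V V + a • T' ∘ₗ LinearMap.snd K V V).prod
    (T ∘ₗ LinearMap.fst K V V + LinearMap.snd K V V)
  have hU : ∀ P R, U (P, R) = (P + a • T' R, T P + R) := fun P R => rfl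
  refine ⟨U ∘ₗ (A.prodMap A), (A'.prodMap A') ∘ₗ U, ?_, ?_, ?_⟩
  · rintro ⟨P, R⟩
    have := key (A P) (A R)
    rw [hA, hA] at this
    simp only [LinearMap.comp_apply, LinearMap.prodMap_apply, hU, dbl_apply]
    apply mul_left_cancel₀ hX
    linear_combination this
  · rintro ⟨P, R⟩
    have := key P R
    simp only [LinearMap.comp_apply, LinearMap.prodMap_apply, hU, dbl_apply, hA']
    linear_combination this
  · rintro ⟨P, R⟩ ⟨P2, R2⟩
    simp only [LinearMap.comp_apply, LinearMap.prodMap_apply, hU, dbl_polar, polar_add_left,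
      polar_add_right, polar_smul_left, polar_smul_right, map_add, map_smul, smul_eq_mul, t3, t4, hAA]
    simp only [← hAA, t3, t4]
    ring

lemma Lg.dbl (h2 : (2:K) = 0) [FiniteDimensional K V] {Q : QuadraticForm K V} (h : Rd Q) (hl : Lg Q) (a : K) : Lg (dbl a Q) := by
  rintro ⟨⟨X, Y⟩, hne, h0⟩
  by_cases hi : ∃ x, x ≠ 0 ∧ Q x = 0
  · obtain ⟨W, hW, hW0⟩ := hl hi
    refine ⟨LinearMap.range (W.subtype.prodMap W.subtype), ?_, ?_⟩
    · rw [LinearMap.finrank_range_of_inj, Module.finrank_prod, Module.finrank_prod]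
      · omega
      · rintro ⟨x, y⟩ ⟨x', y'⟩ h
        have e1 : (x : V) = x' := congrArg Prod.fst h
        have e2 : (y : V) = y' := congrArg Prod.snd h
        exact Prod.ext (Subtype.ext e1) (Subtype.ext e2)
    · rintro _ ⟨⟨x, y⟩, rfl⟩
      simp [dbl_apply, hW0 x x.2, hW0 y y.2]
  push Not at hi
  rw [dbl_apply] at h0
  simp only at h0
  have hY : Y ≠ 0 := by
    rintro rfl
    simp at h0
    have : X = 0 := by by_contra hx; exact hi X hx h0
    exact hne (by simp [this])
  have hQY := hi Y hY
  obtain ⟨A, A', hA, hA', hAA⟩ := h X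
  obtain ⟨D, D', hD, hD', hDD⟩ := h Y
  let C : V →ₗ[K] V := (Q Y)⁻¹ • (A ∘ₗ D)
  have hC : ∀ y, Q (C y) = a * Q y := by
    intro y; simp [C, QuadraticMap.map_smul, hD, hA]; field_simp
    linear_combination Q y * h0 - a * Q y * Q Y * h2
  let U : V →ₗ[K] V × V := C.prod LinearMap.id
  have hinj : Function.Injective U := by
    intro x y hxy; exact congrArg Prod.snd hxy
  refine ⟨LinearMap.range U, ?_, ?_⟩
  · rw [LinearMap.finrank_range_of_inj hinj, Module.finrank_prod]; ring
  · rintro _ ⟨P, rfl⟩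
    have : U P = (C P, P) := rfl
    rw [this, dbl_apply, hC]
    linear_combination a * Q P * h2


/-- nondegenerate -/
def Nd (Q : QuadraticForm K V) : Prop := ∀ x, (∀ y, polar Q x y = 0) → x = 0

lemma Nd.dbl {Q : QuadraticForm K V} (h : Nd Q) {a : K} (ha : a ≠ 0) : Nd (dbl a Q) := by
  rintro ⟨X, Y⟩ hh
  have h1 : X = 0 := h X fun y => by simpa [dbl_polar, polar_zero_right] using hh (y, 0)
  have h3 : Y = 0 := h Y fun y => by
    have := hh (0, y)
    simpa [dbl_polar, polar_zero_right, ha] using this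
  simp [h1, h3]

end Abs

section Conc
variable {K : Type} [Field K]

/-- the index type of Pfister forms -/
abbrev PI (k : ℕ) := (Fin k → Fin 2) × Fin 2

/-- splitting of the index type -/
def piEquiv (k : ℕ) : PI (k+1) ≃ PI k ⊕ PI k where
  toFun p := if p.1 0 = 0 then Sum.inl (Fin.tail p.1, p.2) else Sum.inr (Fin.tail p.1, p.2)
  invFun := Sum.elim (fun p => (Fin.cons 0 p.1, p.2)) (fun p => (Fin.cons 1 p.1, p.2))
  left_inv := by
    rintro ⟨f, j⟩
    by_cases h : f 0 = 0
    · simp only [h, if_true, Sum.elim_inl]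
      rw [← h, Fin.cons_self_tail]
    · have h1 : f 0 = 1 := by omega
      simp only [h, if_false, Sum.elim_inr]
      rw [← h1, Fin.cons_self_tail]
  right_inv := by
    rintro (⟨f, j⟩ | ⟨f, j⟩) <;> simp

/-- coefficients -/
def pm {k : ℕ} (a : Fin k → K) (f : Fin k → Fin 2) : K := ∏ i, if f i = 1 then a i else 1

lemma pm_cons0 {k : ℕ} (a : Fin (k+1) → K) (f : Fin k → Fin 2) : pm a (Fin.cons 0 f) = pm (Fin.tail a) f := by
  simp [pm, Fin.prod_univ_succ, Fin.tail]
lemma pm_cons1 {k : ℕ} (a : Fin (k+1) → K) (f : Fin k → Fin 2) : pm a (Fin.cons 1 f) = a 0 * pm (Fin.tail a) f := by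
  simp [pm, Fin.prod_univ_succ, Fin.tail]

/-- explicit Pfister value -/
def pv {k : ℕ} (a : Fin k → K) (c : K) (x : PI k → K) : K :=
  ∑ f, pm a f * (x (f,0)^2 + x (f,0) * x (f,1) + c * x (f,1)^2)

/-- index bijection -/
def pe (k : ℕ) : PI k ≃ Fin (2^k*2) :=
  (Equiv.prodCongr finFunctionFinEquiv (Equiv.refl _)).trans finProdFinEquiv

lemma ev_qPfister {k : ℕ} (a : Fin k → K) (c : K) (x : Fin (2^k*2) → K) :
    ev (QF.qPfister a c) x = pv a c (x ∘ pe k) := by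
  classical
  have h1 : QF.qPfister a c = Matrix.reindex (pe k) (pe k)
      (Matrix.kroneckerMap (· * ·) (Matrix.diagonal (pm a)) (QF.binary 1 c)) := by
    ext i j
    simp [QF.qPfister, QF.bPfister, pe, pm, Matrix.kroneckerMap, Matrix.diagonal_apply]
  rw [h1, ev_reindex]
  set y := x ∘ pe k
  simp only [ev, pv]
  rw [Fintype.sum_prod_type]
  refine Finset.sum_congr rfl fun f _ => ?_
  simp only [Fintype.sum_prod_type, Matrix.kroneckerMap_apply, Matrix.diagonal_apply, Fin.sum_univ_two, QF.binary]
  simp [ite_mul, Finset.sum_add_distrib, Finset.sum_ite_eq]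
  ring

lemma map_qPfister {L : Type} [Field L] (i : K →+* L) {k : ℕ} (a : Fin k → K) (c : K) :
    (QF.qPfister a c).map i = QF.qPfister (fun t => i (a t)) (i c) := by
  classical
  ext u v
  simp only [QF.qPfister, QF.bPfister, Matrix.map_apply, Matrix.reindex_apply, Matrix.submatrix_apply,
    Matrix.kroneckerMap_apply, map_mul, Matrix.diagonal_apply]
  congr 1
  · split_ifs
    · rw [map_prod]
      refine Finset.prod_congr rfl fun t _ => ?_
      split_ifs <;> simp
    · simp
  · generalize (finProdFinEquiv.symm u).2 = s
    generalize (finProdFinEquiv.symm v).2 = t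
    fin_cases s <;> fin_cases t <;> simp [QF.binary]

/-- the linear equivalence splitting vectors -/
noncomputable def pl2 (k : ℕ) : (PI (k+1) → K) ≃ₗ[K] (PI k → K) × (PI k → K) :=
  (LinearEquiv.funCongrLeft K K (piEquiv k).symm).trans (LinearEquiv.sumArrowLequivProdArrow _ _ K K)

lemma pv_succ {k : ℕ} (a : Fin (k+1) → K) (c : K) (x : PI (k+1) → K) :
    pv a c x = pv (Fin.tail a) c (pl2 k x).1 + a 0 * pv (Fin.tail a) c (pl2 k x).2 := by
  have h := Equiv.sum_comp (Fin.consEquiv (fun _ : Fin (k+1) => Fin 2))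
    (fun f => pm a f * (x (f,0)^2 + x (f,0) * x (f,1) + c * x (f,1)^2))
  simp only [pv]
  rw [← h, Fintype.sum_prod_type, Fin.sum_univ_two, Finset.mul_sum]
  congr 1
  · refine Finset.sum_congr rfl fun f _ => ?_
    have e : ∀ j, (pl2 k x).1 (f, j) = x (Fin.cons 0 f, j) := fun j => rfl
    have hc : (Fin.consEquiv fun _ : Fin (k+1) => Fin 2) (0, f) = Fin.cons 0 f := rfl
    simp only [hc, pm_cons0, e]
  · refine Finset.sum_congr rfl fun f _ => ?_
    have e : ∀ j, (pl2 k x).2 (f, j) = x (Fin.cons 1 f, j) := fun j => rfl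
    have hc : (Fin.consEquiv fun _ : Fin (k+1) => Fin 2) (1, f) = Fin.cons 1 f := rfl
    simp only [hc, pm_cons1, e]
    ring

/-- Mathlib quadratic form from a matrix -/
def toQ {ι : Type} [Fintype ι] (q : Matrix ι ι K) : QuadraticForm K (ι → K) where
  toFun := ev q
  toFun_smul c x := by rw [ev_smul]; simp [pow_two]
  exists_companion' := ⟨plB q, fun x y => by simp [ev_add]⟩

lemma toQ_apply {ι : Type} [Fintype ι] (q : Matrix ι ι K) (x) : toQ q x = ev q x := rfl
lemma toQ_polar {ι : Type} [Fintype ι] (q : Matrix ι ι K) (x y) : polar (toQ q) x y = pl q x y := by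
  simp only [polar, toQ_apply, ev_add]; ring

lemma base_case (h2 : (2:K) = 0) (c : K) : ∃ Q : QuadraticForm K (Fin 2 → K),
    (∀ x, Q x = x 0 ^2 + x 0 * x 1 + c * x 1 ^2) ∧ Rd Q ∧ Lg Q ∧ Nd Q := by
  have hp : ∀ x y, pl (QF.binary 1 c) x y = x 0 * y 1 + x 1 * y 0 := by
    intro x y
    simp [pl, bl, QF.binary, Fin.sum_univ_two]
    linear_combination (x 0 * y 0 + c * x 1 * y 1) * h2
  have hq : ∀ x, toQ (QF.binary 1 c) x = x 0 ^2 + x 0 * x 1 + c * x 1 ^2 := by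
    intro x; rw [toQ_apply]; simp [ev, QF.binary, Fin.sum_univ_two]; ring
  refine ⟨toQ (QF.binary 1 c), hq, ?_, ?_, ?_⟩
  · intro x
    refine ⟨Matrix.mulVecLin !![x 0, c * x 1; x 1, x 0 + x 1],
      Matrix.mulVecLin !![x 0 + x 1, c * x 1; x 1, x 0], ?_, ?_, ?_⟩
    · intro y; rw [hq, hq, hq]; simp [Matrix.mulVec, dotProduct, Fin.sum_univ_two]
      linear_combination (c * x 0 * y 1 * x 1 * y 0 * 2 + c * x 1 ^2 * y 0 * y 1+c * x 0 * x 1 * y 1 ^ 2 + c * x 1 ^ 2 * y 1 ^ 2) * h2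
    · intro y; rw [hq, hq, hq]; simp [Matrix.mulVec, dotProduct, Fin.sum_univ_two]
      linear_combination (c * x 0 * y 1 * x 1 * y 0 * 2 + c * x 1 ^2 * y 0 * y 1+c * x 0 * x 1 * y 1 ^ 2 + x 0 * x 1 * y 0 ^ 2  - x 0 * x 1 * c * y 1 ^ 2 + x 1 ^ 2 * y 0 ^ 2) * h2
    · intro y z; rw [toQ_polar, toQ_polar, hp, hp]; simp [Matrix.mulVec, dotProduct, Fin.sum_univ_two]
      ring
  · rintro ⟨x, hx, h0⟩
    refine ⟨Submodule.span K {x}, ?_, ?_⟩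
    · rw [finrank_span_singleton hx]; simp
    · intro y hy
      obtain ⟨t, rfl⟩ := Submodule.mem_span_singleton.1 hy
      rw [QuadraticMap.map_smul, h0, smul_zero]
  · intro x hx
    have h0 := hx (Pi.single 0 1)
    have h1 := hx (Pi.single 1 1)
    rw [toQ_polar, hp] at h0 h1
    simp at h0 h1
    ext i; fin_cases i <;> simp [h0, h1]

lemma transport {V V' : Type} [AddCommGroup V] [Module K V] [AddCommGroup V'] [Module K V']
    (e : V' ≃ₗ[K] V) (Q : QuadraticForm K V) (hR : Rd Q) (hL : Lg Q) :
    Rd (Q.comp e.toLinearMap) ∧ Lg (Q.comp e.toLinearMap) ∧ (Nd Q → Nd (Q.comp e.toLinearMap)) := by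
  have hpol : ∀ x y, polar (Q.comp e.toLinearMap) x y = polar Q (e x) (e y) := by
    intro x y; simp [polar]
  refine ⟨?_, ?_, ?_⟩
  · intro x
    obtain ⟨A, A', h1, h3, h4⟩ := hR (e x)
    refine ⟨e.symm.toLinearMap ∘ₗ A ∘ₗ e.toLinearMap, e.symm.toLinearMap ∘ₗ A' ∘ₗ e.toLinearMap, ?_, ?_, ?_⟩
    · intro y; simp [h1]
    · intro y; simp [h3]
    · intro y z; simp [hpol, h4]
  · rintro ⟨x, hx, h0⟩
    obtain ⟨W, h1, h3⟩ := hL ⟨e x, by simpa using hx, by simpa using h0⟩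
    refine ⟨W.map e.symm.toLinearMap, ?_, ?_⟩
    · rw [LinearEquiv.finrank_eq e, ← h1]
      exact congrArg _ (LinearEquiv.finrank_map_eq e.symm W)
    · rintro _ ⟨w, hw, rfl⟩
      simpa using h3 w hw
  · intro h x hx
    have : e x = 0 := h (e x) fun y => by
      have := hx (e.symm y); rw [hpol] at this; simpa using this
    simpa using this

theorem pf_main (h2 : (2:K) = 0) : ∀ (k : ℕ) (a : Fin k → K) (c : K),
    ∃ Q : QuadraticForm K (PI k → K), (∀ x, Q x = pv a c x) ∧ Rd Q ∧ Lg Q ∧ ((∀ i, a i ≠ 0) → Nd Q) := by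
  intro k
  induction k with
  | zero =>
    intro a c
    obtain ⟨Q, hQ, hR, hL, hN⟩ := base_case h2 c
    let e : (PI 0 → K) ≃ₗ[K] (Fin 2 → K) :=
      LinearEquiv.funCongrLeft K K (Equiv.uniqueProd (Fin 2) (Fin 0 → Fin 2)).symm
    obtain ⟨t1, t2, t3⟩ := transport e Q hR hL
    refine ⟨_, ?_, t1, t2, fun _ => t3 hN⟩
    intro x
    simp only [QuadraticMap.comp_apply, LinearEquiv.coe_coe, hQ, pv]
    have he : ∀ j f, e x j = x (f, j) := fun j f => by
      change x _ = x _
      exact congrArg x (Prod.ext (Subsingleton.elim _ _) rfl)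
    rw [Fintype.sum_unique, ← he 0, ← he 1]
    simp [pm]
  | succ k ih =>
    intro a c
    obtain ⟨Q, hQ, hR, hL, hN⟩ := ih (Fin.tail a) c
    obtain ⟨t1, t2, t3⟩ := transport (pl2 k) (dbl (a 0) Q) (hR.dbl h2 _) (hL.dbl h2 hR _)
    refine ⟨_, ?_, t1, t2, fun h => t3 ((hN fun i => h i.succ).dbl (h 0))⟩
    intro x
    simp only [QuadraticMap.comp_apply, LinearEquiv.coe_coe, dbl_apply, hQ, pv_succ]

theorem pf_main2 (h2 : (2:K) = 0) (k : ℕ) (a : Fin k → K) (c : K) :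
    Rd (toQ (QF.qPfister a c)) ∧ Lg (toQ (QF.qPfister a c)) ∧
      ((∀ i, a i ≠ 0) → Nd (toQ (QF.qPfister a c))) := by
  obtain ⟨Q, hQ, hR, hL, hN⟩ := pf_main h2 k a c
  let e : (Fin (2^k*2) → K) ≃ₗ[K] (PI k → K) := LinearEquiv.funCongrLeft K K (pe k)
  obtain ⟨t1, t2, t3⟩ := transport e Q hR hL
  have : toQ (QF.qPfister a c) = Q.comp e.toLinearMap := by
    ext x
    rw [toQ_apply, ev_qPfister, QuadraticMap.comp_apply, hQ]; rfl
  rw [this]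
  exact ⟨t1, t2, fun h => t3 (hN h)⟩

theorem pf_mul (h2 : (2:K) = 0) {k : ℕ} (a : Fin k → K) (c : K) (x y : Fin (2^k*2) → K) :
    ∃ z, ev (QF.qPfister a c) z = ev (QF.qPfister a c) x * ev (QF.qPfister a c) y := by
  obtain ⟨A, _, h, _⟩ := (pf_main2 h2 k a c).1 x
  exact ⟨A y, h y⟩

theorem pf_lag (h2 : (2:K) = 0) {k : ℕ} (a : Fin k → K) (c : K) (h : Is (QF.qPfister a c)) :
    ∃ W : Submodule K (Fin (2^k*2) → K), Module.finrank K W = 2^k ∧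
      ∀ x ∈ W, ev (QF.qPfister a c) x = 0 := by
  obtain ⟨W, h1, h3⟩ := (pf_main2 h2 k a c).2.1 h
  refine ⟨W, ?_, h3⟩
  rw [Module.finrank_fin_fun] at h1
  omega

theorem pf_nd (h2 : (2:K) = 0) {k : ℕ} (a : Fin k → K) (c : K) (h : ∀ i, a i ≠ 0) (x : Fin (2^k*2) → K)
    (hx : ∀ y, pl (QF.qPfister a c) x y = 0) : x = 0 :=
  (pf_main2 h2 k a c).2.2 h x fun y => by rw [toQ_polar, hx]

theorem pf_sig {k : ℕ} (a : Fin k → K) (c : K) (h : An (QF.qPfister a c)) (u : (Fin k → Fin 2) → K)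
    (hu : ∑ f, pm a f * u f ^2 = 0) : u = 0 := by
  have := h (fun i => if ((pe k).symm i).2 = 0 then u ((pe k).symm i).1 else 0) (by
    rw [ev_qPfister, pv]
    simpa [Function.comp] using hu)
  ext f
  have h3 := congrFun this (pe k (f, 0))
  simpa using h3

theorem pf_slots {k : ℕ} (a : Fin k → K) (c : K) (h : An (QF.qPfister a c)) (i : Fin k) : a i ≠ 0 := by
  intro h0
  have := pf_sig a c h (fun f => if f = Pi.single i 1 then 1 else 0) (by
    simp [pm]
    exact Finset.prod_eq_zero (Finset.mem_univ i) (by simp [h0]))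
  have := congrFun this (Pi.single i 1)
  simp at this

end Conc
end QX

set_option linter.all false
namespace QX
open Polynomial

section Sep
variable {F K L : Type} [Field F] [Field K] [Field L]

/-- preservation of anisotropy of diagonal forms of degree `2^e` -/
def Sep (i : F →+* K) : Prop := ∀ (e n : ℕ) (c : Fin n → F),
  (∀ x : Fin n → F, ∑ j, c j * x j ^ (2^e) = 0 → x = 0) →
  ∀ z : Fin n → K, ∑ j, i (c j) * z j ^ (2^e) = 0 → z = 0

lemma Sep.comp {i : F →+* K} {j : K →+* L} (hi : Sep i) (hj : Sep j) : Sep (j.comp i) := by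
  intro e n c hc
  exact hj e n (fun t => i (c t)) (hi e n c hc)

lemma Sep.refl : Sep (RingHom.id F) := fun e n c h => h

/-- enough points -/
def Pts {E R : Type} [Field E] [CommRing R] (C : E →+* R) : Prop :=
  ∀ p : R, p ≠ 0 → ∃ φ : R →+* E, (∀ x, φ (C x) = x) ∧ φ p ≠ 0

lemma pts_mv (E : Type) [Field E] [Infinite E] (m : ℕ) : Pts (MvPolynomial.C : E →+* MvPolynomial (Fin m) E) := by
  intro p hp
  by_contra hcon
  push Not at hcon
  apply hp
  apply MvPolynomial.funext
  intro x
  rw [map_zero]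
  exact hcon (MvPolynomial.eval x) (by simp)

lemma pts_poly (E : Type) [Field E] [Infinite E] : Pts (C : E →+* E[X]) := by
  intro p hp
  by_contra hcon
  push Not at hcon
  apply hp
  apply Polynomial.funext
  intro x
  rw [eval_zero]
  exact hcon (evalRingHom x) (by simp)

lemma clear_den {R : Type} [CommRing R] [IsDomain R] {ι : Type} [Finite ι] (z : ι → FractionRing R) :
    ∃ (d : R) (p : ι → R), d ≠ 0 ∧ ∀ t, algebraMap R (FractionRing R) (p t) = algebraMap R (FractionRing R) d * z t := by
  obtain ⟨b, hb⟩ := IsLocalization.exist_integer_multiples_of_finite (nonZeroDivisors R) z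
  choose p hp using hb
  refine ⟨b, p, nonZeroDivisors.ne_zero b.2, fun t => ?_⟩
  rw [hp, Algebra.smul_def]

variable {R : Type} [CommRing R] [IsDomain R]

lemma sep_pts {C : F →+* R} (h : Pts C) : Sep ((algebraMap R (FractionRing R)).comp C) := by
  intro e n c hc z hz
  obtain ⟨d, p, hd, hp⟩ := clear_den z
  have hinj : Function.Injective (algebraMap R (FractionRing R)) := IsFractionRing.injective _ _
  have h0 : ∑ j, C (c j) * p j ^ (2^e) = 0 := by
    apply hinj
    rw [map_zero, map_sum]
    simp only [map_mul, map_pow, hp, mul_pow]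
    have := congrArg (fun t => algebraMap R (FractionRing R) d ^ (2^e) * t) hz
    simp only [mul_zero, Finset.mul_sum] at this
    rw [← this]
    refine Finset.sum_congr rfl fun j _ => ?_
    simp only [RingHom.comp_apply]; ring
  ext j
  have hpj : p j = 0 := by
    by_contra hne
    obtain ⟨φ, h1, h2⟩ := h (p j) hne
    have := congrArg φ h0
    simp only [map_sum, map_mul, map_pow, h1, map_zero] at this
    exact h2 (congrFun (hc (fun t => φ (p t)) this) j)
  have := hp j
  rw [hpj, map_zero] at this
  have hd' : algebraMap R (FractionRing R) d ≠ 0 := by rwa [Ne, map_eq_zero_iff _ hinj]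
  simpa [hd'] using this.symm

lemma an_pts {ι : Type} [Fintype ι] {C : F →+* R} (h : Pts C) (q : Matrix ι ι F) (hq : An q) :
    An (q.map ((algebraMap R (FractionRing R)).comp C)) := by
  intro z hz
  obtain ⟨d, p, hd, hp⟩ := clear_den z
  have hinj : Function.Injective (algebraMap R (FractionRing R)) := IsFractionRing.injective _ _
  have h0 : ev (q.map C) p = 0 := by
    apply hinj
    rw [map_zero, map_ev, Matrix.map_map]
    have : (fun i => algebraMap R (FractionRing R) (p i)) = algebraMap R (FractionRing R) d • z := by
      ext i; simp [hp]
    rw [this, ev_smul]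
    have hz' : ev (q.map (⇑(algebraMap R (FractionRing R)) ∘ ⇑C)) z = 0 := hz
    rw [hz', mul_zero]
  ext j
  have hpj : p j = 0 := by
    by_contra hne
    obtain ⟨φ, h1, h2⟩ := h (p j) hne
    have := congrArg φ h0
    rw [map_ev, map_zero, Matrix.map_map] at this
    have e : q.map (φ ∘ C) = q := by ext a b; simp [h1]
    rw [e] at this
    exact h2 (congrFun (hq _ this) j)
  have := hp j
  rw [hpj, map_zero] at this
  have hd' : algebraMap R (FractionRing R) d ≠ 0 := by rwa [Ne, map_eq_zero_iff _ hinj]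
  simpa [hd'] using this.symm

lemma poly_zero_of_max {n : Type} [Fintype n] (p : n → F[X])
    (h : ∀ D, (∀ j, (p j).natDegree ≤ D) → ∀ j, (p j).coeff D = 0) : p = 0 := by
  have key : ∀ D, (∀ j, (p j).natDegree ≤ D) → p = 0 := by
    intro D
    induction D with
    | zero =>
      intro hD
      ext1 j
      have := h 0 hD j
      rw [eq_C_of_natDegree_le_zero (hD j), this, C_0]; rfl
    | succ D ih =>
      intro hD
      apply ih
      intro j
      have h1 := h _ hD j
      by_contra hlt
      have h2 : (p j).natDegree = D + 1 := le_antisymm (hD j) (by omega)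
      have h3 : (p j).leadingCoeff = 0 := by rw [leadingCoeff, h2, h1]
      rw [leadingCoeff_eq_zero] at h3
      rw [h3] at h2; simp at h2
  exact key (Finset.univ.sup fun j => (p j).natDegree) fun j =>
    Finset.le_sup (f := fun j => (p j).natDegree) (Finset.mem_univ j)

lemma sep_ratfunc : Sep ((algebraMap F[X] (FractionRing F[X])).comp C) := by
  intro e n c hc z hz
  obtain ⟨d, p, hd, hp⟩ := clear_den z
  have hinj : Function.Injective (algebraMap F[X] (FractionRing F[X])) := IsFractionRing.injective _ _
  have h0 : ∑ j, C (c j) * p j ^ (2^e) = 0 := by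
    apply hinj
    rw [map_zero, map_sum]
    simp only [map_mul, map_pow, hp, mul_pow]
    have := congrArg (fun t => algebraMap F[X] (FractionRing F[X]) d ^ (2^e) * t) hz
    simp only [mul_zero, Finset.mul_sum] at this
    rw [← this]
    refine Finset.sum_congr rfl fun j _ => ?_
    simp only [RingHom.comp_apply]; ring
  have hpp : p = 0 := by
    apply poly_zero_of_max
    intro D hD j
    have := congrArg (fun t => coeff t (2^e * D)) h0
    simp only [finset_sum_coeff, coeff_C_mul, coeff_zero] at this
    have h3 := hc (fun j => (p j).coeff D) (by
      rw [← this]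
      refine Finset.sum_congr rfl fun j _ => ?_
      rw [coeff_pow_of_natDegree_le (hD j)])
    exact congrFun h3 j
  ext j
  have := hp j
  rw [hpp, Pi.zero_apply, map_zero] at this
  have hd' : algebraMap F[X] (FractionRing F[X]) d ≠ 0 := by rwa [Ne, map_eq_zero_iff _ hinj]
  simpa [hd'] using this.symm

theorem quadExt (b c : F) (hr : ∀ x, x^2 + b * x + c ≠ 0) : ∃ (K : Type) (_ : Field K) (i : F →+* K) (α : K),
    α^2 + i b * α + i c = 0 ∧ (∀ z, ∃ x y, z = i x + i y * α) ∧
    (∀ x y, i x + i y * α = 0 → x = 0 ∧ y = 0) ∧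
    (∀ (L : Type) (_ : Field L) (j : F →+* L) (β : L), β^2 + j b * β + j c = 0 →
      ∃ φ : K →+* L, (∀ x, φ (i x) = j x) ∧ φ α = β) := by
  set f : F[X] := X^2 + C b * X + C c with hf
  have hdeg : f.natDegree = 2 := by rw [hf]; compute_degree!
  have hmon : f.Monic := by rw [hf]; monicity!
  have hirr : Irreducible f := by
    apply irreducible_of_degree_le_three_of_not_isRoot
    · rw [hdeg]; simp
    · intro x hx; apply hr x; simpa [hf, IsRoot] using hx
  haveI := Fact.mk hirr
  refine ⟨AdjoinRoot f, inferInstance, AdjoinRoot.of f, AdjoinRoot.root f, ?_, ?_, ?_, ?_⟩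
  · have := AdjoinRoot.eval₂_root f
    simpa [hf] using this
  · intro z
    obtain ⟨p, rfl⟩ := AdjoinRoot.mk_surjective z
    have h1 : AdjoinRoot.mk f p = AdjoinRoot.mk f (p %ₘ f) := by
      rw [AdjoinRoot.mk_eq_mk]
      exact ⟨p /ₘ f, by rw [eq_comm, eq_sub_iff_add_eq, add_comm]; exact modByMonic_add_div p f⟩
    have h2 : (p %ₘ f).natDegree ≤ 1 := by
      have := natDegree_modByMonic_lt p hmon (by intro h; rw [h] at hdeg; simp at hdeg)
      omega
    refine ⟨(p %ₘ f).coeff 0, (p %ₘ f).coeff 1, ?_⟩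
    rw [h1]
    conv_lhs => rw [eq_X_add_C_of_natDegree_le_one h2]
    simp [add_comm]
  · intro x y h
    have h1 : AdjoinRoot.mk f (C x + C y * X) = 0 := by simpa using h
    rw [AdjoinRoot.mk_eq_zero] at h1
    have h2 : C x + C y * X = 0 := by
      by_contra hne
      have h3 := natDegree_le_of_dvd h1 hne
      have h4 : (C x + C y * X).natDegree ≤ 1 := by compute_degree
      omega
    have a1 := congrArg (fun t => coeff t 0) h2
    have a2 := congrArg (fun t => coeff t 1) h2
    simp [coeff_C] at a1 a2
    exact ⟨a1, a2⟩
  · intro L _ j β hβ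
    refine ⟨AdjoinRoot.lift j β (by simpa [hf] using hβ), fun x => by simp, by simp⟩

lemma sep_quad (h2 : (2:F) = 0) (b c : F) (hb : b ≠ 0) (i : F →+* K) (α : K) (hα : α^2 + i b * α + i c = 0)
    (hs : ∀ z, ∃ x y, z = i x + i y * α) (hi : ∀ x y, i x + i y * α = 0 → x = 0 ∧ y = 0) : Sep i := by
  have h2K : (2:K) = 0 := two_map i h2
  haveI : CharP K 2 := CharTwo.of_one_ne_zero_of_two_eq_zero one_ne_zero h2K
  intro e n d hd z hz
  have hpow : ∀ e : ℕ, ∃ u v, v ≠ 0 ∧ α^(2^e) = i u + i v * α := by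
    intro e
    induction e with
    | zero => exact ⟨0, 1, one_ne_zero, by simp⟩
    | succ e ih =>
      obtain ⟨u, v, hv, h⟩ := ih
      refine ⟨u^2 + v^2 * c, v^2 * b, by simp [hv, hb], ?_⟩
      rw [pow_succ, pow_mul, h]
      simp only [map_add, map_mul, map_pow]
      linear_combination (i v)^2 * hα + (i u * i v * α - i v ^2 * i b * α - i v ^ 2 * i c) * h2K
  obtain ⟨u, v, hv, hu⟩ := hpow e
  choose x y hxy using hs
  have h1 : i (∑ j, d j * x (z j)^(2^e) + (∑ j, d j * y (z j)^(2^e)) * u) +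
     i ((∑ j, d j * y (z j)^(2^e)) * v) * α = 0 := by
    rw [← hz]
    simp only [map_add, map_mul, map_sum, map_pow, Finset.sum_mul]
    rw [← Finset.sum_add_distrib, ← Finset.sum_add_distrib]
    refine Finset.sum_congr rfl fun j _ => ?_
    conv_rhs => rw [hxy (z j), add_pow_char_pow, mul_pow, hu]
    ring
  obtain ⟨h3, h4⟩ := hi _ _ h1
  have h5 : ∑ j, d j * y (z j)^(2^e) = 0 := by simpa [hv] using h4
  rw [h5] at h3
  have h6 := hd (fun j => y (z j)) h5
  have h7 := hd (fun j => x (z j)) (by simpa using h3)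
  ext j
  rw [hxy (z j)]
  have t1 : y (z j) = 0 := congrFun h6 j
  have t2 : x (z j) = 0 := congrFun h7 j
  rw [t1, t2]; simp

/-- isotropy over a quadratic extension gives a value -/
lemma quad_value {ι : Type} [Fintype ι] (b c : F) (i : F →+* K) (α : K) (hα : α^2 + i b * α + i c = 0)
    (hs : ∀ z, ∃ x y, z = i x + i y * α) (hi : ∀ x y, i x + i y * α = 0 → x = 0 ∧ y = 0)
    (q : Matrix ι ι F) (hq : An q) (hK : Is (q.map i)) :
    ∃ w0 w1, ev q w1 ≠ 0 ∧ ev q w0 = c * ev q w1 := by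
  obtain ⟨z, hz, h0⟩ := hK
  choose x y hxy using hs
  have hzz : z = (fun t => i (x (z t))) + α • (fun t => i (y (z t))) := by
    ext t; simp only [Pi.add_apply, Pi.smul_apply, smul_eq_mul]; conv_lhs => rw [hxy (z t)]
    ring
  set w0 := fun t => x (z t)
  set w1 := fun t => y (z t)
  rw [hzz, ev_add, ev_smul, pl_smul_right] at h0
  have e1 := map_ev i q w0
  have e2 := map_ev i q w1
  have e3 := map_pl i q w0 w1
  rw [← e1, ← e2, ← e3] at h0
  have h1 : i (ev q w0 - c * ev q w1) + i (pl q w0 w1 - b * ev q w1) * α = 0 := by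
    simp only [map_sub, map_mul]
    linear_combination h0 - i (ev q w1) * hα
  have h4 := (hi _ _ h1).1
  refine ⟨w0, w1, fun h => hz ?_, sub_eq_zero.1 h4⟩
  rw [h, mul_zero, sub_zero] at h4
  have a1 := hq _ h; have a0 := hq _ h4
  ext t
  have t1 : y (z t) = 0 := congrFun a1 t
  have t2 : x (z t) = 0 := congrFun a0 t
  rw [hxy (z t), t1, t2]; simp

end Sep
end QX

set_option linter.all false
namespace QX
open Polynomial

section CP
variable {k : Type} [Field k] {N : Type} [Fintype N]

lemma ev_natDegree_le (ρ : Matrix N N k) (R : N → k[X]) (d : ℕ) (h : ∀ i, (R i).natDegree ≤ d) :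
    (ev (ρ.map C) R).natDegree ≤ 2 * d := by
  unfold ev
  refine natDegree_sum_le_of_forall_le _ _ fun i _ => natDegree_sum_le_of_forall_le _ _ fun j _ => ?_
  rw [Matrix.map_apply, mul_assoc]
  refine (natDegree_C_mul_le _ _).trans (natDegree_mul_le.trans ?_)
  have := h i; have := h j; omega

lemma coeff_ev (ρ : Matrix N N k) (R : N → k[X]) (d : ℕ) (h : ∀ i, (R i).natDegree ≤ d) :
    (ev (ρ.map C) R).coeff (2 * d) = ev ρ (fun i => (R i).coeff d) := by
  unfold ev
  simp only [finset_sum_coeff, Matrix.map_apply, mul_assoc, coeff_C_mul]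
  refine Finset.sum_congr rfl fun i _ => Finset.sum_congr rfl fun j _ => ?_
  rw [two_mul, coeff_mul_add_eq_of_natDegree_le (h i) (h j)]

lemma ev_poly_an (ρ : Matrix N N k) (hρ : An ρ) (R : N → k[X]) (h : ev (ρ.map C) R = 0) : R = 0 := by
  apply poly_zero_of_max
  intro D hD j
  have := coeff_ev ρ R D hD
  rw [h, coeff_zero] at this
  exact congrFun (hρ _ this.symm) j

lemma ev_poly_deg (ρ : Matrix N N k) (hρ : An ρ) (e : ℕ) (R : N → k[X]) (h : (ev (ρ.map C) R).natDegree ≤ 2 * e) :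
    ∀ i, (R i).natDegree ≤ e := by
  have key : ∀ d, (∀ i, (R i).natDegree ≤ e + d) → ∀ i, (R i).natDegree ≤ e := by
    intro d
    induction d with
    | zero => intro h; exact h
    | succ d ih =>
      intro hd
      apply ih
      intro i
      have h1 := coeff_ev ρ R (e + (d+1)) hd
      rw [coeff_eq_zero_of_natDegree_lt (by omega)] at h1
      have h3 : (R i).coeff (e+(d+1)) = 0 := congrFun (hρ _ h1.symm) i
      by_contra hlt
      have h4 : (R i).natDegree = e + (d+1) := le_antisymm (hd i) (by omega)
      have h5 : (R i).leadingCoeff = 0 := by rw [leadingCoeff, h4, h3]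
      rw [leadingCoeff_eq_zero] at h5
      rw [h5] at h4; simp at h4
  refine key (Finset.univ.sup fun j => (R j).natDegree) fun j => ?_
  have := Finset.le_sup (f := fun j => (R j).natDegree) (Finset.mem_univ j)
  omega

lemma pl_const_deg (ρ : Matrix N N k) (R : N → k[X]) (w : N → k) (d : ℕ) (h : ∀ i, (R i).natDegree ≤ d) :
    (pl (ρ.map C) R (fun i => C (w i))).natDegree ≤ d := by
  unfold pl bl
  refine natDegree_add_le_of_degree_le ?_ ?_ <;>
  refine natDegree_sum_le_of_forall_le _ _ fun i _ => natDegree_sum_le_of_forall_le _ _ fun j _ => ?_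
  · rw [Matrix.map_apply]
    refine natDegree_mul_le.trans ?_
    rw [natDegree_C, add_zero]
    exact (natDegree_C_mul_le _ _).trans (h i)
  · rw [Matrix.map_apply, ← C_mul]
    exact (natDegree_C_mul_le _ _).trans (h j)

theorem cp (h2 : (2:k) = 0) (ρ : Matrix N N k) (hρ : An ρ) {ι : Type} (w : ι → N → k) (Y : N → k[X]) (g : k[X]) :
    ∀ (n : ℕ) (h : k[X]) (V : N → k[X]), h.natDegree ≤ n → h ≠ 0 → ev (ρ.map C) V = h^2 * g →
      (∀ l, pl (ρ.map C) V (fun i => C (w l i)) = h * pl (ρ.map C) Y (fun i => C (w l i))) →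
      ∃ V, ev (ρ.map C) V = g ∧ ∀ l, pl (ρ.map C) V (fun i => C (w l i)) = pl (ρ.map C) Y (fun i => C (w l i)) := by
  have h2X : (2:k[X]) = 0 := by
    have := congrArg C h2; rwa [map_ofNat, map_zero] at this
  intro n
  induction n with
  | zero =>
    intro h V hn hh h1 h3
    obtain ⟨c, rfl⟩ : ∃ c, h = C c := ⟨_, eq_C_of_natDegree_le_zero hn⟩
    have hc : c ≠ 0 := by rintro rfl; simp at hh
    have hcc : C c⁻¹ * C c = 1 := by rw [← C_mul, inv_mul_cancel₀ hc, C_1]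
    refine ⟨C c⁻¹ • V, ?_, ?_⟩
    · rw [ev_smul, h1]
      linear_combination (g + g * C c⁻¹ * C c) * hcc
    · intro l
      rw [pl_smul_left, h3]
      linear_combination (pl (ρ.map C) Y (fun i => C (w l i))) * hcc
  | succ n ih =>
    intro h V hn hh h1 h3
    let G : N → k[X] := fun i => (V i - h * Y i) / h
    let R : N → k[X] := fun i => (V i - h * Y i) % h
    have hVR : V = h • (Y + G) + R := by
      ext1 i
      have := EuclideanDomain.div_add_mod (V i - h * Y i) h
      simp only [Pi.add_apply, Pi.smul_apply, smul_eq_mul, G, R]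
      linear_combination -this
    have hR : ∀ i, (R i).degree < h.degree := fun i => EuclideanDomain.mod_lt _ hh
    obtain ⟨g0, hg0⟩ : ∃ g0, g0 = Y + G := ⟨_, rfl⟩
    rw [← hg0] at hVR
    by_cases hR0 : R = 0
    · rw [hR0, add_zero] at hVR
      refine ⟨g0, ?_, ?_⟩
      · rw [hVR, ev_smul] at h1
        exact mul_left_cancel₀ (pow_ne_zero 2 hh) h1
      · intro l
        have := h3 l
        rw [hVR, pl_smul_left] at this
        exact mul_left_cancel₀ hh this
    have hRn : ∀ i, (R i).natDegree ≤ h.natDegree - 1 := by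
      intro i
      by_cases hi : R i = 0
      · simp [hi]
      · have := natDegree_lt_natDegree hi (hR i); omega
    have hpos : 0 < h.natDegree := by
      by_contra h0
      have h00 : h.natDegree = 0 := by omega
      obtain ⟨i, hi⟩ := Function.ne_iff.1 hR0
      have := natDegree_lt_natDegree hi (hR i); omega
    set h' := h * (g + ev (ρ.map C) g0) + pl (ρ.map C) V g0 with hh'
    have eR : ev (ρ.map C) R = h * h' := by
      have e1 : R = V + h • g0 := by
        ext1 i
        have := congrFun hVR i
        simp only [Pi.add_apply, Pi.smul_apply, smul_eq_mul] at this ⊢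
        rw [this]; linear_combination - h * g0 i * h2X
      rw [e1, ev_add, ev_smul, pl_smul_right, h1, hh']; ring
    have hpgR : pl (ρ.map C) g0 R = pl (ρ.map C) V g0 := by
      conv_rhs => rw [hVR]
      rw [pl_add_left, pl_smul_left, pl_self, pl_comm _ R g0]
      linear_combination (-h * ev (ρ.map C) g0) * h2X
    have hne : h' ≠ 0 := by
      intro h0
      rw [h0, mul_zero] at eR
      exact hR0 (ev_poly_an ρ hρ R eR)
    have hdeg : h'.natDegree ≤ n := by
      have a1 := ev_natDegree_le ρ R _ hRn
      rw [eR, natDegree_mul hh hne] at a1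
      omega
    refine ih h' (h' • g0 + (ev (ρ.map C) g0 + g) • R) hdeg hne ?_ ?_
    · rw [ev_add, ev_smul, ev_smul, pl_smul_left, pl_smul_right, eR, hpgR, hh']
      linear_combination ((h * (g + ev (ρ.map C) g0) + pl (ρ.map C) V g0) ^ 2 * ev (ρ.map C) g0) * h2X
    · intro l
      have a1 := h3 l
      have a2 := pl_const_deg ρ R (w l) _ hRn
      set W := fun i => C (w l i)
      rw [hVR, hg0, pl_add_left, pl_smul_left, pl_add_left] at a1
      have a3 : h * (- pl (ρ.map C) G W) = pl (ρ.map C) R W := by linear_combination - a1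
      have a4 : pl (ρ.map C) G W = 0 := by
        by_contra hne
        have := natDegree_mul hh (neg_ne_zero.2 hne)
        rw [a3] at this
        omega
      have a5 : pl (ρ.map C) R W = 0 := by rw [← a3, a4]; simp
      rw [pl_add_left, pl_smul_left, pl_smul_left, a5, hg0, pl_add_left, a4]
      ring

end CP

section Spec
variable {E : Type} [Field E]

/-- `C ∘ g` as a ring hom to the rational function field -/
noncomputable def tof (E : Type) [Field E] : E →+* FractionRing E[X] := (algebraMap E[X] (FractionRing E[X])).comp C

lemma an_tof {N : Type} [Fintype N] (ρ : Matrix N N E) (hρ : An ρ) : An (ρ.map (tof E)) := by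
  intro z hz
  obtain ⟨d, p, hd, hp⟩ := clear_den z
  have hinj : Function.Injective (algebraMap E[X] (FractionRing E[X])) := IsFractionRing.injective _ _
  have h0 : ev (ρ.map C) p = 0 := by
    apply hinj
    rw [map_zero, map_ev, Matrix.map_map]
    have : (fun i => algebraMap E[X] (FractionRing E[X]) (p i)) = algebraMap E[X] (FractionRing E[X]) d • z := by
      ext i; simp [hp]
    rw [this, ev_smul]
    have hz' : ev (ρ.map (⇑(algebraMap E[X] (FractionRing E[X])) ∘ ⇑C)) z = 0 := hz
    rw [hz', mul_zero]
  have hpp := ev_poly_an ρ hρ p h0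
  ext j
  have := hp j
  rw [hpp, Pi.zero_apply, map_zero] at this
  have hd' : algebraMap E[X] (FractionRing E[X]) d ≠ 0 := by rwa [Ne, map_eq_zero_iff _ hinj]
  simpa [hd'] using this.symm

theorem spec (h2 : (2:E) = 0) [Infinite E] {m N : ℕ} (τ : Matrix (Fin m) (Fin m) E) (ρ : Matrix (Fin N) (Fin N) E) (a : E)
    (h : MvPolynomial (Fin m) E) (hh : h ≠ 0) (V : Fin N → MvPolynomial (Fin m) E)
    (hV : ev (ρ.map MvPolynomial.C) V = h^2 * (MvPolynomial.C a * ev (τ.map MvPolynomial.C) MvPolynomial.X))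
    (K : Type) [Field K] (g : E →+* K) (hK : An (ρ.map g)) (x : Fin m → K) :
    ∃ v, ev (ρ.map g) v = g a * ev (τ.map g) x := by
  obtain ⟨Y, hY⟩ : ∃ Y, MvPolynomial.eval Y h ≠ 0 := by
    by_contra hcon
    push Not at hcon
    exact hh (MvPolynomial.funext fun x => by rw [hcon, map_zero])
  let φ : MvPolynomial (Fin m) E →+* K[X] :=
    MvPolynomial.eval₂Hom (C.comp g) (fun i => C (x i) + X * (C (g (Y i)) - C (x i)))
  have hφC : ∀ a, φ (MvPolynomial.C a) = C (g a) := fun a => by simp [φ]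
  have hφX : ∀ i, φ (MvPolynomial.X i) = C (x i) + X * (C (g (Y i)) - C (x i)) := fun a => by simp [φ]
  have hφh : φ h ≠ 0 := by
    intro h0
    have h1 : ((evalRingHom 1).comp φ) = g.comp (MvPolynomial.eval Y) := by
      apply MvPolynomial.ringHom_ext
      · intro r; simp [hφC]
      · intro i; simp [hφX]
    have h3 := congrArg (fun f => f h) h1
    simp only [RingHom.comp_apply, h0, map_zero] at h3
    exact hY ((map_eq_zero g).1 h3.symm)
  have hV' := congrArg φ hV
  rw [map_mul, map_pow, map_mul, map_ev, map_ev, hφC] at hV'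
  have m1 : (ρ.map MvPolynomial.C).map φ = (ρ.map g).map C := by ext i j; simp [hφC]
  have m2 : (τ.map MvPolynomial.C).map φ = (τ.map g).map C := by ext i j; simp [hφC]
  rw [m1, m2] at hV'
  obtain ⟨V', h1, -⟩ := cp (two_map g h2) (ρ.map g) hK (ι := Empty) (fun l => l.elim) 0 _ _ _ _ le_rfl hφh hV'
    (fun l => l.elim)
  refine ⟨fun i => (evalRingHom 0) (V' i), ?_⟩
  have h3 := congrArg (evalRingHom 0) h1
  rw [map_ev, map_mul, map_ev] at h3
  have m3 : ((ρ.map g).map C).map (evalRingHom 0) = ρ.map g := by ext i j; simp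
  have m4 : ((τ.map g).map C).map (evalRingHom 0) = τ.map g := by ext i j; simp
  rw [m3, m4] at h3
  rw [h3]
  simp [hφX]

end Spec

section LemL
variable {E : Type} [Field E] {M N : Type} [Fintype M] [Fintype N]

theorem lemL (h2 : (2:E) = 0) (τ : Matrix M M E) (ρ : Matrix N N E)
    (H0 : ∀ (K : Type) [Field K] (g : E →+* K), An (ρ.map g) → ∀ x, ∃ v, ev (ρ.map g) v = ev (τ.map g) x)
    {ι : Type} (e : ι → M → E) (w : ι → N → E)
    (hp : ∀ a b, pl τ (e a) (e b) = pl ρ (w a) (w b)) (s : Finset ι) (hev : ∀ a ∈ s, ev τ (e a) = ev ρ (w a)) :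
    ∀ (K : Type) [Field K] (g : E →+* K), An (ρ.map g) → ∀ x : M → K, ∃ v, ev (ρ.map g) v = ev (τ.map g) x ∧
      ∀ l ∈ s, pl (ρ.map g) v (fun i => g (w l i)) = pl (τ.map g) x (fun i => g (e l i)) := by
  classical
  induction s using Finset.induction_on with
  | empty =>
    intro K _ g hg x
    obtain ⟨v, hv⟩ := H0 K g hg x
    exact ⟨v, hv, by simp⟩
  | insert a s ha ih =>
    have ih := ih (fun b hb => hev b (Finset.mem_insert_of_mem hb))
    intro K _ g hg x
    have h2K := two_map g h2
    obtain ⟨vx, hvx, hvx2⟩ := ih K g hg x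
    have hg' : An (ρ.map ((tof K).comp g)) := by
      have := an_tof _ hg
      rwa [Matrix.map_map] at this
    set A := algebraMap K[X] (FractionRing K[X]) with hA
    have hinj : Function.Injective A := IsFractionRing.injective _ _
    let XX : M → K[X] := (fun i => C (x i)) + (X : K[X]) • (fun i => C (g (e a i)))
    obtain ⟨v', hv', hv'2⟩ := ih (FractionRing K[X]) ((tof K).comp g) hg' (fun i => A (XX i))
    obtain ⟨d, V, hd, hV⟩ := clear_den v'
    have hVd : (fun i => A (V i)) = A d • v' := by ext i; simp [hV, hA]
    have m1 : ((ρ.map g).map C).map A = ρ.map ((tof K).comp g) := by ext i j; simp [tof, hA]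
    have m2 : ((τ.map g).map C).map A = τ.map ((tof K).comp g) := by ext i j; simp [tof, hA]
    have c1 : ev ((ρ.map g).map C) V = d^2 * ev ((τ.map g).map C) XX := by
      apply hinj
      rw [map_ev, m1, hVd, ev_smul, hv', map_mul, map_pow, map_ev, m2]
    let ws : s → N → K := fun l i => g (w l i)
    let Y : N → K[X] := (fun i => C (vx i)) + (X : K[X]) • (fun i => C (g (w a i)))
    have c2 : ∀ l : s, pl ((ρ.map g).map C) V (fun i => C (ws l i)) = d * pl ((ρ.map g).map C) Y (fun i => C (ws l i)) := by
      intro l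
      have b1 : pl ((ρ.map g).map C) V (fun i => C (ws l i)) = d * pl ((τ.map g).map C) XX (fun i => C (g (e l i))) := by
        apply hinj
        rw [map_pl, m1, hVd, pl_smul_left, map_mul, map_pl, m2]
        exact congrArg _ (hv'2 l l.2)
      rw [b1]
      congr 1
      simp only [XX, Y, pl_add_left, pl_smul_left]
      rw [← map_pl C, ← map_pl C, ← map_pl C, ← map_pl C]
      have b2 := hvx2 l l.2
      have b3 := congrArg g (hp a l)
      rw [map_pl, map_pl] at b3
      simp only [ws]
      rw [b2, b3]
    obtain ⟨W, hW1, hW2⟩ := cp h2K (ρ.map g) hg ws Y _ _ d V le_rfl hd c1 c2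
    have hexp : ∀ (n : Type) [Fintype n] (q : Matrix n n K) (u v : n → K),
        ev (q.map C) ((fun i => C (u i)) + (X : K[X]) • (fun i => C (v i))) =
          C (ev q u) + X^2 * C (ev q v) + X * C (pl q u v) := by
      intro n _ q u v
      rw [ev_add, ev_smul, pl_smul_right, ← map_ev C, ← map_ev C, ← map_pl C]
    have hdeg : ∀ i, (W i).natDegree ≤ 1 := by
      apply ev_poly_deg (ρ.map g) hg
      rw [hW1]
      simp only [XX]
      rw [hexp]
      compute_degree
    set v0 : N → K := fun i => (W i).coeff 0
    set v1 : N → K := fun i => (W i).coeff 1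
    have hWW : W = (fun i => C (v0 i)) + (X : K[X]) • (fun i => C (v1 i)) := by
      ext1 i
      conv_lhs => rw [eq_X_add_C_of_natDegree_le_one (hdeg i)]
      simp only [Pi.add_apply, Pi.smul_apply, smul_eq_mul, v0, v1]; ring
    have hcmp : ∀ a b c a' b' c' : K, (C a + X^2 * C b + X * C c : K[X]) = C a' + X^2 * C b' + X * C c' →
        a = a' ∧ b = b' ∧ c = c' := by
      intro a b c a' b' c' h
      have t0 := congrArg (fun t => coeff t 0) h
      have t1 := congrArg (fun t => coeff t 1) h
      have t2 := congrArg (fun t => coeff t 2) h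
      simp [coeff_X_pow, coeff_C, coeff_X] at t0 t1 t2
      exact ⟨t0, t2, t1⟩
    have hcmp2 : ∀ a b a' b' : K, (C a + X * C b : K[X]) = C a' + X * C b' → a = a' ∧ b = b' := by
      intro a b a' b' h
      have t0 := congrArg (fun t => coeff t 0) h
      have t1 := congrArg (fun t => coeff t 1) h
      simp [coeff_C] at t0 t1
      exact ⟨t0, t1⟩
    rw [hWW] at hW1 hW2
    simp only [XX] at hW1
    rw [hexp, hexp] at hW1
    obtain ⟨r0, r1, r2⟩ := hcmp _ _ _ _ _ _ hW1
    have r3 : ∀ l ∈ s, pl (ρ.map g) v0 (fun i => g (w l i)) = pl (τ.map g) x (fun i => g (e l i)) ∧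
        pl (ρ.map g) v1 (fun i => g (w l i)) = pl (ρ.map g) (fun i => g (w a i)) (fun i => g (w l i)) := by
      intro l hl
      have := hW2 ⟨l, hl⟩
      simp only [Y, pl_add_left, pl_smul_left] at this
      rw [← map_pl C, ← map_pl C, ← map_pl C, ← map_pl C] at this
      obtain ⟨t0, t1⟩ := hcmp2 _ _ _ _ this
      exact ⟨t0.trans (hvx2 l hl), t1⟩
    set wa : N → K := fun i => g (w a i)
    have r1' : ev (ρ.map g) v1 = ev (ρ.map g) wa := by
      rw [r1]
      have := congrArg g (hev a (Finset.mem_insert_self a s))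
      rwa [map_ev, map_ev] at this
    set u := v1 - wa with hu
    by_cases hu0 : u = 0
    · refine ⟨v0, r0, fun l hl => ?_⟩
      rcases Finset.mem_insert.1 hl with rfl | hl
      · have : v1 = wa := sub_eq_zero.1 hu0
        rw [this] at r2; exact r2
      · exact (r3 l hl).1
    have hun : ev (ρ.map g) u ≠ 0 := fun h => hu0 (hg _ h)
    have q1 : pl (ρ.map g) u wa = ev (ρ.map g) u := by
      have e1 : v1 = u + wa := by simp [hu]
      rw [e1, ev_add] at r1'
      linear_combination r1' - ev (ρ.map g) u * h2K
    set t := pl (ρ.map g) v0 u / ev (ρ.map g) u with ht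
    have ht' : t * ev (ρ.map g) u = pl (ρ.map g) v0 u := div_mul_cancel₀ _ hun
    refine ⟨v0 + t • u, ?_, ?_⟩
    · rw [ev_add, ev_smul, pl_smul_right, r0]
      linear_combination t * ht' + t * pl (ρ.map g) v0 u * h2K
    · intro l hl
      rcases Finset.mem_insert.1 hl with rfl | hl
      · rw [← r2, pl_add_left, pl_smul_left]
        change pl (ρ.map g) v0 wa + t * pl (ρ.map g) u wa = _
        have e1 : v1 = u + wa := by simp [hu]
        rw [q1, e1, pl_add_right]
        linear_combination ht'
      · rw [pl_add_left, pl_smul_left, (r3 l hl).1]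
        have : pl (ρ.map g) u (fun i => g (w l i)) = 0 := by
          rw [hu, pl_sub_left, (r3 l hl).2, sub_self]
        rw [this]; ring
end LemL
end QX

set_option linter.all false
namespace QX

section LemG

lemma map_map_form {A B D : Type} [CommRing A] [CommRing B] [CommRing D] {ι : Type} (q : Matrix ι ι A) (f : A →+* B) (g : B →+* D) :
    (q.map f).map g = q.map (g.comp f) := by ext; simp

/-- the generic quadratic equation has no root -/
lemma no_root {k : Type} [Field k] (h2 : (2:k) = 0) {ι : Type} [Fintype ι] (τ : Matrix ι ι k) (hτ : An τ)
    (x0 Z : ι → k) (hx : ev τ x0 ≠ 0) (hp : pl τ x0 Z ≠ 0) (β : k) :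
    β^2 + (pl τ x0 Z / ev τ x0) * β + ev τ Z / ev τ x0 ≠ 0 := by
  intro h
  have h1 : ev τ (β • x0 + Z) = 0 := by
    rw [ev_add, ev_smul, pl_smul_left]
    field_simp at h
    linear_combination h
  have h3 := hτ _ h1
  have h4 : pl τ x0 (β • x0 + Z) = 0 := by rw [h3]; simp
  rw [pl_add_right, pl_smul_right, pl_self, h2] at h4
  apply hp; linear_combination h4

theorem lemG {E : Type} [Field E] [Infinite E] (h2 : (2:E) = 0) {m : ℕ} (τ : Matrix (Fin m) (Fin m) E)
    (hτ : An τ) (x0 y1 : Fin m → E) (hxy : pl τ x0 y1 ≠ 0) :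
    ∃ (K : Type) (_ : Field K) (i : E →+* K), Sep i ∧ Is (τ.map i) ∧
      ∀ (E' : Type) (_ : Field E') (j : E →+* E'), ∃ (K' : Type) (_ : Field K') (j' : E' →+* K') (i' : K →+* K'),
        i'.comp i = j'.comp j ∧ ∀ (n : ℕ) (a : Fin n → E') (c : E'), An (QF.qPfister a c) →
          Is ((QF.qPfister a c).map j') → ∃ (h : MvPolynomial (Fin m) E') (V : Fin (2^n*2) → MvPolynomial (Fin m) E'),
            h ≠ 0 ∧ ev ((QF.qPfister a c).map MvPolynomial.C) V = h^2 * (MvPolynomial.C (j (ev τ x0)) *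
              ev ((τ.map j).map MvPolynomial.C) MvPolynomial.X) := by
  have hx0 : ev τ x0 ≠ 0 := by
    intro h; rw [hτ _ h] at hxy; simp at hxy
  -- generic data over any extension
  have gen : ∀ (E' : Type) [Field E'] (j : E →+* E'),
      pl ((τ.map j).map (MvPolynomial.C (σ := Fin m))) (fun i => MvPolynomial.C (j (x0 i))) MvPolynomial.X ≠ 0 := by
    intro E' _ j h
    have h3 := congrArg (MvPolynomial.eval (fun i => j (y1 i))) h
    rw [map_pl, map_zero] at h3
    have m1 : ((τ.map j).map (MvPolynomial.C (σ := Fin m))).map (MvPolynomial.eval (fun i => j (y1 i))) = τ.map j := by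
      ext; simp
    rw [m1] at h3
    simp only [MvPolynomial.eval_C, MvPolynomial.eval_X] at h3
    rw [← map_pl] at h3
    exact hxy ((map_eq_zero j).1 h3)
  -- setup over E
  let R := MvPolynomial (Fin m) E
  let A : R →+* FractionRing R := algebraMap R (FractionRing R)
  have hA : Function.Injective A := IsFractionRing.injective _ _
  let I : E →+* FractionRing R := A.comp MvPolynomial.C
  let Z : Fin m → FractionRing R := fun i => A (MvPolynomial.X i)
  have hanF : An (τ.map I) := an_pts (pts_mv E m) τ hτ
  have hplF : pl (τ.map I) (fun i => I (x0 i)) Z ≠ 0 := by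
    have := gen E (RingHom.id E)
    intro h
    apply this
    apply hA
    rw [map_pl, map_zero, ← h, map_map_form, map_map_form]
    rfl
  have hevF : ev (τ.map I) (fun i => I (x0 i)) ≠ 0 := by
    rw [← map_ev]; simpa using hx0
  have h2F : (2 : FractionRing R) = 0 := two_map I h2
  have hnr := no_root h2F _ hanF _ Z hevF hplF
  set b := pl (τ.map I) (fun i => I (x0 i)) Z / ev (τ.map I) (fun i => I (x0 i)) with hb
  set c := ev (τ.map I) Z / ev (τ.map I) (fun i => I (x0 i)) with hc
  obtain ⟨K, _, i0, α, hα, hs, hi, huniv⟩ := quadExt b c hnr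
  have hb0 : b ≠ 0 := div_ne_zero hplF hevF
  refine ⟨K, inferInstance, i0.comp I, (sep_pts (pts_mv E m)).comp (sep_quad h2F b c hb0 i0 α hα hs hi), ?_, ?_⟩
  · refine ⟨α • (fun t => i0 (I (x0 t))) + (fun t => i0 (Z t)), ?_, ?_⟩
    · intro h0
      have h4 : pl (τ.map (i0.comp I)) (fun t => i0 (I (x0 t))) (α • (fun t => i0 (I (x0 t))) + (fun t => i0 (Z t))) = 0 := by
        rw [h0]; simp
      rw [pl_add_right, pl_smul_right, pl_self, two_map i0 h2F, ← map_map_form, ← map_pl] at h4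
      apply hplF
      simpa using h4
    · rw [ev_add, ev_smul, pl_smul_left, ← map_map_form, ← map_pl i0 (τ.map I) (fun i => I (x0 i)) Z,
        ← map_ev i0 (τ.map I) (fun i => I (x0 i)), ← map_ev i0 (τ.map I) Z]
      have e1 : i0 (pl (τ.map I) (fun i => I (x0 i)) Z) = i0 (ev (τ.map I) (fun i => I (x0 i))) * i0 b := by
        rw [← map_mul, hb, mul_div_cancel₀ _ hevF]
      have e2 : i0 (ev (τ.map I) Z) = i0 (ev (τ.map I) (fun i => I (x0 i))) * i0 c := by
        rw [← map_mul, hc, mul_div_cancel₀ _ hevF]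
      rw [e1, e2]
      linear_combination i0 (ev (τ.map I) (fun i => I (x0 i))) * hα
  intro E' _ j
  haveI : Infinite E' := Infinite.of_injective j j.injective
  let R' := MvPolynomial (Fin m) E'
  let A' : R' →+* FractionRing R' := algebraMap R' (FractionRing R')
  have hA' : Function.Injective A' := IsFractionRing.injective _ _
  let I' : E' →+* FractionRing R' := A'.comp MvPolynomial.C
  let Z' : Fin m → FractionRing R' := fun i => A' (MvPolynomial.X i)
  have h2' : (2:E') = 0 := two_map j h2
  have h2F' : (2:FractionRing R') = 0 := two_map I' h2'
  have hinjmap : Function.Injective (A'.comp (MvPolynomial.map j)) :=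
    hA'.comp (MvPolynomial.map_injective j j.injective)
  let μ : FractionRing R →+* FractionRing R' := IsFractionRing.lift hinjmap
  have hμ : ∀ r : R, μ (A r) = A' (MvPolynomial.map j r) := fun r => IsFractionRing.lift_algebraMap hinjmap r
  have hμI : μ.comp I = I'.comp j := by
    ext x
    have h5 : μ (A (MvPolynomial.C x)) = _ := hμ _
    rw [MvPolynomial.map_C] at h5
    exact h5
  have hμZ : (fun i => μ (Z i)) = Z' := by ext i; simp [Z, Z', hμ]
  have hevF' : ev (τ.map (I'.comp j)) (fun i => I' (j (x0 i))) = μ (ev (τ.map I) (fun i => I (x0 i))) := by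
    rw [map_ev, map_map_form, hμI]
    congr 1; ext i; exact (congrArg (fun f => f (x0 i)) hμI).symm
  have hevZ' : ev (τ.map (I'.comp j)) Z' = μ (ev (τ.map I) Z) := by
    rw [map_ev, map_map_form, hμI, hμZ]
  by_cases hroot : ∃ β : FractionRing R', β^2 + μ b * β + μ c = 0
  · obtain ⟨β, hβ⟩ := hroot
    obtain ⟨φ, hφ, hφα⟩ := huniv _ inferInstance μ β hβ
    refine ⟨FractionRing R', inferInstance, I', φ, ?_, ?_⟩
    · rw [← hμI]; ext x; simp [hφ]
    · intro n a c' hP hPi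
      exact absurd (an_pts (pts_mv E' m) _ hP) (not_an.2 hPi)
  push Not at hroot
  obtain ⟨K', _, i0', α', hα', hs', hi', -⟩ := quadExt (μ b) (μ c) hroot
  obtain ⟨φ, hφ, hφα⟩ := huniv K' inferInstance (i0'.comp μ) α' hα'
  refine ⟨K', inferInstance, i0'.comp I', φ, ?_, ?_⟩
  · rw [RingHom.comp_assoc, ← hμI]; ext x; simp [hφ]
  intro n a c' hP hPi
  have hPF : An ((QF.qPfister a c').map I') := an_pts (pts_mv E' m) _ hP
  rw [← map_map_form] at hPi
  obtain ⟨w0, w1, hw1, hw⟩ := quad_value (μ b) (μ c) i0' α' hα' hs' hi' _ hPF hPi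
  rw [map_qPfister] at hw1 hw
  obtain ⟨z, hz⟩ := pf_mul h2F' (fun t => I' (a t)) (I' c') w0 w1
  set T := μ (ev (τ.map I) (fun i => I (x0 i))) with hT
  have hT0 : T ≠ 0 := by rw [hT]; simpa using hevF
  have hcT : T * μ c = μ (ev (τ.map I) Z) := by
    rw [hT, ← map_mul, hc, mul_div_cancel₀ _ hevF]
  set Qw := ev (QF.qPfister (fun t => I' (a t)) (I' c')) w1 with hQw
  obtain ⟨d, p, hd, hp⟩ := clear_den ((T / Qw) • z)
  refine ⟨d, p, hd, ?_⟩
  apply hA'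
  have e1 : (fun t => A' (p t)) = A' d • ((T / Qw) • z) := by ext t; simp [hp, A']
  have m1 : ((QF.qPfister a c').map (MvPolynomial.C (σ := Fin m))).map A' = QF.qPfister (fun t => I' (a t)) (I' c') := by
    rw [map_map_form, map_qPfister]
  have m2 : ((τ.map j).map (MvPolynomial.C (σ := Fin m))).map A' = τ.map (I'.comp j) := by
    ext; simp [I']
  rw [map_ev, m1, e1, ev_smul, ev_smul, hz, hw, map_mul, map_pow, map_mul,
    map_ev A' ((τ.map j).map MvPolynomial.C) MvPolynomial.X, m2]
  change _ = A' d ^ 2 * (A' (MvPolynomial.C (j (ev τ x0))) * ev (τ.map (I'.comp j)) Z')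
  have e3 : A' (MvPolynomial.C (j (ev τ x0))) = T := by
    rw [← hevF', ← map_map_form]
    change I' (j (ev τ x0)) = _
    rw [map_ev, map_ev]
  rw [e3, hevZ', ← hcT]
  have h7 : T / Qw * Qw = T := div_mul_cancel₀ T hw1
  linear_combination (A' d)^2 * μ c * (T / Qw * Qw + T) * h7

end LemG
end QX

set_option linter.all false
namespace QX
open Polynomial

section Start
variable {F : Type} [Field F]

lemma generic_an {k : ℕ} (a : Fin k → F) (c : F) (h : An (QF.qPfister a c)) :
    An (QF.qPfister (fun t => tof F (a t)) (algebraMap F[X] (FractionRing F[X]) X)) := by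
  intro z hz
  obtain ⟨d, p, hd, hp⟩ := clear_den z
  set A := algebraMap F[X] (FractionRing F[X]) with hA
  have hinj : Function.Injective A := IsFractionRing.injective _ _
  let P : PI k → F[X] := p ∘ pe k
  have h0 : ∑ f, C (pm a f) * (P (f,0)^2 + P (f,0) * P (f,1) + X * P (f,1)^2) = 0 := by
    apply hinj
    have h1 : ev (QF.qPfister (fun t => tof F (a t)) (A X)) (A d • z) = 0 := by
      rw [ev_smul, hz, mul_zero]
    have h3 : A d • z = fun t => A (p t) := by ext t; simp [hp]
    rw [h3, ev_qPfister] at h1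
    rw [map_zero, ← h1, pv, map_sum]
    refine Finset.sum_congr rfl fun f _ => ?_
    have : A (C (pm a f)) = pm (fun t => tof F (a t)) f := by
      change tof F (pm a f) = _
      simp only [pm, map_prod]
      refine Finset.prod_congr rfl fun i _ => ?_
      split_ifs <;> simp
    simp [this, P]
  have hP : P = 0 := by
    apply poly_zero_of_max
    intro D hD
    have hv : (fun f => (P (f,1)).coeff D) = 0 := by
      apply pf_sig a c h
      have := congrArg (fun q => q.coeff (2*D+1)) h0
      simp only [finset_sum_coeff, coeff_C_mul, coeff_add, coeff_X_mul, coeff_zero] at this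
      rw [← this]
      refine Finset.sum_congr rfl fun f _ => ?_
      have e1 : (P (f,0)^2).coeff (2*D+1) = 0 := by
        apply coeff_eq_zero_of_natDegree_lt
        have := natDegree_pow_le (p := P (f,0)) (n := 2)
        have := hD (f,0); omega
      have e2 : (P (f,0) * P (f,1)).coeff (2*D+1) = 0 := by
        apply coeff_eq_zero_of_natDegree_lt
        have := natDegree_mul_le (p := P (f,0)) (q := P (f,1))
        have := hD (f,0); have := hD (f,1); omega
      have e3 : (P (f,1)^2).coeff (2*D) = (P (f,1)).coeff D ^2 := coeff_pow_of_natDegree_le (hD (f,1))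
      rw [e1, e2, e3]; ring
    have hu : (fun f => (P (f,0)).coeff D) = 0 := by
      apply pf_sig a c h
      have := congrArg (fun q => q.coeff (2*D)) h0
      simp only [finset_sum_coeff, coeff_C_mul, coeff_add, coeff_zero] at this
      rw [← this]
      refine Finset.sum_congr rfl fun f _ => ?_
      have hvf : (P (f,1)).coeff D = 0 := congrFun hv f
      have e1 : (P (f,0)^2).coeff (2*D) = (P (f,0)).coeff D ^2 := coeff_pow_of_natDegree_le (hD (f,0))
      have e2 : (P (f,0) * P (f,1)).coeff (2*D) = 0 := by
        rw [two_mul, coeff_mul_add_eq_of_natDegree_le (hD (f,0)) (hD (f,1)), hvf, mul_zero]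
      have e3 : (X * P (f,1)^2).coeff (2*D) = 0 := by
        rcases Nat.eq_zero_or_pos D with rfl | hpos
        · simp
        · apply coeff_eq_zero_of_natDegree_lt
          have h1 : (P (f,1)).natDegree ≤ D - 1 := by
            rw [natDegree_le_iff_coeff_eq_zero]
            intro N hN
            rcases (show D ≤ N by omega).eq_or_lt with rfl | hlt
            · exact hvf
            · exact coeff_eq_zero_of_natDegree_lt (lt_of_le_of_lt (hD (f,1)) hlt)
          have h3 := natDegree_pow_le (p := P (f,1)) (n := 2)
          have h4 := natDegree_mul_le (p := (X : F[X])) (q := P (f,1)^2)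
          rw [natDegree_X] at h4
          omega
      rw [e1, e2, e3]; ring
    rintro ⟨f, b⟩
    fin_cases b
    · exact congrFun hu f
    · exact congrFun hv f
  ext t
  have h1 : P ((pe k).symm t) = 0 := by rw [hP]; rfl
  have h3 := hp t
  have h4 : p t = 0 := by simpa [P] using h1
  rw [h4, map_zero] at h3
  have hd1 : A d ≠ 0 := (map_ne_zero_iff A hinj).2 hd
  simpa [hd1] using h3.symm

/-- isotropy after adjoining an Artin-Schreier root -/
lemma as_is {k : ℕ} (h2 : (2:F) = 0) (a : Fin k → F) (α : F) : Is (QF.qPfister a (α^2 + α)) := by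
  let x : PI k → F := fun p => if p.1 = 0 then (if p.2 = 0 then α else 1) else 0
  refine ⟨x ∘ (pe k).symm, ?_, ?_⟩
  · intro h
    have := congrFun h (pe k (0, 1))
    simp [x] at this
  · rw [ev_qPfister, pv]
    refine Finset.sum_eq_zero fun f _ => ?_
    by_cases hf : f = 0
    · simp [x, hf]; right; linear_combination (α^2 + α) * h2
    · simp [x, hf]

end Start
end QX

set_option linter.all false
namespace QX
open Module

section LA
variable {E K : Type} [Field E] [Field K]

lemma li_map (g : E →+* K) {N : Type} [Fintype N] [DecidableEq N] {ι : Type} [Fintype ι] [DecidableEq ι] (w : ι → N → E)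
    (h : LinearIndependent E w) : LinearIndependent K (fun i t => g (w i t)) := by
  obtain ⟨L, hL⟩ := LinearMap.exists_leftInverse_of_injective (Fintype.linearCombination E w)
    (LinearMap.ker_eq_bot.2 (by
      have := linearIndependent_iff_injective_fintypeLinearCombination.1 h
      exact this))
  have hLw : ∀ i, L (w i) = Pi.single i 1 := by
    intro i
    have := LinearMap.congr_fun hL (Pi.single i 1)
    simpa [Fintype.linearCombination_apply, Pi.single_apply] using this
  have hsum : ∀ x : N → E, ∀ i, L x i = ∑ t, x t * L (Pi.single t 1) i := by
    intro x i
    conv_lhs => rw [pi_eq_sum_univ' x]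
    rw [map_sum, Finset.sum_apply]
    refine Finset.sum_congr rfl fun t _ => ?_
    rw [map_smul]; simp
  rw [Fintype.linearIndependent_iff]
  intro c hc i
  have h1 : ∑ t, (∑ j, c j • (fun t => g (w j t)) : N → K) t * g (L (Pi.single t 1) i) = 0 := by
    rw [hc]; simp
  have h3 : ∑ t, (∑ j, c j • (fun t => g (w j t)) : N → K) t * g (L (Pi.single t 1) i) = ∑ j, c j * g (L (w j) i) := by
    simp only [Finset.sum_apply, Pi.smul_apply, smul_eq_mul, Finset.sum_mul]
    rw [Finset.sum_comm]
    refine Finset.sum_congr rfl fun j _ => ?_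
    rw [hsum (w j) i, map_sum, Finset.mul_sum]
    refine Finset.sum_congr rfl fun t _ => ?_
    rw [map_mul]; ring
  rw [h3] at h1
  simp only [hLw] at h1
  rw [Finset.sum_eq_single i] at h1
  · simpa using h1
  · intro b _ hb; simp [Ne.symm hb]
  · simp

variable {N : Type} [Fintype N] [DecidableEq N]

lemma nd_of (ρ : Matrix N N E) (h : ∀ x, (∀ y, pl ρ x y = 0) → x = 0) : (plB ρ).Nondegenerate := by
  refine (LinearMap.IsRefl.nondegenerate_iff_separatingLeft (plB_refl ρ)).2 ?_
  exact h

lemma mem_orth (ρ : Matrix N N E) (W : Submodule E (N → E)) (x : N → E) :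
    x ∈ (plB ρ).orthogonal W ↔ ∀ y ∈ W, pl ρ y x = 0 := Iff.rfl

/-- double perp -/
lemma dperp (ρ : Matrix N N E) (h : ∀ x, (∀ y, pl ρ x y = 0) → x = 0) {ι κ : Type} [Fintype ι] [Fintype κ]
    (f : ι → N → E) (hf : LinearIndependent E f) (w : κ → N → E) (hw : LinearIndependent E w)
    (hfw : ∀ a b, pl ρ (w a) (f b) = 0) (hc : Fintype.card ι + Fintype.card κ = Fintype.card N)
    (y : N → E) (hy : ∀ a, pl ρ y (w a) = 0) : ∃ c : ι → E, y = ∑ a, c a • f a := by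
  have h1 := LinearMap.BilinForm.finrank_orthogonal (nd_of ρ h) (Submodule.span E (Set.range w))
  rw [finrank_span_eq_card hw, finrank_fintype_fun_eq_card] at h1
  have hperp : ∀ z, (∀ a, pl ρ (w a) z = 0) → z ∈ (plB ρ).orthogonal (Submodule.span E (Set.range w)) := by
    intro z hz
    rw [mem_orth]
    intro u hu
    induction hu using Submodule.span_induction with
    | mem x hx => obtain ⟨a, rfl⟩ := hx; exact hz a
    | zero => simp
    | add x y _ _ hx hy => rw [pl_add_left, hx, hy, add_zero]
    | smul c x _ hx => rw [pl_smul_left, hx, mul_zero]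
  have h3 : Submodule.span E (Set.range f) = (plB ρ).orthogonal (Submodule.span E (Set.range w)) := by
    apply Submodule.eq_of_le_of_finrank_eq
    · rw [Submodule.span_le]
      rintro _ ⟨b, rfl⟩
      exact hperp _ fun a => hfw a b
    · rw [finrank_span_eq_card hf, h1]; omega
  have h4 : y ∈ Submodule.span E (Set.range f) := by
    rw [h3]; exact hperp _ fun a => by rw [pl_comm, hy]
  obtain ⟨c, hc⟩ := (Submodule.mem_span_range_iff_exists_fun E).1 h4
  exact ⟨c, hc.symm⟩

/-- dual vectors -/
lemma dual_vec (ρ : Matrix N N E) (h : ∀ x, (∀ y, pl ρ x y = 0) → x = 0) {ι : Type} [Fintype ι] [DecidableEq ι]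
    (f : ι → N → E) (hf : LinearIndependent E f) (g : ι → E) : ∃ z, ∀ a, pl ρ z (f a) = g a := by
  obtain ⟨L, hL⟩ := LinearMap.exists_leftInverse_of_injective (Fintype.linearCombination E f)
    (LinearMap.ker_eq_bot.2 (linearIndependent_iff_injective_fintypeLinearCombination.1 hf))
  have hLw : ∀ i, L (f i) = Pi.single i 1 := by
    intro i
    have := LinearMap.congr_fun hL (Pi.single i 1)
    simpa [Fintype.linearCombination_apply, Pi.single_apply] using this
  let φ : (N → E) →ₗ[E] E := (Fintype.linearCombination E g) ∘ₗ L
  have hinj : Function.Injective (plB ρ) := by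
    rw [← LinearMap.ker_eq_bot, LinearMap.ker_eq_bot']
    intro x hx
    exact h x fun y => LinearMap.congr_fun hx y
  have hsurj : Function.Surjective (plB ρ) := by
    refine (LinearMap.injective_iff_surjective_of_finrank_eq_finrank ?_).1 hinj
    simp
  obtain ⟨z, hz⟩ := hsurj φ
  refine ⟨z, fun a => ?_⟩
  have := LinearMap.congr_fun hz (f a)
  rw [plB_apply] at this
  rw [this]
  simp [φ, hLw, Fintype.linearCombination_apply, Pi.single_apply]

/-- orthogonal basis of complement -/
lemma perp_basis (ρ : Matrix N N E) (h : ∀ x, (∀ y, pl ρ x y = 0) → x = 0) {ι : Type} [Fintype ι]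
    (f : ι → N → E) (hf : LinearIndependent E f) (m : ℕ) (hm : Fintype.card ι + m = Fintype.card N) :
    ∃ w : Fin m → N → E, LinearIndependent E w ∧ ∀ a b, pl ρ (w a) (f b) = 0 := by
  have h1 := LinearMap.BilinForm.finrank_orthogonal (nd_of ρ h) (Submodule.span E (Set.range f))
  rw [finrank_span_eq_card hf, finrank_fintype_fun_eq_card] at h1
  let B := finBasisOfFinrankEq E ((plB ρ).orthogonal (Submodule.span E (Set.range f))) (n := m) (by omega)
  refine ⟨fun a => (B a : N → E), ?_, ?_⟩
  · exact B.linearIndependent.map' (Submodule.subtype _) (Submodule.ker_subtype _)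
  · intro a b
    have := (mem_orth _ _ _).1 (B a).2 (f b) (Submodule.subset_span ⟨b, rfl⟩)
    rw [pl_comm, this]

/-- intersecting a subspace with the span of many independent vectors -/
lemma meet (W : Submodule E (N → E)) {κ : Type} [Fintype κ] (w : κ → N → E) (hw : LinearIndependent E w)
    (hc : Fintype.card N < finrank E W + Fintype.card κ) : ∃ c : κ → E, ∑ a, c a • w a ≠ 0 ∧ ∑ a, c a • w a ∈ W := by
  have h1 := Submodule.finrank_sup_add_finrank_inf_eq W (Submodule.span E (Set.range w))
  rw [finrank_span_eq_card hw] at h1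
  have h3 := Submodule.finrank_le (W ⊔ (Submodule.span E (Set.range w)))
  rw [finrank_fintype_fun_eq_card] at h3
  have h4 : 0 < finrank E ↥(W ⊓ (Submodule.span E (Set.range w))) := by omega
  haveI := finrank_pos_iff.1 h4
  obtain ⟨⟨y, hy1, hy2⟩, hne⟩ := exists_ne (0 : ↥(W ⊓ (Submodule.span E (Set.range w))))
  obtain ⟨c, hc⟩ := (Submodule.mem_span_range_iff_exists_fun E).1 hy2
  refine ⟨c, ?_, ?_⟩
  · rw [hc]; intro h0; apply hne; ext1; exact h0
  · rw [hc]; exact hy1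

end LA
end QX

set_option linter.all false
namespace QX
open Module Polynomial

section Odd
variable {E : Type} [Field E]

lemma even_deg {N : Type} [Fintype N] (ρ : Matrix N N E) (hρ : An ρ) (R : N → E[X]) (e : ℕ)
    (h : (ev (ρ.map C) R).natDegree = 2 * e + 1) : False := by
  have h1 := ev_poly_deg ρ hρ (e+1) R (by omega)
  have h3 := coeff_ev ρ R (e+1) h1
  rw [coeff_eq_zero_of_natDegree_lt (by omega)] at h3
  have h4 := hρ _ h3.symm
  have h5 : ∀ i, (R i).natDegree ≤ e := by
    intro i
    rw [natDegree_le_iff_coeff_eq_zero]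
    intro M hM
    rcases (show e + 1 ≤ M by omega).eq_or_lt with rfl | hlt
    · exact congrFun h4 i
    · exact coeff_eq_zero_of_natDegree_lt (lt_of_le_of_lt (h1 i) hlt)
  have := ev_natDegree_le ρ R e h5
  omega

lemma odd_contra {N M : Type} [Fintype N] [Fintype M] (ρ : Matrix N N E) (hρ : An ρ) (τ : Matrix M M E) (t0 : E) (ht : t0 ≠ 0)
    (H : ∀ (K : Type) [Field K] (g : E →+* K), An (ρ.map g) → ∀ x, ∃ v, ev (ρ.map g) v = g t0 * ev (τ.map g) x)
    (z0 y : M → E) (hz : ev τ z0 = 0) (hy : pl τ z0 y ≠ 0) : False := by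
  set A := algebraMap E[X] (FractionRing E[X]) with hA
  have hinj : Function.Injective A := IsFractionRing.injective _ _
  obtain ⟨v, hv⟩ := H _ (tof E) (an_tof ρ hρ) (A X • (fun t => tof E (z0 t)) + fun t => tof E (y t))
  rw [ev_add, ev_smul, pl_smul_left, ← map_ev, ← map_ev, ← map_pl, hz] at hv
  obtain ⟨d, p, hd, hp⟩ := clear_den v
  have e1 : (fun t => A (p t)) = A d • v := by ext t; simp [hp, A]
  have h3 : ev (ρ.map C) p = d^2 * (C (t0 * pl τ z0 y) * X + C (t0 * ev τ y)) := by
    apply hinj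
    rw [map_ev, map_map_form, e1, ev_smul]
    change _ * ev (ρ.map (tof E)) v = _
    rw [hv]
    simp only [map_mul, map_add, map_pow, tof, RingHom.comp_apply, map_zero]
    ring
  have hdeg : (C (t0 * pl τ z0 y) * X + C (t0 * ev τ y)).natDegree = 1 :=
    natDegree_linear (mul_ne_zero ht hy)
  have h4 : (ev (ρ.map C) p).natDegree = 2 * d.natDegree + 1 := by
    rw [h3, natDegree_mul (pow_ne_zero _ hd), hdeg, natDegree_pow]
    intro h0; rw [h0] at hdeg; simp at hdeg
  exact even_deg ρ hρ p _ h4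

end Odd

section Tau
variable {E : Type} [Field E] {N : Type} [Fintype N]

/-- base change of vectors -/
def bc {L : Type} [Field L] (g : E →+* L) (x : N → E) : N → L := fun t => g (x t)

def uv {L : Type} [Field L] (g : E →+* L) {m : ℕ} (z : N → E) (w : Fin m → N → E) (x : Fin (m+1) → L) : N → L :=
  x 0 • bc g z + ∑ b, x b.succ • bc g (w b)

lemma uv_add {L : Type} [Field L] (g : E →+* L) {m : ℕ} (z : N → E) (w : Fin m → N → E) (x y : Fin (m+1) → L) :
    uv g z w (x + y) = uv g z w x + uv g z w y := by
  simp only [uv, Pi.add_apply, add_smul, Finset.sum_add_distrib]; abel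

lemma ev_add_mat {ι R : Type} [Fintype ι] [CommRing R] (q q' : Matrix ι ι R) (x : ι → R) : ev (q + q') x = ev q x + ev q' x := by
  simp [ev, add_mul, Finset.sum_add_distrib]

lemma tau_ex (h2 : (2:E) = 0) (ρ : Matrix N N E) {m : ℕ} (z : N → E) (w : Fin m → N → E) (κ : E) :
    ∃ τ : Matrix (Fin (m+1)) (Fin (m+1)) E, ∀ (L : Type) [Field L] (g : E →+* L),
      (∀ x, ev (τ.map g) x = x 0^2 * g κ + ev (ρ.map g) (uv g z w x)) ∧
      (∀ x y, pl (τ.map g) x y = pl (ρ.map g) (uv g z w x) (uv g z w y)) := by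
  classical
  let u : Fin (m+1) → N → E := Fin.cons z w
  let G : Matrix N (Fin (m+1)) E := Matrix.of fun t i => u i t
  refine ⟨G.transpose * ρ * G + Matrix.diagonal (Pi.single 0 κ), ?_⟩
  intro L _ g
  have h1 : ∀ x, ev ((G.transpose * ρ * G + Matrix.diagonal (Pi.single 0 κ)).map g) x =
      x 0^2 * g κ + ev (ρ.map g) (uv g z w x) := by
    intro x
    have e1 : (G.transpose * ρ * G + Matrix.diagonal (Pi.single 0 κ)).map g =
        (G.map g).transpose * (ρ.map g) * (G.map g) + Matrix.diagonal (Pi.single 0 (g κ)) := by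
      rw [Matrix.map_add g (map_add g), Matrix.map_mul, Matrix.map_mul, Matrix.transpose_map, Matrix.diagonal_map (map_zero g)]
      congr 2
      ext i; by_cases h : i = 0
      · subst h; simp
      · simp [h]
    rw [e1, ev_add_mat, ev_conj]
    have e2 : (G.map g).mulVec x = uv g z w x := by
      ext t
      simp only [Matrix.mulVec, dotProduct, Fin.sum_univ_succ, uv, Pi.add_apply, Pi.smul_apply, Finset.sum_apply, smul_eq_mul]
      simp [G, u, bc, mul_comm]
    rw [e2]
    have e3 : ev (Matrix.diagonal (Pi.single 0 (g κ))) x = x 0^2 * g κ := by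
      simp only [ev]
      rw [Finset.sum_eq_single 0, Finset.sum_eq_single 0]
      · simp; ring
      · intro b _ hb; simp [Matrix.diagonal_apply_ne _ (Ne.symm hb)]
      · simp
      · intro b _ hb
        refine Finset.sum_eq_zero fun c _ => ?_
        by_cases hbc : b = c
        · subst hbc; simp [hb]
        · simp [hbc]
      · simp
    rw [e3]; ring
  refine ⟨h1, fun x y => ?_⟩
  have h3 := ev_add ((G.transpose * ρ * G + Matrix.diagonal (Pi.single 0 κ)).map g) x y
  rw [h1, h1, h1, uv_add, ev_add] at h3
  have := two_map g h2
  simp only [Pi.add_apply] at h3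
  linear_combination -h3 + x 0 * y 0 * g κ * this

end Tau
end QX

set_option linter.all false
namespace QX
open Module Polynomial

section Step

lemma map_id_form {E : Type} [Field E] {ι : Type} (q : Matrix ι ι E) : q.map (RingHom.id E) = q := by ext; simp

lemma sub_ev {L : Type} [Field L] {κ ι : Type} [Fintype κ] [Fintype ι] [DecidableEq κ] [DecidableEq ι]
    (p : Matrix κ κ L) (φ : ι → κ) (x : ι → L) :
    ev p (∑ a, x a • (Pi.single (φ a) 1 : κ → L)) = ev (p.submatrix φ φ) x := by
  apply gram_mat
  · intro a; rw [ev_single]; rfl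
  · intro a b _; rw [pl_single]; rfl

lemma gli_ev {L : Type} [Field L] {N κ ι : Type} [Fintype N] [Fintype κ] [Fintype ι] [DecidableEq κ] [DecidableEq ι]
    (ρ : Matrix N N L) (p : Matrix κ κ L) (φ : ι → κ) (v : ι → N → L)
    (h1 : ∀ a, ev ρ (v a) = p (φ a) (φ a)) (h2 : ∀ a b, a ≠ b → pl ρ (v a) (v b) = p (φ a) (φ b) + p (φ b) (φ a))
    (x : ι → L) : ev ρ (∑ a, x a • v a) = ev p (∑ a, x a • (Pi.single (φ a) 1 : κ → L)) := by
  rw [sub_ev]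
  exact gram_mat _ _ _ h1 h2 x

lemma gli {L : Type} [Field L] {N κ ι : Type} [Fintype N] [Fintype κ] [Fintype ι] [DecidableEq κ] [DecidableEq ι]
    (ρ : Matrix N N L) (p : Matrix κ κ L) (hp : An p) (φ : ι → κ) (hφ : Function.Injective φ) (v : ι → N → L)
    (h1 : ∀ a, ev ρ (v a) = p (φ a) (φ a)) (h2 : ∀ a b, a ≠ b → pl ρ (v a) (v b) = p (φ a) (φ b) + p (φ b) (φ a))
    (x : ι → L) (hx : ev ρ (∑ a, x a • v a) = 0) : x = 0 := by
  rw [gli_ev ρ p φ v h1 h2] at hx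
  have := hp _ hx
  ext b
  have h3 := congrFun this (φ b)
  simpa [Finset.sum_apply, Pi.single_apply, hφ.eq_iff] using h3

lemma gli_li {L : Type} [Field L] {N κ ι : Type} [Fintype N] [Fintype κ] [Fintype ι] [DecidableEq κ] [DecidableEq ι]
    (ρ : Matrix N N L) (p : Matrix κ κ L) (hp : An p) (φ : ι → κ) (hφ : Function.Injective φ) (v : ι → N → L)
    (h1 : ∀ a, ev ρ (v a) = p (φ a) (φ a)) (h2 : ∀ a b, a ≠ b → pl ρ (v a) (v b) = p (φ a) (φ b) + p (φ b) (φ a)) :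
    LinearIndependent L v := by
  rw [Fintype.linearIndependent_iff]
  intro x hx b
  have := gli ρ p hp φ hφ v h1 h2 x (by rw [hx]; simp)
  exact congrFun this b

theorem core {E E' : Type} [Field E] [Field E'] [Infinite E] (h2 : (2:E) = 0) (j : E →+* E') {n k : ℕ} (a : Fin n → E) (v c : E)
    (hρ : An (QF.qPfister a v)) (hρi : Is ((QF.qPfister a v).map j)) (hπ : An ((QF.qPfister a c).map j))
    (p : Matrix (Fin k) (Fin k) E) (hp : ∀ (L : Type) [Field L] (g : E →+* L), An ((QF.qPfister a c).map g) → An (p.map g))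
    (s : Finset (Fin k)) (d : Fin k) (hd : d ∉ s) (hs : s.card < 2^n) (f : Fin k → Fin (2^n*2) → E)
    (hf1 : ∀ l ∈ s, ev (QF.qPfister a v) (f l) = p l l)
    (hf2 : ∀ l ∈ s, ∀ l' ∈ s, l ≠ l' → pl (QF.qPfister a v) (f l) (f l') = p l l' + p l' l) :
    ∃ (K K' : Type) (_ : Field K) (_ : Field K') (i : E →+* K) (j' : K →+* K') (fd : Fin (2^n*2) → K), Sep i ∧
      An ((QF.qPfister a v).map i) ∧ Is ((QF.qPfister a v).map (j'.comp i)) ∧ An ((QF.qPfister a c).map (j'.comp i)) ∧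
      ev ((QF.qPfister a v).map i) fd = i (p d d) ∧
      ∀ l ∈ s, pl ((QF.qPfister a v).map i) fd (bc i (f l)) = i (p d l + p l d) := by
  classical
  set ρ := QF.qPfister a v with hρdef
  set π := QF.qPfister a c with hπdef
  have ha := pf_slots a v hρ
  have hnd := pf_nd h2 a v ha
  have hpE : An p := by
    have := hp E (RingHom.id E) (by rw [map_id_form]; exact hπ.of_map)
    rwa [map_id_form] at this
  let φ : s → Fin k := Subtype.val
  have hφ : Function.Injective φ := Subtype.val_injective
  let fs : s → Fin (2^n*2) → E := fun l => f l
  have g1 : ∀ l : s, ev ρ (fs l) = p (φ l) (φ l) := fun l => hf1 l l.2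
  have g2 : ∀ l l' : s, l ≠ l' → pl ρ (fs l) (fs l') = p (φ l) (φ l') + p (φ l') (φ l) :=
    fun l l' h => hf2 l l.2 l' l'.2 (fun h0 => h (Subtype.ext h0))
  have hli : LinearIndependent E fs := gli_li ρ p hpE φ hφ fs g1 g2
  obtain ⟨z, hz⟩ := dual_vec ρ hnd fs hli (fun l => p d l + p l d)
  obtain ⟨m, hm⟩ : ∃ m, s.card + m = 2^n*2 := ⟨2^n*2 - s.card, by omega⟩
  obtain ⟨w, hw, hwf⟩ := perp_basis ρ hnd fs hli m (by simpa using hm)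
  obtain ⟨τ, hτ⟩ := tau_ex h2 ρ z w (p d d)
  -- isotropy of τ gives the next vector
  have fd_of : ∀ (L : Type) [Field L] (g : E →+* L), An (ρ.map g) → Is (τ.map g) →
      ∃ fd, ev (ρ.map g) fd = g (p d d) ∧ ∀ l ∈ s, pl (ρ.map g) fd (bc g (f l)) = g (p d l + p l d) := by
    intro L _ g hL hi
    obtain ⟨x, hx, hx0⟩ := hi
    rw [(hτ L g).1] at hx0
    have h2L := two_map g h2
    by_cases hlam : x 0 = 0
    · exfalso
      rw [hlam] at hx0
      have h3 := hL (uv g z w x) (by linear_combination hx0)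
      have h4 : ∑ b, x (Fin.succ b) • bc g (w b) = 0 := by
        rw [uv, hlam, zero_smul, zero_add] at h3; exact h3
      have h5 := Fintype.linearIndependent_iff.1 (li_map g w hw) _ h4
      apply hx
      ext t
      refine Fin.cases hlam (fun b => h5 b) t
    · refine ⟨(x 0)⁻¹ • uv g z w x, ?_, ?_⟩
      · rw [ev_smul]
        field_simp
        linear_combination hx0 - (x 0)^2 * g (p d d) * h2L
      · intro l hl
        have e1 : ∀ b, pl (ρ.map g) (bc g (w b)) (bc g (f l)) = 0 := by
          intro b
          have := hwf b ⟨l, hl⟩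
          change pl ρ (w b) (f l) = 0 at this
          have h6 := map_pl g ρ (w b) (f l)
          rw [this, map_zero] at h6
          exact h6.symm
        have e2 : pl (ρ.map g) (bc g z) (bc g (f l)) = g (p d l + p l d) := by
          rw [← hz ⟨l, hl⟩]; exact (map_pl g ρ z (f l)).symm
        rw [pl_smul_left, uv, pl_add_left, pl_smul_left, pl_sum_left, e2]
        simp only [pl_smul_left, e1]
        field_simp
        simp
  by_cases hτan : An τ
  swap
  · obtain ⟨fd, q1, q2⟩ := fd_of E (RingHom.id E) (by rwa [map_id_form]) (by rw [map_id_form]; exact not_an.1 hτan)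
    refine ⟨E, E', inferInstance, inferInstance, RingHom.id E, j, fd, Sep.refl, by rwa [map_id_form], ?_, ?_, q1, q2⟩
    · simpa using hρi
    · simpa using hπ
  -- two non orthogonal w
  obtain ⟨a0, b0, hab⟩ : ∃ a0 b0, pl ρ (w a0) (w b0) ≠ 0 := by
    by_contra hcon
    push Not at hcon
    have h3 : Submodule.span E (Set.range w) ≤ Submodule.span E (Set.range fs) := by
      rw [Submodule.span_le]
      rintro _ ⟨b, rfl⟩
      obtain ⟨c, hc⟩ := dperp ρ hnd fs hli w hw hwf (by simpa using hm) (w b) (fun a => hcon b a)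
      exact (Submodule.mem_span_range_iff_exists_fun E).2 ⟨c, hc.symm⟩
    have h4 := Submodule.finrank_mono h3
    rw [finrank_span_eq_card hw, finrank_span_eq_card hli] at h4
    simp at h4
    omega
  have uvs : ∀ (L : Type) [Field L] (g : E →+* L) (b : Fin m), uv g z w (Pi.single b.succ 1) = bc g (w b) := by
    intro L _ g b
    rw [uv, Finset.sum_eq_single b]
    · simp [Fin.succ_ne_zero]
    · intro b' _ hb'; simp [Pi.single_apply, hb']
    · simp
  have bcid : ∀ x : Fin (2^n*2) → E, bc (RingHom.id E) x = x := fun x => rfl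
  have hτE := hτ E (RingHom.id E)
  rw [map_id_form, map_id_form] at hτE
  have hx0y1 : pl τ (Pi.single a0.succ 1) (Pi.single b0.succ 1) ≠ 0 := by
    rw [hτE.2, uvs, uvs, bcid, bcid]; exact hab
  have hτx0 : ev τ (Pi.single a0.succ 1) = ev ρ (w a0) := by
    rw [hτE.1, uvs, bcid]; simp [(Fin.succ_ne_zero _).symm, Fin.succ_ne_zero]
  have hwa : ev ρ (w a0) ≠ 0 := by
    intro h
    have := hρ _ h
    rw [this] at hab; simp at hab
  obtain ⟨K, _, i, hsep, hKi, Q⟩ := lemG h2 τ hτan _ _ hx0y1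
  by_cases hKρ : An (ρ.map i)
  · obtain ⟨K', _, j'', i', hcomm, Hπ⟩ := Q E' inferInstance j
    obtain ⟨fd, q1, q2⟩ := fd_of K i hKρ hKi
    refine ⟨K, K', inferInstance, inferInstance, i, i', fd, hsep, hKρ, ?_, ?_, q1, q2⟩
    · rw [hcomm, ← map_map_form]; exact hρi.map j''
    · rw [hcomm, ← map_map_form]
      by_contra hcon
      rw [not_an] at hcon
      rw [hπdef, map_qPfister] at hcon hπ
      obtain ⟨h, V, hh, hV⟩ := Hπ n _ _ hπ hcon
      haveI : Infinite E' := Infinite.of_injective j j.injective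
      have h2' := two_map j h2
      have hsp := spec h2' _ _ _ h hh V hV
      have haj : ∀ t, j (a t) ≠ 0 := fun t => by simpa using ha t
      -- geometry over E'
      have hρj : ρ.map j = QF.qPfister (fun t => j (a t)) (j v) := by rw [hρdef, map_qPfister]
      have hnd' := pf_nd h2' (fun t => j (a t)) (j v) haj
      rw [hρj] at hρi
      obtain ⟨W, hW1, hW2⟩ := pf_lag h2' _ _ hρi
      have hwj := li_map j w hw
      obtain ⟨y, hy1, hy2⟩ := meet W (fun b => bc j (w b)) hwj (by simp [hW1]; omega)
      rw [← hρj] at hW2 hnd'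
      have hpj : An (p.map j) := hp E' j (by rwa [hπdef, map_qPfister])
      have g1' : ∀ l : s, ev (ρ.map j) (bc j (fs l)) = (p.map j) (φ l) (φ l) := by
        intro l
        have := map_ev j ρ (fs l)
        rw [g1] at this; exact this.symm
      have g2' : ∀ l l' : s, l ≠ l' → pl (ρ.map j) (bc j (fs l)) (bc j (fs l')) = (p.map j) (φ l) (φ l') + (p.map j) (φ l') (φ l) := by
        intro l l' hl
        have := map_pl j ρ (fs l) (fs l')
        rw [g2 l l' hl, map_add] at this; exact this.symm
      obtain ⟨b, hb⟩ : ∃ b, pl (ρ.map j) (∑ b, y b • bc j (w b)) (bc j (w b)) ≠ 0 := by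
        by_contra hcc
        push Not at hcc
        obtain ⟨cc, hcc'⟩ := dperp (ρ.map j) hnd' (fun l => bc j (fs l)) (gli_li _ _ hpj φ hφ _ g1' g2')
          (fun b => bc j (w b)) hwj (fun x l => by
            have := map_pl j ρ (w x) (fs l)
            rw [hwf, map_zero] at this; exact this.symm) (by simpa using hm) _ hcc
        have h0 := hW2 _ hy2
        rw [hcc'] at h0
        have h9 := gli _ _ hpj φ hφ _ g1' g2' cc h0
        apply hy1
        rw [hcc', h9]; simp
      have hz0 : uv j z w (Fin.cons 0 y) = ∑ b, y b • bc j (w b) := by simp [uv]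
      refine odd_contra _ hπ (τ.map j) (j (ev τ (Pi.single a0.succ 1))) ?_ hsp (Fin.cons 0 y) (Pi.single b.succ 1) ?_ ?_
      · rw [hτx0]; simpa using hwa
      · rw [(hτ E' j).1, hz0, hW2 _ hy2]; simp
      · rw [(hτ E' j).2, hz0, uvs]; exact hb
  · exfalso
    rw [not_an] at hKρ
    obtain ⟨K', _, j'', i', hcomm, Hρ⟩ := Q E inferInstance (RingHom.id E)
    rw [RingHom.comp_id] at hcomm
    obtain ⟨h, V, hh, hV⟩ := Hρ n a v hρ (by
      rw [← hcomm, ← hρdef, ← map_map_form]; exact hKρ.map i')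
    have hsp := spec h2 _ _ _ h hh V hV
    rw [map_id_form, RingHom.id_apply, hτx0] at hsp
    have H0 : ∀ (K : Type) [Field K] (g : E →+* K), An (ρ.map g) → ∀ x, ∃ v, ev (ρ.map g) v = ev (τ.map g) x := by
      intro K _ g hg x
      obtain ⟨u, hu⟩ := hsp K g hg x
      have h2K := two_map g h2
      have hρg : ρ.map g = QF.qPfister (fun t => g (a t)) (g v) := by rw [hρdef, map_qPfister]
      obtain ⟨y, hy⟩ := pf_mul h2K (fun t => g (a t)) (g v) u (bc g (w a0))
      change ev (Matrix.map ρ g) u = _ at hu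
      rw [← hρg, hu] at hy
      have e1 : ev (ρ.map g) (bc g (w a0)) = g (ev ρ (w a0)) := (map_ev g ρ (w a0)).symm
      rw [e1] at hy
      have hne : g (ev ρ (w a0)) ≠ 0 := by simpa using hwa
      refine ⟨(g (ev ρ (w a0)))⁻¹ • y, ?_⟩
      rw [ev_smul, hy]
      field_simp
    obtain ⟨u, hu1, hu2⟩ := lemL h2 τ ρ H0 (fun b : Fin m => Pi.single b.succ 1) w
      (fun x y => by rw [hτE.2, uvs, uvs]; rfl) Finset.univ
      (fun x _ => by rw [hτE.1, uvs, bcid]; simp [(Fin.succ_ne_zero _).symm, Fin.succ_ne_zero])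
      E (RingHom.id E) (by rwa [map_id_form]) (Pi.single 0 1)
    rw [map_id_form, map_id_form] at hu1
    simp only [map_id_form, RingHom.id_apply] at hu2
    have uv0 : uv (RingHom.id E) z w (Pi.single 0 1) = z := by
      simp [uv, bcid, Fin.succ_ne_zero]
    rw [hτE.1, uv0] at hu1
    simp only [Pi.single_eq_same, one_pow, one_mul, RingHom.id_apply] at hu1
    obtain ⟨cc, hcc⟩ := dperp ρ hnd fs hli w hw hwf (by simpa using hm) (u - z) (fun b => by
      have := hu2 b (Finset.mem_univ _)
      rw [hτE.2, uv0, uvs, bcid] at this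
      rw [pl_sub_left, this, sub_self])
    have hu3 : u = z + ∑ l, cc l • fs l := by rw [← hcc]; abel
    rw [hu3, ev_add, gli_ev ρ p φ fs g1 g2, pl_sum_right] at hu1
    simp only [pl_smul_right, hz] at hu1
    set X0 : Fin k → E := ∑ l, cc l • (Pi.single (φ l) 1 : Fin k → E) with hX0
    have hfin : ev p (X0 + Pi.single d 1) = 0 := by
      have e5 : pl p X0 (Pi.single d 1) = ∑ l, cc l * (p d l + p l d) := by
        rw [hX0, pl_sum_left]
        refine Finset.sum_congr rfl fun l _ => ?_
        rw [pl_smul_left, pl_single, add_comm (p d l)]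
      rw [ev_add, ev_single, e5]
      linear_combination hu1 + p d d * h2
    have h10 := congrFun (hpE _ hfin) d
    have h11 : X0 d = 0 := by
      rw [hX0, Finset.sum_apply]
      refine Finset.sum_eq_zero fun l _ => ?_
      have : d ≠ φ l := fun h => hd (by rw [h]; exact l.2)
      simp [Pi.single_apply, this]
    simp [h11] at h10

end Step
end QX

set_option linter.all false
namespace QX
open Module Polynomial

section SepThm

def St {F : Type} [Field F] {n k : ℕ} (a : Fin n → F) (c : F) (p : Matrix (Fin k) (Fin k) F) (s : Finset (Fin k)) : Prop :=
  ∃ (E E' : Type) (_ : Field E) (_ : Field E') (_ : Infinite E) (i : F →+* E) (j : E →+* E') (v : E) (f : Fin k → Fin (2^n*2) → E),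
    Sep i ∧ An (QF.qPfister (fun t => i (a t)) v) ∧ Is ((QF.qPfister (fun t => i (a t)) v).map j) ∧
    An ((QF.qPfister a c).map (j.comp i)) ∧
    (∀ l ∈ s, ev (QF.qPfister (fun t => i (a t)) v) (f l) = i (p l l)) ∧
    ∀ l ∈ s, ∀ l' ∈ s, l ≠ l' → pl (QF.qPfister (fun t => i (a t)) v) (f l) (f l') = i (p l l' + p l' l)

lemma St_empty {F : Type} [Field F] (h2 : (2:F) = 0) {n k : ℕ} (a : Fin n → F) (c : F) (p : Matrix (Fin k) (Fin k) F)
    (hπ : An (QF.qPfister a c)) : St a c p ∅ := by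
  set A := algebraMap F[X] (FractionRing F[X]) with hA
  have hinj : Function.Injective A := IsFractionRing.injective _ _
  let ψ : F[X] →+* F[X] := (Polynomial.aeval (X^2 + X : F[X])).toRingHom
  have hψ : Function.Injective ψ := by
    have : Function.Injective (fun q : F[X] => q.comp (X^2 + X)) := by
      have hd : (X^2 + X : F[X]).natDegree = 2 := by compute_degree!
      refine (injective_iff_map_eq_zero (compRingHom (X^2 + X : F[X]))).2 ?_
      intro q hq
      have h0 : q.comp (X^2+X) = 0 := hq
      rcases comp_eq_zero_iff.1 h0 with h | ⟨_, h⟩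
      · exact h
      · rw [h, natDegree_C] at hd; omega
    intro x y hxy
    apply this
    simpa [ψ, comp, aeval_def] using hxy
  let j : FractionRing F[X] →+* FractionRing F[X] := IsFractionRing.lift (g := A.comp ψ) (hinj.comp hψ)
  have hj : ∀ r, j (A r) = A (ψ r) := fun r => IsFractionRing.lift_algebraMap _ r
  have hjt : j.comp (tof F) = tof F := by
    ext x
    have := hj (C x)
    have h3 : ψ (C x) = C x := by simp [ψ]
    rw [h3] at this
    exact this
  haveI : Infinite (FractionRing F[X]) := Infinite.of_injective A hinj
  refine ⟨FractionRing F[X], FractionRing F[X], inferInstance, inferInstance, inferInstance, tof F, j, A X, fun _ => 0,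
    sep_ratfunc, generic_an a c hπ, ?_, ?_, by simp, by simp⟩
  · rw [map_qPfister]
    have h1 : j (A X) = (A X)^2 + A X := by
      rw [hj]; simp [ψ]
    rw [h1]
    exact as_is (two_map (tof F) h2) _ _
  · rw [hjt]; exact an_tof _ hπ

lemma St_all {F : Type} [Field F] (h2 : (2:F) = 0) {n k : ℕ} (a : Fin n → F) (c : F) (p : Matrix (Fin k) (Fin k) F)
    (hπ : An (QF.qPfister a c)) (hk : k ≤ 2^n)
    (hp : ∀ (L : Type) [Field L] (g : F →+* L), An ((QF.qPfister a c).map g) → An (p.map g)) (s : Finset (Fin k)) :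
    St a c p s := by
  induction s using Finset.induction_on with
  | empty => exact St_empty h2 a c p hπ
  | insert d s hd ih =>
    obtain ⟨E, E', _, _, _, i, j, v, f, hsep, hρ, hρi, hπj, hf1, hf2⟩ := ih
    have hcard : s.card < 2^n := by
      have := Finset.card_le_univ (insert d s)
      rw [Finset.card_insert_of_notMem hd, Fintype.card_fin] at this
      omega
    obtain ⟨K, K', _, _, i1, j1, fd, s1, s2, s3, s4, s5, s6⟩ := core (two_map i h2) j (fun t => i (a t)) v (i c) hρ hρi
      (by rw [← map_qPfister, map_map_form]; exact hπj) (p.map i)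
      (fun L _ g hg => by
        rw [map_map_form]; apply hp; rwa [← map_map_form, map_qPfister]) s d hd hcard f
      (fun l hl => hf1 l hl) (fun l hl l' hl' hne => by rw [hf2 l hl l' hl' hne, map_add]; rfl)
    haveI : Infinite K := Infinite.of_injective i1 i1.injective
    rw [map_qPfister] at s2 s5
    rw [← map_map_form, map_qPfister i1] at s3
    rw [← map_qPfister, map_map_form] at s4
    refine ⟨K, K', inferInstance, inferInstance, inferInstance, i1.comp i, j1, i1 v, Function.update (fun l => bc i1 (f l)) d fd,
      hsep.comp s1, s2, s3, s4, ?_, ?_⟩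
    · intro l hl
      rcases Finset.mem_insert.1 hl with rfl | hl0
      · rw [Function.update_self]; exact s5
      · have hne : l ≠ d := fun h => hd (h ▸ hl0)
        rw [Function.update_of_ne hne]
        have := map_ev i1 (QF.qPfister (fun t => i (a t)) v) (f l)
        rw [hf1 l hl0, map_qPfister] at this
        exact this.symm
    · have old : ∀ l ∈ s, ∀ l' ∈ s, l ≠ l' → pl (QF.qPfister (fun t => (i1.comp i) (a t)) (i1 v)) (bc i1 (f l)) (bc i1 (f l')) = (i1.comp i) (p l l' + p l' l) := by
        intro l hl l' hl' hne
        have := map_pl i1 (QF.qPfister (fun t => i (a t)) v) (f l) (f l')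
        rw [hf2 l hl l' hl' hne, map_qPfister] at this
        exact this.symm
      have new : ∀ l ∈ s, pl (QF.qPfister (fun t => (i1.comp i) (a t)) (i1 v)) fd (bc i1 (f l)) = (i1.comp i) (p d l + p l d) := by
        intro l hl
        have := s6 l hl
        rw [map_qPfister] at this
        rw [map_add]
        rw [map_add] at this
        exact this
      intro l hl l' hl' hne
      rcases Finset.mem_insert.1 hl with rfl | hl0
      · rcases Finset.mem_insert.1 hl' with rfl | hl0'
        · exact absurd rfl hne
        · rw [Function.update_self, Function.update_of_ne (Ne.symm hne)]
          exact new l' hl0'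
      · have hne1 : l ≠ d := fun h => hd (h ▸ hl0)
        rcases Finset.mem_insert.1 hl' with rfl | hl0'
        · rw [Function.update_self, Function.update_of_ne hne, pl_comm, add_comm (p l l')]
          exact new l hl0
        · have hne2 : l' ≠ d := fun h => hd (h ▸ hl0')
          rw [Function.update_of_ne hne1, Function.update_of_ne hne2]
          exact old l hl0 l' hl0' hne

/-- a form representing everything of `τ` universally and of the same dimension -/
lemma gram_all {E : Type} [Field E] (h2 : (2:E) = 0) {N : ℕ} (τ ρ : Matrix (Fin N) (Fin N) E) (hρ : An ρ)
    (H0 : ∀ (K : Type) [Field K] (g : E →+* K), An (ρ.map g) → ∀ x, ∃ v, ev (ρ.map g) v = ev (τ.map g) x) (s : Finset (Fin N)) :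
    ∃ w : Fin N → Fin N → E, (∀ l ∈ s, ev ρ (w l) = ev τ (Pi.single l 1)) ∧
      ∀ l ∈ s, ∀ l' ∈ s, pl ρ (w l) (w l') = pl τ (Pi.single l 1) (Pi.single l' 1) := by
  classical
  induction s using Finset.induction_on with
  | empty => exact ⟨0, by simp, by simp⟩
  | insert d s hd ih =>
    obtain ⟨w, hw1, hw2⟩ := ih
    obtain ⟨v, hv1, hv2⟩ := lemL h2 τ ρ H0 (fun l : s => Pi.single l.1 1) (fun l : s => w l)
      (fun l l' => (hw2 l l.2 l' l'.2).symm) Finset.univ (fun l _ => (hw1 l l.2).symm) E (RingHom.id E)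
      (by rwa [map_id_form]) (Pi.single d 1)
    rw [map_id_form, map_id_form] at hv1
    simp only [map_id_form, RingHom.id_apply] at hv2
    have new : ∀ l ∈ s, pl ρ v (w l) = pl τ (Pi.single d 1) (Pi.single l 1) := fun l hl => hv2 ⟨l, hl⟩ (Finset.mem_univ _)
    refine ⟨Function.update w d v, ?_, ?_⟩
    · intro l hl
      rcases Finset.mem_insert.1 hl with rfl | hl0
      · rw [Function.update_self]; exact hv1
      · rw [Function.update_of_ne (show l ≠ d from fun h => hd (h ▸ hl0))]; exact hw1 l hl0
    · intro l hl l' hl'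
      rcases Finset.mem_insert.1 hl with rfl | hl0
      · rcases Finset.mem_insert.1 hl' with rfl | hl0'
        · rw [Function.update_self, pl_self, pl_self, hv1]
        · rw [Function.update_self, Function.update_of_ne (show l' ≠ l from fun h => hd (h ▸ hl0'))]
          exact new l' hl0'
      · rcases Finset.mem_insert.1 hl' with rfl | hl0'
        · rw [Function.update_self, Function.update_of_ne (show l ≠ l' from fun h => hd (h ▸ hl0)), pl_comm, new l hl0, pl_comm]
        · rw [Function.update_of_ne (show l ≠ d from fun h => hd (h ▸ hl0)), Function.update_of_ne (show l' ≠ d from fun h => hd (h ▸ hl0'))]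
          exact hw2 l hl0 l' hl0'

lemma isotropy_transfer {E E' : Type} [Field E] [Field E'] (h2 : (2:E) = 0) {N : ℕ} (τ ρ : Matrix (Fin N) (Fin N) E) (hρ : An ρ)
    (hτ : An τ)
    (H0 : ∀ (K : Type) [Field K] (g : E →+* K), An (ρ.map g) → ∀ x, ∃ v, ev (ρ.map g) v = ev (τ.map g) x) (j : E →+* E')
    (hi : Is (ρ.map j)) : Is (τ.map j) := by
  classical
  obtain ⟨w, hw1, hw2⟩ := gram_all h2 τ ρ hρ H0 Finset.univ
  have k1 : ∀ l, ev ρ (w l) = τ l l := fun l => by rw [hw1 l (Finset.mem_univ _), ev_single]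
  have k2 : ∀ l l', l ≠ l' → pl ρ (w l) (w l') = τ l l' + τ l' l :=
    fun l l' _ => by rw [hw2 l (Finset.mem_univ _) l' (Finset.mem_univ _), pl_single]
  have hli : LinearIndependent E w := gli_li ρ τ hτ id Function.injective_id w k1 k2
  have hlj := li_map j w hli
  have htop := hlj.span_eq_top_of_card_eq_finrank' (by simp)
  obtain ⟨y, hy, hy0⟩ := hi
  obtain ⟨x, hx⟩ := (Submodule.mem_span_range_iff_exists_fun E').1 (htop ▸ Submodule.mem_top : y ∈ Submodule.span E' (Set.range fun i t => j (w i t)))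
  refine ⟨x, ?_, ?_⟩
  · rintro rfl; apply hy; rw [← hx]; simp
  · rw [← gram_mat (τ.map j) (ρ.map j) (fun i t => j (w i t)), hx, hy0]
    · intro l; rw [← map_ev, k1]; rfl
    · intro l l' hne; rw [← map_pl, k2 l l' hne, map_add]; rfl

theorem sep_thm {F : Type} [Field F] (h2 : (2:F) = 0) {n k : ℕ} (a : Fin n → F) (c : F) (p : Matrix (Fin k) (Fin k) F)
    (hπ : An (QF.qPfister a c)) (hk : k ≤ 2^n)
    (hp : ∀ (L : Type) [Field L] (g : F →+* L), An ((QF.qPfister a c).map g) → An (p.map g)) :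
    ∃ (K : Type) (_ : Field K) (i : F →+* K), Sep i ∧ Is ((QF.qPfister a c).map i) ∧ An (p.map i) := by
  classical
  obtain ⟨E, E', _, _, _, i, j, v, f, hsep, hρ, hρi, hπj, hf1, hf2⟩ := St_all h2 a c p hπ hk hp Finset.univ
  set ρ := QF.qPfister (fun t => i (a t)) v with hρdef
  set π := (QF.qPfister a c).map i with hπdef
  have hπj1 : An (π.map j) := by rw [hπdef, map_map_form]; exact hπj
  have hπE : An π := hπj1.of_map
  have h2E := two_map i h2
  have hpE : An (p.map i) := hp E i hπE
  obtain ⟨x0, y1, hxy⟩ : ∃ x0 y1, pl π x0 y1 ≠ 0 := by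
    by_contra hcon
    push Not at hcon
    have hpi : π = QF.qPfister (fun t => i (a t)) (i c) := by rw [hπdef, map_qPfister]
    have := pf_nd h2E (fun t => i (a t)) (i c) (fun t => by simpa using pf_slots a c hπ t) (fun _ => 1) (fun y => by
      rw [← hpi]; exact hcon _ _)
    have h1 := congrFun this (pe n (0,0))
    simp at h1
  have hx0 : ev π x0 ≠ 0 := by
    intro h; rw [hπE _ h] at hxy; simp at hxy
  obtain ⟨K, _, i1, hs1, hK1, Q⟩ := lemG h2E π hπE x0 y1 hxy
  by_cases hKρ : An (ρ.map i1)
  · refine ⟨K, inferInstance, i1.comp i, hsep.comp hs1, by rw [← map_map_form]; exact hK1, ?_⟩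
    have g1 : ∀ l, ev ρ (f l) = (p.map i) l l := fun l => hf1 l (Finset.mem_univ _)
    have g2 : ∀ l l', l ≠ l' → pl ρ (f l) (f l') = (p.map i) l l' + (p.map i) l' l := fun l l' hne => by
      rw [hf2 l (Finset.mem_univ _) l' (Finset.mem_univ _) hne, map_add]; rfl
    have hli : LinearIndependent E f := gli_li ρ (p.map i) hpE id Function.injective_id f g1 g2
    intro x hx
    rw [← map_map_form, ← gram_mat ((p.map i).map i1) (ρ.map i1) (fun l t => i1 (f l t))] at hx
    · have h3 := hKρ _ hx
      ext l
      exact Fintype.linearIndependent_iff.1 (li_map i1 f hli) x h3 l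
    · intro l; rw [← map_ev, g1]; rfl
    · intro l l' hne; rw [← map_pl, g2 l l' hne, map_add]; rfl
  · exfalso
    rw [not_an] at hKρ
    obtain ⟨K', _, j'', i', hcomm, Hρ⟩ := Q E inferInstance (RingHom.id E)
    rw [RingHom.comp_id] at hcomm
    obtain ⟨h, V, hh, hV⟩ := Hρ n _ v hρ (by
      rw [← hcomm, ← hρdef, ← map_map_form]; exact hKρ.map i')
    have hsp := spec h2E _ _ _ h hh V hV
    rw [map_id_form, RingHom.id_apply] at hsp
    have hτ : An (ev π x0 • π) := by
      intro x hx
      rw [ev_smul_mat] at hx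
      exact hπE x ((mul_eq_zero.1 hx).resolve_left hx0)
    have htm : ∀ (L : Type) [Field L] (g : E →+* L), (ev π x0 • π).map g = g (ev π x0) • π.map g := by
      intro L _ g; ext; simp
    have h5 := isotropy_transfer h2E (ev π x0 • π) ρ hρ hτ (fun K _ g hg x => by
      rw [htm]; simp only [ev_smul_mat]; exact hsp K g hg x) j hρi
    obtain ⟨x, hx, hx1⟩ := h5
    rw [htm, ev_smul_mat] at hx1
    apply hx
    apply hπj1
    refine (mul_eq_zero.1 hx1).resolve_left ?_
    simpa using hx0

end SepThm
end QX

set_option linter.all false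
namespace QX
open Module
open scoped TensorProduct

section SepFacts

lemma sep_isSep {F K : Type} [Field F] [Field K] [Algebra F K] (h2 : (2:F) = 0) (h : Sep (algebraMap F K)) :
    QF.IsSepExt F K := by
  intro L _ _ hL
  haveI : CharP F 2 := CharTwo.of_one_ne_zero_of_two_eq_zero one_ne_zero h2
  have hinjK : Function.Injective (algebraMap K (K ⊗[F] L)) := (algebraMap K (K ⊗[F] L)).injective
  haveI : CharP K 2 := charP_of_injective_algebraMap (algebraMap F K).injective 2
  haveI : CharP L 2 := charP_of_injective_algebraMap (algebraMap F L).injective 2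
  haveI : CharP (K ⊗[F] L) 2 := charP_of_injective_algebraMap hinjK 2
  refine ⟨fun ξ hξ => ?_⟩
  obtain ⟨N, hN⟩ := hξ
  let b := Basis.ofVectorSpace F L
  let B := Algebra.TensorProduct.basis K b
  set S := (B.repr ξ).support with hS
  let eq := S.equivFin
  set n := S.card
  let l : Fin n → L := fun j => b (eq.symm j).1
  let z : Fin n → K := fun j => B.repr ξ (eq.symm j).1
  have hl : LinearIndependent F l := b.linearIndependent.comp _ (Subtype.val_injective.comp eq.symm.injective)
  have hξ : ξ = ∑ j, z j ⊗ₜ[F] l j := by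
    conv_lhs => rw [← B.linearCombination_repr ξ]
    rw [Finsupp.linearCombination_apply, Finsupp.sum, ← hS, ← Finset.sum_coe_sort, ← Equiv.sum_comp eq.symm]
    refine Finset.sum_congr rfl fun j _ => ?_
    simp only [B, Algebra.TensorProduct.basis_apply]
    rw [TensorProduct.smul_tmul', smul_eq_mul, mul_one]
  have hp : ∀ j, ∃ e : ℕ, l j ^ 2 ^ e ∈ (algebraMap F L).range := fun j => IsPurelyInseparable.pow_mem F 2 (l j)
  choose ej hej using hp
  set e := N + ∑ j, ej j with he
  have hc : ∀ j, ∃ c : F, algebraMap F L c = l j ^ 2 ^ e := by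
    intro j
    have hle : ej j ≤ e := by
      have := Finset.single_le_sum (f := ej) (fun _ _ => Nat.zero_le _) (Finset.mem_univ j)
      omega
    obtain ⟨c, hc⟩ := hej j
    refine ⟨c ^ 2 ^ (e - ej j), ?_⟩
    rw [map_pow, hc, ← pow_mul, ← pow_add, Nat.add_sub_cancel' hle]
  choose c hc using hc
  have h0 : ξ ^ 2 ^ e = 0 := by
    apply pow_eq_zero_of_le _ hN
    have : N < 2 ^ N := Nat.lt_two_pow_self
    have h3 : 2 ^ N ≤ 2 ^ e := Nat.pow_le_pow_right (by norm_num) (by omega)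
    omega
  have hz : ∑ j, algebraMap F K (c j) * z j ^ 2 ^ e = 0 := by
    apply hinjK
    rw [map_zero, ← h0, hξ, sum_pow_char_pow, map_sum]
    refine Finset.sum_congr rfl fun j _ => ?_
    rw [Algebra.TensorProduct.tmul_pow, ← hc, Algebra.TensorProduct.algebraMap_apply, Algebra.algebraMap_self_apply,
      Algebra.algebraMap_eq_smul_one, Algebra.algebraMap_eq_smul_one, TensorProduct.tmul_smul, TensorProduct.smul_tmul', smul_mul_assoc, one_mul]
  have := h e n c (fun x hx => by
    have h5 : (∑ j, x j • l j) ^ 2 ^ e = 0 := by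
      rw [sum_pow_char_pow, ← map_zero (algebraMap F L), ← hx, map_sum]
      refine Finset.sum_congr rfl fun j _ => ?_
      rw [smul_pow, ← hc, map_mul, Algebra.smul_def, mul_comm]
    ext j
    exact Fintype.linearIndependent_iff.1 hl x (pow_eq_zero_iff (by positivity)|>.1 h5) j) z hz
  rw [hξ, this]
  simp

/-- `F` viewed as an algebra over itself via Frobenius -/
def Fr (F : Type) : Type := F
instance (F : Type) [Field F] : Field (Fr F) := inferInstanceAs (Field F)
def toFr {F : Type} [Field F] : F ≃+* Fr F := RingEquiv.refl F
noncomputable instance (F : Type) [Field F] [CharP F 2] : Algebra F (Fr F) :=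
  (toFr.toRingHom.comp (frobenius F 2)).toAlgebra

lemma isSep_ql {F K : Type} [Field F] [Field K] [Algebra F K] (h2 : (2:F) = 0) (h : QF.IsSepExt F K) {n : ℕ} (c : Fin n → F)
    (hc : ∀ x : Fin n → F, ∑ j, c j * x j ^ 2 = 0 → x = 0) (z : Fin n → K)
    (hz : ∑ j, algebraMap F K (c j) * z j ^ 2 = 0) : z = 0 := by
  haveI : CharP F 2 := CharTwo.of_one_ne_zero_of_two_eq_zero one_ne_zero h2
  haveI : CharP K 2 := charP_of_injective_algebraMap (algebraMap F K).injective 2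
  have hFr : ∀ x : F, algebraMap F (Fr F) x = toFr x ^ 2 := fun x => map_pow toFr x 2
  have hpi : IsPurelyInseparable F (Fr F) := by
    rw [isPurelyInseparable_iff_pow_mem F 2]
    intro x
    refine ⟨1, toFr.symm x, ?_⟩
    rw [hFr]; simp
  have hred := h (Fr F) hpi
  have hinjK : Function.Injective (algebraMap K (K ⊗[F] Fr F)) := (algebraMap K (K ⊗[F] Fr F)).injective
  haveI : CharP (K ⊗[F] Fr F) 2 := charP_of_injective_algebraMap hinjK 2
  let l : Fin n → Fr F := fun j => toFr (c j)
  have hl : LinearIndependent F l := by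
    rw [Fintype.linearIndependent_iff]
    intro g hg
    have : g = 0 := by
      apply hc
      apply toFr.injective
      rw [map_zero, ← hg, map_sum]
      refine Finset.sum_congr rfl fun j _ => ?_
      rw [Algebra.smul_def, hFr, map_mul, map_pow, mul_comm]
    intro i; rw [this]; rfl
  obtain ⟨G, hG⟩ := LinearMap.exists_leftInverse_of_injective (Fintype.linearCombination F l)
    (LinearMap.ker_eq_bot.2 (linearIndependent_iff_injective_fintypeLinearCombination.1 hl))
  have hGl : ∀ i, G (l i) = Pi.single i 1 := by
    intro i
    have := LinearMap.congr_fun hG (Pi.single i 1)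
    simpa [Fintype.linearCombination_apply, Pi.single_apply] using this
  have hξ : (∑ j, z j ⊗ₜ[F] l j) = 0 := by
    apply hred.eq_zero
    refine ⟨2, ?_⟩
    rw [sum_pow_char 2, ← map_zero (algebraMap K (K ⊗[F] Fr F)), ← hz, map_sum]
    refine Finset.sum_congr rfl fun j _ => ?_
    rw [Algebra.TensorProduct.tmul_pow, ← hFr, Algebra.TensorProduct.algebraMap_apply, Algebra.algebraMap_self_apply,
      Algebra.algebraMap_eq_smul_one, Algebra.algebraMap_eq_smul_one, TensorProduct.tmul_smul, TensorProduct.smul_tmul', smul_mul_assoc, one_mul]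
  ext j
  have := congrArg (fun t => TensorProduct.rid F K (LinearMap.lTensor K ((LinearMap.proj j).comp G) t)) hξ
  simpa [hGl, Pi.single_apply] using this

/-- tower killing all binary forms -/
lemma tower {F : Type} [Field F] (h2 : (2:F) = 0) {r : ℕ} (a b : Fin r → F) (s : Finset (Fin r)) :
    ∃ (K : Type) (_ : Field K) (i : F →+* K), Sep i ∧
      ∀ l ∈ s, ∃ x y : K, (x ≠ 0 ∨ y ≠ 0) ∧ i (a l) * x^2 + x * y + i (b l) * y^2 = 0 := by
  induction s using Finset.induction_on with
  | empty => exact ⟨F, inferInstance, RingHom.id F, Sep.refl, by simp⟩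
  | insert d s hd ih =>
    obtain ⟨K, _, i, hi, hs⟩ := ih
    by_cases hex : ∃ x y : K, (x ≠ 0 ∨ y ≠ 0) ∧ i (a d) * x^2 + x * y + i (b d) * y^2 = 0
    · refine ⟨K, inferInstance, i, hi, fun l hl => ?_⟩
      rcases Finset.mem_insert.1 hl with rfl | hl0
      · exact hex
      · exact hs l hl0
    · push Not at hex
      have hb : i (a d) ≠ 0 := by
        intro h0
        exact hex 1 0 (Or.inl one_ne_zero) (by simp [h0])
      obtain ⟨K', _, i', α, hα, hsp, hind, -⟩ := quadExt (i (a d))⁻¹ ((i (b d)) * (i (a d))⁻¹) (fun x hx => by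
        apply hex x 1 (Or.inr one_ne_zero)
        have := congrArg (fun t => i (a d) * t) hx
        simp only [mul_zero] at this
        rw [← this]; field_simp)
      have hsep := sep_quad (two_map i h2) _ _ (inv_ne_zero hb) i' α hα hsp hind
      refine ⟨K', inferInstance, i'.comp i, hi.comp hsep, fun l hl => ?_⟩
      rcases Finset.mem_insert.1 hl with rfl | hl0
      · refine ⟨α, 1, Or.inr one_ne_zero, ?_⟩
        have hb' : i' (i (a l)) ≠ 0 := by simpa using hb
        have := congrArg (fun t => i' (i (a l)) * t) hα
        simp only [mul_zero, map_mul, map_inv₀] at this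
        rw [← this]; simp only [RingHom.comp_apply]; field_simp
      · obtain ⟨x, y, hxy, h0⟩ := hs l hl0
        refine ⟨i' x, i' y, by simpa using hxy, ?_⟩
        have := congrArg i' h0
        simpa using this

end SepFacts
end QX

set_option linter.all false
namespace QX
open Module

section Witt
variable {K : Type} [Field K]

lemma pl_eq_ev {ι R : Type} [Fintype ι] [CommRing R] (q : Matrix ι ι R) (x y : ι → R) :
    pl q x y = ev q (x + y) - ev q x - ev q y := by
  rw [ev_add]; ring

lemma isom_of {D D' : ℕ} {κ : Type} [Fintype κ] [DecidableEq κ] (e : κ ≃ Fin D') (q : QF K D) (p : Matrix κ κ K)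
    (v : κ → Fin D → K) (hli : LinearIndependent K v) (hcard : Fintype.card κ = D)
    (h1 : ∀ a, ev q (v a) = p a a) (h2 : ∀ a b, a ≠ b → pl q (v a) (v b) = p a b + p b a) :
    QF.Isom q (Matrix.reindex e e p) := by
  have hcd : Fintype.card κ = finrank K (Fin D → K) := by simpa using hcard
  let B : Basis κ K (Fin D → K) := basisOfTopLeSpanOfCardEqFinrank v (hli.span_eq_top_of_card_eq_finrank' hcd).ge hcd
  have hB : ∀ a, B a = v a := fun a => by simp [B]
  refine ⟨B.equivFun.trans (LinearEquiv.funCongrLeft K K e.symm), fun x => ?_⟩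
  have h3 := gram_mat p q v h1 h2 (B.equivFun x)
  have h4 : ∑ a, B.equivFun x a • v a = x := by
    simp only [← hB]; exact B.sum_equivFun x
  rw [h4] at h3
  refine Eq.trans ?_ h3.symm
  refine (ev_reindex e p _).trans ?_
  congr 1
  funext a
  simp [LinearEquiv.funCongrLeft_apply, LinearMap.funLeft_apply]

lemma of_isom {D D' : ℕ} {κ : Type} [Fintype κ] [DecidableEq κ] (e : κ ≃ Fin D') (q : QF K D) (p : Matrix κ κ K)
    (h : QF.Isom q (Matrix.reindex e e p)) :
    ∃ v : κ → Fin D → K, LinearIndependent K v ∧ Fintype.card κ = D ∧ (∀ x, ev q (∑ a, x a • v a) = ev p x) ∧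
      (∀ a, ev q (v a) = p a a) ∧ ∀ a b, pl q (v a) (v b) = p a b + p b a := by
  obtain ⟨E, hE⟩ := h
  have hD : D = D' := by simpa using E.finrank_eq
  let T := E.trans (LinearEquiv.funCongrLeft K K e)
  have hT : ∀ x, ev p (T x) = ev q x := by
    intro x
    have h1 := hE x
    have h2 := ev_reindex e p (E x)
    exact h2.symm.trans h1
  let v : κ → Fin D → K := fun a => T.symm (Pi.single a 1)
  have hsum : ∀ x : κ → K, ∑ a, x a • v a = T.symm x := by
    intro x
    simp only [v, ← map_smul, ← map_sum]
    congr 1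
    funext b
    simp [Finset.sum_apply, Pi.single_apply]
  have hev : ∀ x : κ → K, ev q (T.symm x) = ev p x := fun x => by rw [← hT, T.apply_symm_apply]
  refine ⟨v, ?_, by rw [hD, Fintype.card_congr e, Fintype.card_fin], fun x => by rw [hsum, hev], fun a => ?_, fun a b => ?_⟩
  · rw [Fintype.linearIndependent_iff]
    intro g hg i
    rw [hsum] at hg
    have := (map_eq_zero_iff _ T.symm.injective).1 hg
    rw [this]; rfl
  · simp only [v]; rw [hev, ev_single]
  · simp only [v]; rw [pl_eq_ev, ← map_add, hev, hev, hev, ← pl_eq_ev, pl_single]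

lemma orth_reindex {κ κ' : Type} {n m : ℕ} (e1 : κ ≃ Fin n) (e2 : κ' ≃ Fin m) (p : Matrix κ κ K) (p' : Matrix κ' κ' K) :
    QF.orthSum (Matrix.reindex e1 e1 p) (Matrix.reindex e2 e2 p') =
      Matrix.reindex ((Equiv.sumCongr e1 e2).trans finSumFinEquiv) ((Equiv.sumCongr e1 e2).trans finSumFinEquiv)
        (Matrix.fromBlocks p 0 0 p') := by
  ext i j
  obtain ⟨i, rfl⟩ := finSumFinEquiv.surjective i
  obtain ⟨j, rfl⟩ := finSumFinEquiv.surjective j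
  rcases i with i | i <;> rcases j with j | j <;> simp [QF.orthSum]

structure HF {D w : ℕ} (q : QF K D) (v y : Fin w → Fin D → K) : Prop where
  v0 : ∀ i, ev q (v i) = 0
  y0 : ∀ i, ev q (y i) = 0
  vv : ∀ i j, pl q (v i) (v j) = 0
  yy : ∀ i j, pl q (y i) (y j) = 0
  vy : ∀ i j, pl q (v i) (y j) = if i = j then 1 else 0

lemma HF.of_isom {D w m : ℕ} {q : QF K D} {q' : QF K m} (h : QF.Isom q (QF.orthSum q' (QF.hyper w))) :
    ∃ v y : Fin w → Fin D → K, HF q v y := by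
  have h1 := orth_reindex (Equiv.refl _) finSumFinEquiv q' (Matrix.fromBlocks (Matrix.diagonal (0 : Fin w → K)) (1 : Matrix (Fin w) (Fin w) K) 0 (Matrix.diagonal (0 : Fin w → K)))
  have h2 : QF.orthSum q' (QF.hyper w) = _ := h1
  rw [h2] at h
  obtain ⟨u, -, -, -, k1, k2⟩ := QX.of_isom _ _ _ h
  refine ⟨fun i => u (Sum.inr (Sum.inl i)), fun i => u (Sum.inr (Sum.inr i)), ?_, ?_, ?_, ?_, ?_⟩
  · intro i; rw [k1]; simp
  · intro i; rw [k1]; simp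
  · intro i j; rw [k2]; simp
  · intro i j; rw [k2]; simp
  · intro i j; rw [k2]; simp [Matrix.one_apply]

/-- coefficients from pairing -/
lemma HF.coef {D w : ℕ} {q : QF K D} {v y : Fin w → Fin D → K} (h : HF q v y) (x : Fin w ⊕ Fin w → K) (u : Fin D → K)
    (hu : ∀ a, pl q u (v a) = 0 ∧ pl q u (y a) = 0)
    (h0 : ∑ a, x a • Sum.elim v y a + u = 0) : x = 0 := by
  rw [Fintype.sum_sum_type] at h0
  simp only [Sum.elim_inl, Sum.elim_inr] at h0
  have hyv : ∀ i j, pl q (y i) (v j) = if i = j then 1 else 0 := by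
    intro i j; rw [pl_comm, h.vy]; simp [eq_comm]
  funext a
  rcases a with a | a
  · have := congrArg (fun t => pl q t (y a)) h0
    simpa [pl_add_left, pl_sum_left, pl_smul_left, h.vy, h.yy, (hu a).2, pl_zero_left] using this
  · have := congrArg (fun t => pl q t (v a)) h0
    simpa [pl_add_left, pl_sum_left, pl_smul_left, hyv, h.vv, (hu a).1, pl_zero_left] using this

lemma HF.dim {D w s : ℕ} {q : QF K D} {v y : Fin w → Fin D → K} (h : HF q v y) (z : Fin s → Fin D → K)
    (hz : LinearIndependent K z) (hr : ∀ j x, pl q (z j) x = 0) : w + w + s ≤ D := by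
  have : LinearIndependent K (Sum.elim (Sum.elim v y) z) := by
    rw [Fintype.linearIndependent_iff]
    intro g hg
    rw [Fintype.sum_sum_type] at hg
    simp only [Sum.elim_inl, Sum.elim_inr] at hg
    have h1 := h.coef (fun a => g (Sum.inl a)) (∑ j, g (Sum.inr j) • z j) (fun a => by
      simp [pl_sum_left, pl_smul_left, hr]) hg
    have h2 : ∀ a, g (Sum.inl a) = 0 := fun a => congrFun h1 a
    simp only [h2, zero_smul, Finset.sum_const_zero, zero_add] at hg
    have h3 := Fintype.linearIndependent_iff.1 hz _ hg
    rintro (a | a)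
    · exact h2 a
    · exact h3 a
  have := this.fintype_card_le_finrank
  simpa using this

lemma HF.isom {D w : ℕ} {q : QF K D} {v y : Fin w → Fin D → K} (h : HF q v y) :
    ∃ (m : ℕ) (q' : QF K m), QF.Isom q (QF.orthSum q' (QF.hyper w)) := by
  let Φ : (Fin D → K) →ₗ[K] (Fin w ⊕ Fin w → K) := LinearMap.pi fun a => plB q (Sum.elim v y a)
  have hyv : ∀ i j, pl q (y i) (v j) = if i = j then 1 else 0 := by
    intro i j; rw [pl_comm, h.vy]; simp [eq_comm]
  have hsurj : Function.Surjective Φ := by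
    intro g
    refine ⟨∑ i, g (Sum.inl i) • y i + ∑ i, g (Sum.inr i) • v i, ?_⟩
    funext a
    rcases a with a | a <;>
    simp [Φ, pl_add_right, pl_sum_right, pl_smul_right, h.vy, hyv, h.yy, h.vv]
  have hfr := LinearMap.finrank_range_add_finrank_ker Φ
  rw [LinearMap.range_eq_top.2 hsurj, finrank_top] at hfr
  simp only [Module.finrank_fintype_fun_eq_card, Fintype.card_sum, Fintype.card_fin] at hfr
  set m := finrank K (LinearMap.ker Φ) with hm
  let C : Basis (Fin m) K (LinearMap.ker Φ) := finBasis K _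
  let c : Fin m → Fin D → K := fun i => (C i).1
  have hcl : LinearIndependent K c := C.linearIndependent.map' (Submodule.subtype _) (Submodule.ker_subtype _)
  have hcv : ∀ i a, pl q (c i) (v a) = 0 := by
    intro i a
    have : Φ (c i) (Sum.inl a) = 0 := by rw [LinearMap.mem_ker.1 (C i).2]; rfl
    rw [pl_comm]; exact this
  have hcy : ∀ i a, pl q (c i) (y a) = 0 := by
    intro i a
    have : Φ (c i) (Sum.inr a) = 0 := by rw [LinearMap.mem_ker.1 (C i).2]; rfl
    rw [pl_comm]; exact this
  let q' : QF K m := Matrix.of fun i j => if i = j then ev q (c i) else if i < j then pl q (c i) (c j) else 0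
  refine ⟨m, q', ?_⟩
  have h1 := orth_reindex (Equiv.refl _) finSumFinEquiv q' (Matrix.fromBlocks (Matrix.diagonal (0 : Fin w → K)) (1 : Matrix (Fin w) (Fin w) K) 0 (Matrix.diagonal (0 : Fin w → K)))
  have h2 : QF.orthSum q' (QF.hyper w) = _ := h1
  rw [h2]
  refine isom_of _ _ _ (Sum.elim c (Sum.elim v y)) ?_ (by simp; omega) ?_ ?_
  · rw [Fintype.linearIndependent_iff]
    intro g hg
    rw [Fintype.sum_sum_type] at hg
    simp only [Sum.elim_inl, Sum.elim_inr] at hg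
    rw [add_comm] at hg
    have h1 := h.coef (fun a => g (Sum.inr a)) (∑ j, g (Sum.inl j) • c j) (fun a => by
      simp [pl_sum_left, pl_smul_left, hcv, hcy]) hg
    have h2 : ∀ a, g (Sum.inr a) = 0 := fun a => congrFun h1 a
    simp only [h2, zero_smul, Finset.sum_const_zero, zero_add] at hg
    have h3 := Fintype.linearIndependent_iff.1 hcl _ hg
    rintro (a | a)
    · exact h3 a
    · exact h2 a
  · rintro (a | a | a)
    · simp [q']
    · simp [h.v0]
    · simp [h.y0]
  · have hvc : ∀ a i, pl q (v a) (c i) = 0 := fun a i => by rw [pl_comm, hcv]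
    have hyc : ∀ a i, pl q (y a) (c i) = 0 := fun a i => by rw [pl_comm, hcy]
    rintro (a | a | a) (b | b | b) hab
    · have hab' : a ≠ b := fun h => hab (by rw [h])
      rcases lt_or_gt_of_ne hab' with hlt | hlt
      · simp [q', hab', hab'.symm, hlt, hlt.not_gt]
      · simp [q', hab', hab'.symm, hlt, hlt.not_gt, pl_comm q (c a)]
    · simp [hcv]
    · simp [hcy]
    · simp [hvc]
    · simp [h.vv]
    · simp [h.vy, Matrix.one_apply]
    · simp [hyc]
    · simp [hyv, Matrix.one_apply, eq_comm]
    · simp [h.yy]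

lemma HF.of_iso {D w : ℕ} (q : QF K D) (v : Fin w → Fin D → K) (hv : ∀ x : Fin w → K, ev q (∑ i, x i • v i) = 0)
    (hrad : ∀ x : Fin w → K, (∀ u, pl q (∑ i, x i • v i) u = 0) → x = 0) : ∃ y, HF q v y := by
  have v0 : ∀ i, ev q (v i) = 0 := fun i => by
    have := hv (Pi.single i 1)
    simpa [Pi.single_apply, ite_smul] using this
  have vv : ∀ i j, pl q (v i) (v j) = 0 := fun i j => by
    rw [pl_eq_ev, v0, v0]
    have := hv (Pi.single i 1 + Pi.single j 1)
    simpa [Pi.single_apply, ite_smul, add_smul, Finset.sum_add_distrib] using this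
  let A : (Fin w → K) →ₗ[K] Dual K (Fin D → K) := LinearMap.comp (plB q) (Fintype.linearCombination K v)
  have hA : LinearMap.ker A = ⊥ := by
    rw [LinearMap.ker_eq_bot']
    intro x hx
    exact hrad x fun u => LinearMap.congr_fun hx u
  obtain ⟨L, hL⟩ := LinearMap.exists_leftInverse_of_injective A hA
  have dual : ∀ j, ∃ y, ∀ i, pl q (v i) y = if i = j then 1 else 0 := by
    intro j
    obtain ⟨y, hy⟩ := (evalEquiv K (Fin D → K)).surjective ((LinearMap.proj j).comp L)
    refine ⟨y, fun i => ?_⟩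
    have h1 : A (Pi.single i 1) y = (L (A (Pi.single i 1))) j := LinearMap.congr_fun hy (A (Pi.single i 1))
    have h2 := LinearMap.congr_fun hL (Pi.single i 1)
    simp only [LinearMap.comp_apply, LinearMap.id_apply] at h2
    rw [h2] at h1
    have h3 : A (Pi.single i 1) y = pl q (v i) y := by
      simp [A, Fintype.linearCombination_apply, Pi.single_apply, ite_smul]
    rw [← h3, h1, Pi.single_apply]
    simp [eq_comm]
  choose u hu using dual
  have huv : ∀ i j, pl q (u i) (v j) = if i = j then 1 else 0 := by
    intro i j; rw [pl_comm, hu]; simp [eq_comm]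
  let C : Fin w → Fin w → K := fun j k => if j = k then - ev q (u j) else if j < k then - pl q (u j) (u k) else 0
  have e1 : ∀ j k, pl q (u j) (∑ i, C i k • v i) = C j k := by
    intro j k; simp [pl_sum_right, pl_smul_right, huv]
  have e2 : ∀ j k, pl q (v j) (∑ i, C i k • v i) = 0 := by
    intro j k; simp [pl_sum_right, pl_smul_right, vv]
  have y0 : ∀ j, ev q (u j + ∑ i, C i j • v i) = 0 := by
    intro j; rw [ev_add, hv, e1]; simp [C]
  refine ⟨fun j => u j + ∑ i, C i j • v i, v0, y0, vv, ?_, ?_⟩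
  · intro j k
    by_cases hjk : j = k
    · subst hjk; rw [pl_self, y0, mul_zero]
    · rw [pl_add_left, pl_add_right, pl_add_right, e1, pl_comm q (∑ i, C i j • v i) (u k), e1]
      have : pl q (∑ i, C i j • v i) (∑ i, C i k • v i) = 0 := by simp [pl_sum_left, pl_smul_left, e2]
      rw [this]
      rcases lt_or_gt_of_ne hjk with hlt | hlt
      · simp [C, hjk, Ne.symm hjk, hlt, hlt.not_gt]
      · simp [C, hjk, Ne.symm hjk, hlt, hlt.not_gt, pl_comm q (u j)]
  · intro i j
    rw [pl_add_right, e2, hu, add_zero]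

/-- Witt index characterization -/
lemma witt_mem {D : ℕ} (q : QF K D) : ∃ v y : Fin (QF.wittIndex q) → Fin D → K, HF q v y := by
  have hb : BddAbove {w | ∃ (m : ℕ) (q' : QF K m), QF.Isom q (QF.orthSum q' (QF.hyper w))} := by
    refine ⟨D, ?_⟩
    rintro w ⟨m, q', E, -⟩
    have : D = m + (w + w) := by simpa using E.finrank_eq
    omega
  have hne : {w | ∃ (m : ℕ) (q' : QF K m), QF.Isom q (QF.orthSum q' (QF.hyper w))}.Nonempty := by
    refine ⟨0, ?_⟩
    exact HF.isom (v := Fin.elim0) (y := Fin.elim0) ⟨fun i => i.elim0, fun i => i.elim0, fun i => i.elim0, fun i => i.elim0, fun i => i.elim0⟩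
  obtain ⟨m, q', h⟩ := Nat.sSup_mem hne hb
  exact HF.of_isom h

lemma witt_ge {D w : ℕ} (q : QF K D) {v y : Fin w → Fin D → K} (h : HF q v y) : w ≤ QF.wittIndex q := by
  have hb : BddAbove {w | ∃ (m : ℕ) (q' : QF K m), QF.Isom q (QF.orthSum q' (QF.hyper w))} := by
    refine ⟨D, ?_⟩
    rintro w ⟨m, q', E, -⟩
    have : D = m + (w + w) := by simpa using E.finrank_eq
    omega
  exact le_csSup hb h.isom

lemma HF.iso {D w : ℕ} {q : QF K D} {v y : Fin w → Fin D → K} (h : HF q v y) : LinearIndependent K v ∧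
    ∀ x : Fin w → K, ev q (∑ i, x i • v i) = 0 := by
  constructor
  · rw [Fintype.linearIndependent_iff]
    intro g hg a
    have := congrArg (fun t => pl q t (y a)) hg
    simpa [pl_sum_left, pl_smul_left, h.vy, pl_zero_left] using this
  · intro x
    rw [gram_mat 0 q v (fun a => h.v0 a) (fun a b _ => by simp [h.vv])]
    simp [ev]

end Witt
end QX

set_option linter.all false
namespace QX
open Module

section Typ
variable {F : Type} [Field F]

/-- the standard model of type (r,s) -/
def MM {F : Type} [Field F] {r s : ℕ} (a b : Fin r → F) (c : Fin s → F) : Matrix ((Fin r ⊕ Fin r) ⊕ Fin s) ((Fin r ⊕ Fin r) ⊕ Fin s) F :=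
  Matrix.fromBlocks (Matrix.fromBlocks (Matrix.diagonal a) 1 0 (Matrix.diagonal b)) 0 0 (Matrix.diagonal c)

/-- a basis adapted to the type -/
structure TB {D r s : ℕ} (q : QF F D) (a b : Fin r → F) (c : Fin s → F) (u : (Fin r ⊕ Fin r) ⊕ Fin s → Fin D → F) : Prop where
  li : LinearIndependent F u
  card : r + r + s = D
  k1 : ∀ t, ev q (u t) = MM a b c t t
  k2 : ∀ t t', pl q (u t) (u t') = MM a b c t t' + MM a b c t' t

lemma TB.ex {D r s : ℕ} {q : QF F D} (h : QF.HasType q r s) : ∃ a b c u, TB (r := r) (s := s) q a b c u := by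
  obtain ⟨c, a, b, h⟩ := h
  have h1 := orth_reindex finSumFinEquiv (Equiv.refl _) (Matrix.fromBlocks (Matrix.diagonal a) 1 0 (Matrix.diagonal b)) (Matrix.diagonal c)
  have h2 : QF.orthSum (QF.binSum a b) (QF.diag c) = _ := h1
  rw [h2] at h
  obtain ⟨u, k0, k3, -, k1, k2⟩ := QX.of_isom _ _ _ h
  exact ⟨a, b, c, u, k0, by simpa using k3, k1, k2⟩

lemma TB.map {D r s : ℕ} {q : QF F D} {a b : Fin r → F} {c : Fin s → F} {u} (h : TB q a b c u) {K : Type} [Field K] (i : F →+* K) :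
    TB (q.map i) (fun t => i (a t)) (fun t => i (b t)) (fun t => i (c t)) (fun t l => i (u t l)) := by
  have hM : MM (fun t => i (a t)) (fun t => i (b t)) (fun t => i (c t)) = (MM a b c).map i := by
    ext (t | t) (t' | t')
    · rcases t with t | t <;> rcases t' with t' | t' <;> simp [MM, Matrix.diagonal_apply, Matrix.one_apply, apply_ite i]
    · simp [MM]
    · simp [MM]
    · simp [MM, Matrix.diagonal_apply, apply_ite i]
  refine ⟨li_map i u h.li, h.card, fun t => ?_, fun t t' => ?_⟩
  · rw [← map_ev, h.k1, hM]; rfl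
  · rw [← map_pl, h.k2, hM, map_add]; rfl

lemma TB.span {D r s : ℕ} {q : QF F D} {a b : Fin r → F} {c : Fin s → F} {u} (h : TB q a b c u) (x : Fin D → F) :
    ∃ ξ : (Fin r ⊕ Fin r) ⊕ Fin s → F, ∑ t, ξ t • u t = x := by
  have htop := h.li.span_eq_top_of_card_eq_finrank' (by simp [h.card])
  exact (Submodule.mem_span_range_iff_exists_fun F).1 (htop ▸ Submodule.mem_top : x ∈ Submodule.span F (Set.range u))

lemma TB.zrad {D r s : ℕ} {q : QF F D} {a b : Fin r → F} {c : Fin s → F} {u} (h2 : (2:F) = 0) (h : TB q a b c u) (j : Fin s) (x : Fin D → F) :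
    pl q (u (Sum.inr j)) x = 0 := by
  obtain ⟨ξ, rfl⟩ := h.span x
  rw [pl_sum_right]
  refine Finset.sum_eq_zero fun t _ => ?_
  rw [pl_smul_right, h.k2]
  rcases t with t | t
  · simp [MM]
  · by_cases hjt : j = t
    · subst hjt; rw [← two_mul, h2]; simp
    · simp [MM, hjt, Ne.symm hjt]

lemma TB.ev_sum {D r s : ℕ} {q : QF F D} {a b : Fin r → F} {c : Fin s → F} {u} (h : TB q a b c u) (ξ) :
    ev q (∑ t, ξ t • u t) = ev (MM a b c) ξ := gram_mat _ _ _ h.k1 (fun t t' _ => h.k2 t t') ξ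

lemma ev_MM {r s : ℕ} (a b : Fin r → F) (c : Fin s → F) (ξ) : ev (MM a b c) ξ =
    (∑ l, (a l * ξ (Sum.inl (Sum.inl l))^2 + ξ (Sum.inl (Sum.inl l)) * ξ (Sum.inl (Sum.inr l)) + b l * ξ (Sum.inl (Sum.inr l))^2))
      + ∑ j, c j * ξ (Sum.inr j)^2 := by
  simp only [ev, MM, Fintype.sum_sum_type, Matrix.fromBlocks_apply₁₁, Matrix.fromBlocks_apply₁₂, Matrix.fromBlocks_apply₂₁,
    Matrix.fromBlocks_apply₂₂, Matrix.zero_apply, zero_mul, Finset.sum_const_zero, add_zero, zero_add,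
    Matrix.diagonal_apply, Matrix.one_apply, ite_mul, one_mul, Finset.sum_ite_eq, Finset.mem_univ, if_true, Finset.sum_add_distrib]
  simp only [pow_two, mul_assoc, add_assoc]

lemma TB.rad {D r s : ℕ} {q : QF F D} {a b : Fin r → F} {c : Fin s → F} {u} (h2 : (2:F) = 0) (h : TB q a b c u)
    (hc : ∀ x : Fin s → F, ∑ j, c j * x j ^ 2 = 0 → x = 0) (x : Fin D → F) (hx : ∀ y, pl q x y = 0) (hx0 : ev q x = 0) : x = 0 := by
  obtain ⟨ξ, rfl⟩ := h.span x
  have hk : ∀ t', ∑ t, ξ t * (MM a b c t t' + MM a b c t' t) = 0 := by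
    intro t'
    rw [← hx (u t'), pl_sum_left]
    exact Finset.sum_congr rfl fun t _ => by rw [pl_smul_left, h.k2]
  have e1 : ∀ l, ξ (Sum.inl (Sum.inr l)) = 0 := by
    intro l
    have := hk (Sum.inl (Sum.inl l))
    rw [Fintype.sum_sum_type, Fintype.sum_sum_type] at this
    simpa [MM, mul_add, Finset.sum_add_distrib, Matrix.diagonal_apply, Matrix.one_apply, ← two_mul, h2] using this
  have e2 : ∀ l, ξ (Sum.inl (Sum.inl l)) = 0 := by
    intro l
    have := hk (Sum.inl (Sum.inr l))
    rw [Fintype.sum_sum_type, Fintype.sum_sum_type] at this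
    simpa [MM, mul_add, Finset.sum_add_distrib, Matrix.diagonal_apply, Matrix.one_apply, ← two_mul, h2] using this
  rw [h.ev_sum, ev_MM] at hx0
  simp only [e1, e2] at hx0
  have h3 := hc (fun j => ξ (Sum.inr j)) (by simpa using hx0)
  have : ξ = 0 := by
    funext t
    rcases t with (t | t) | t
    · exact e2 t
    · exact e1 t
    · exact congrFun h3 t
  simp [this]

lemma TB.witt_le {D r s : ℕ} {q : QF F D} {a b : Fin r → F} {c : Fin s → F} {u} (h2 : (2:F) = 0) (h : TB q a b c u) :
    QF.wittIndex q ≤ r := by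
  obtain ⟨v, y, hf⟩ := witt_mem q
  have := hf.dim (fun j => u (Sum.inr j)) (h.li.comp _ Sum.inr_injective) (fun j x => h.zrad h2 j x)
  have := h.card
  omega

lemma TB.le_witt {D r s w : ℕ} {q : QF F D} {a b : Fin r → F} {c : Fin s → F} {u} (h2 : (2:F) = 0) (h : TB q a b c u)
    (hc : ∀ x : Fin s → F, ∑ j, c j * x j ^ 2 = 0 → x = 0) (v : Fin w → Fin D → F) (hv : LinearIndependent F v)
    (hv0 : ∀ x : Fin w → F, ev q (∑ i, x i • v i) = 0) : w ≤ QF.wittIndex q := by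
  obtain ⟨y, hy⟩ := HF.of_iso q v hv0 (fun x hx => by
    have := h.rad h2 hc _ hx (hv0 x)
    funext i
    exact Fintype.linearIndependent_iff.1 hv x this i)
  exact witt_ge q hy

lemma TB.sub_witt {D r s : ℕ} {q : QF F D} {a b : Fin r → F} {c : Fin s → F} {u} (h2 : (2:F) = 0) (h : TB q a b c u)
    (hc : ∀ x : Fin s → F, ∑ j, c j * x j ^ 2 = 0 → x = 0) (W : Submodule F (Fin D → F)) (hW : ∀ x ∈ W, ev q x = 0) :
    finrank F W ≤ QF.wittIndex q := by
  let B := finBasis F W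
  refine h.le_witt h2 hc (fun i => (B i).1) (B.linearIndependent.map' (Submodule.subtype _) (Submodule.ker_subtype _)) fun x => ?_
  apply hW
  exact Submodule.sum_mem _ fun i _ => Submodule.smul_mem _ _ (B i).2

lemma witt_sub {D : ℕ} (q : QF F D) : ∃ W : Submodule F (Fin D → F), finrank F W = QF.wittIndex q ∧ ∀ x ∈ W, ev q x = 0 := by
  obtain ⟨v, y, hf⟩ := witt_mem q
  refine ⟨Submodule.span F (Set.range v), by rw [finrank_span_eq_card hf.iso.1, Fintype.card_fin], fun x hx => ?_⟩
  obtain ⟨t, rfl⟩ := (Submodule.mem_span_range_iff_exists_fun F).1 hx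
  exact hf.iso.2 t

lemma TB.ql {D r s : ℕ} {q : QF F D} {a b : Fin r → F} {c : Fin s → F} {u} (h : TB q a b c u) (hq : An q) :
    ∀ x : Fin s → F, ∑ j, c j * x j ^ 2 = 0 → x = 0 := by
  intro x hx
  have h1 := h.ev_sum (Sum.elim 0 x)
  rw [ev_MM] at h1
  simp only [Sum.elim_inl, Sum.elim_inr, hx, Pi.zero_apply] at h1
  have h3 := hq _ (h1.trans (by simp))
  funext j
  exact Fintype.linearIndependent_iff.1 h.li _ h3 (Sum.inr j)

/-- a separable extension splitting everything -/
lemma TB.split {D r s : ℕ} {q : QF F D} {a b : Fin r → F} {c : Fin s → F} {u} (h2 : (2:F) = 0) (h : TB q a b c u) (hq : An q) :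
    ∃ (K : Type) (_ : Field K) (i : F →+* K), Sep i ∧ QF.wittIndex (q.map i) = r := by
  obtain ⟨K, _, i, hs, ht⟩ := tower h2 a b Finset.univ
  refine ⟨K, inferInstance, i, hs, le_antisymm ((h.map i).witt_le (two_map i h2)) ?_⟩
  choose x y hxy h0 using fun l => ht l (Finset.mem_univ _)
  set U := fun t l => i (u t l) with hU
  have hK := h.map i
  have key : ∀ t : Fin r → K, ∑ l, t l • (x l • U (Sum.inl (Sum.inl l)) + y l • U (Sum.inl (Sum.inr l))) =
      ∑ a, (Sum.elim (Sum.elim (fun l => t l * x l) (fun l => t l * y l)) (0 : Fin s → K)) a • U a := by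
    intro t
    rw [Fintype.sum_sum_type, Fintype.sum_sum_type]
    simp [smul_add, Finset.sum_add_distrib, smul_smul]
  refine hK.le_witt (two_map i h2) ?_ (fun l => x l • U (Sum.inl (Sum.inl l)) + y l • U (Sum.inl (Sum.inr l))) ?_ ?_
  · have := hs 1 s c (by simpa using h.ql hq)
    simpa using this
  · rw [Fintype.linearIndependent_iff]
    intro t ht l
    rw [key] at ht
    have h3 := Fintype.linearIndependent_iff.1 hK.li _ ht
    have e1 := h3 (Sum.inl (Sum.inl l))
    have e2 := h3 (Sum.inl (Sum.inr l))
    simp only [Sum.elim_inl, Sum.elim_inr] at e1 e2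
    rcases hxy l with h4 | h4
    · exact (mul_eq_zero.1 e1).resolve_right h4
    · exact (mul_eq_zero.1 e2).resolve_right h4
  · intro t
    rw [key, hK.ev_sum, ev_MM]
    simp only [Sum.elim_inl, Sum.elim_inr, Pi.zero_apply]
    have : ∀ l, i (a l) * (t l * x l)^2 + t l * x l * (t l * y l) + i (b l) * (t l * y l)^2 = 0 := by
      intro l
      have := congrArg (fun z => t l ^2 * z) (h0 l)
      simp only [mul_zero] at this
      rw [← this]; ring
    simp [this]

end Typ
end QX

set_option linter.all false
namespace QX
open Module

section Main

lemma comap_dim {K : Type} [Field K] {D N : ℕ} (g : (Fin D → K) →ₗ[K] (Fin N → K)) (hg : Function.Injective g)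
    (W : Submodule K (Fin N → K)) : finrank K W + D ≤ N + finrank K (W.comap g) := by
  have h1 : finrank K (W.comap g) = finrank K (W ⊓ LinearMap.range g : Submodule K (Fin N → K)) := by
    rw [inf_comm, ← Submodule.map_comap_eq]
    exact (LinearEquiv.finrank_eq (Submodule.equivMapOfInjective g hg _))
  have h2 := Submodule.finrank_sup_add_finrank_inf_eq W (LinearMap.range g)
  have h3 : finrank K (LinearMap.range g) = D := by rw [LinearMap.finrank_range_of_inj hg]; simp
  have h4 := Submodule.finrank_le (W ⊔ LinearMap.range g)
  rw [h3] at h2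
  rw [Module.finrank_fintype_fun_eq_card, Fintype.card_fin] at h4
  omega

/-- extend isotropic `I` by a Lagrangian -/
lemma lag_ext {K : Type} [Field K] {N M : ℕ} (ρ : Matrix (Fin N) (Fin N) K) (hnd : ∀ x, (∀ y, pl ρ x y = 0) → x = 0)
    (hN : N = M + M) (Λ I : Submodule K (Fin N → K)) (hΛ : ∀ x ∈ Λ, ev ρ x = 0) (hI : ∀ x ∈ I, ev ρ x = 0)
    (hd : finrank K Λ = M) : ∃ Λ' : Submodule K (Fin N → K), M ≤ finrank K Λ' ∧ (∀ x ∈ Λ', ev ρ x = 0) ∧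
      ∀ x ∈ Λ', ∀ y ∈ I, pl ρ y x = 0 := by
  have pli : ∀ W : Submodule K (Fin N → K), (∀ x ∈ W, ev ρ x = 0) → ∀ x ∈ W, ∀ y ∈ W, pl ρ x y = 0 := by
    intro W hW x hx y hy
    rw [pl_eq_ev, hW _ (W.add_mem hx hy), hW x hx, hW y hy]; simp
  have hB := nd_of ρ hnd
  have hfr : ∀ W : Submodule K (Fin N → K), finrank K ((plB ρ).orthogonal W) = N - finrank K W := by
    intro W
    have := LinearMap.BilinForm.finrank_orthogonal hB W
    simpa using this
  have hΛle : Λ ≤ (plB ρ).orthogonal Λ := fun x hx => (mem_orth ρ Λ x).2 fun y hy => pli Λ hΛ y hy x hx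
  have hΛeq : Λ = (plB ρ).orthogonal Λ := Submodule.eq_of_le_of_finrank_eq hΛle (by rw [hfr, hd]; omega)
  set Z := (plB ρ).orthogonal (Λ ⊔ I) with hZ
  have hZΛ : Z ≤ Λ := by
    rw [hΛeq]
    intro x hx
    exact (mem_orth ρ Λ x).2 fun y hy => (mem_orth ρ _ x).1 hx y (Submodule.mem_sup_left hy)
  have hZI : ∀ x ∈ Z, ∀ y ∈ I, pl ρ y x = 0 := fun x hx y hy => (mem_orth ρ _ x).1 hx y (Submodule.mem_sup_right hy)
  refine ⟨Z ⊔ I, ?_, ?_, ?_⟩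
  · have h1 := Submodule.finrank_sup_add_finrank_inf_eq Λ I
    have h2 := Submodule.finrank_sup_add_finrank_inf_eq Z I
    have h3 := hfr (Λ ⊔ I)
    rw [← hZ] at h3
    have h4 : finrank K (Z ⊓ I : Submodule K (Fin N → K)) ≤ finrank K (Λ ⊓ I : Submodule K (Fin N → K)) :=
      Submodule.finrank_mono (inf_le_inf_right I hZΛ)
    have h5 := Submodule.finrank_le (Λ ⊔ I)
    rw [Module.finrank_fintype_fun_eq_card, Fintype.card_fin] at h5
    omega
  · intro x hx
    obtain ⟨z, hz, y, hy, rfl⟩ := Submodule.mem_sup.1 hx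
    rw [ev_add, hΛ z (hZΛ hz), hI y hy, pl_comm, hZI z hz y hy]; simp
  · intro x hx y hy
    obtain ⟨z, hz, y', hy', rfl⟩ := Submodule.mem_sup.1 hx
    rw [pl_add_right, hZI z hz y hy, pli I hI y hy y' hy', add_zero]

theorem main (F : Type) [Field F] [CharP F 2] {n m r s : ℕ}
    (q : QF F (2 ^ n + m)) (hm : 1 ≤ m) (hm' : m ≤ 2 ^ n)
    (hty : QF.HasType q r s) (hr : 1 ≤ r) (haniso : An q)
    (hpn : QF.IsPfisterNeighbour q) :
    r + s ≤ 2 ^ n ∧ (QF.hnd q = 1 ↔ r + s = 2 ^ n) := by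
  have h2 : (2:F) = 0 := CharTwo.two_eq_zero
  obtain ⟨a, b, c, u, hT⟩ := TB.ex hty
  have hcard := hT.card
  obtain ⟨k, π, hk, ⟨d, hd, A, C, E, hE⟩, f, hf, hfq⟩ := hpn
  obtain rfl : k = n := by
    have h1 : 2 ^ n + m ≤ 2 ^ k * 2 := by simpa using LinearMap.finrank_le_finrank_of_injective hf
    have h3 : 2 ^ k < 2 ^ (n+1) := by rw [pow_succ]; omega
    have h4 : 2 ^ n < 2 ^ (k+1) := by rw [pow_succ]; omega
    have h5 := (Nat.pow_lt_pow_iff_right (by norm_num)).1 h3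
    have h6 := (Nat.pow_lt_pow_iff_right (by norm_num)).1 h4
    omega
  set P := QF.qPfister A C with hP
  set g : (Fin (2^k+m) → F) →ₗ[F] (Fin (2^k*2) → F) := E.toLinearMap.comp f with hg
  have hgi : Function.Injective g := E.injective.comp hf
  have hgq : ∀ x, d * ev P (g x) = ev q x := by
    intro x
    rw [← ev_smul_mat]
    exact (hE (f x)).trans (hfq x)
  have hgpl : ∀ x y, d * pl P (g x) (g y) = pl q x y := by
    intro x y
    rw [pl_eq_ev, pl_eq_ev, ← map_add, mul_sub, mul_sub, hgq, hgq, hgq]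
  -- vectors
  let γ : Fin (2^k+m) → Fin (2^k*2) → F := fun t => g (Pi.single t 1)
  have hγs : ∀ x : Fin (2^k+m) → F, ∑ t, x t • γ t = g x := by
    intro x
    simp only [γ, ← map_smul, ← map_sum]
    congr 1
    funext t
    simp [Finset.sum_apply, Pi.single_apply]
  have hγ : LinearIndependent F γ := by
    rw [Fintype.linearIndependent_iff]
    intro x hx t
    rw [hγs] at hx
    rw [(map_eq_zero_iff _ hgi).1 hx]; rfl
  have hPan : An P := by
    rw [← not_is]
    intro hi
    obtain ⟨W, hW, hW0⟩ := pf_lag h2 A C hi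
    obtain ⟨x, hx0, hxW⟩ := meet W γ hγ (by rw [hW]; simp; omega)
    rw [hγs] at hx0 hxW
    apply hx0
    have := hgq x
    rw [hW0 _ hxW, mul_zero] at this
    rw [haniso x this.symm, map_zero]
  have hslots : ∀ t, A t ≠ 0 := fun t => pf_slots A C hPan t
  have hPK : ∀ {K : Type} [Field K] (i : F →+* K), P.map i = QF.qPfister (fun t => i (A t)) (i C) := fun i => map_qPfister i A C
  have hndK : ∀ {K : Type} [Field K] (i : F →+* K) (x), (∀ y, pl (P.map i) x y = 0) → x = 0 := by
    intro K _ i x hx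
    rw [hPK] at hx
    exact pf_nd (two_map i h2) _ _ (fun t => by simpa using hslots t) x hx
  have hlagK : ∀ {K : Type} [Field K] (i : F →+* K), Is (P.map i) → ∃ W : Submodule K (Fin (2^k*2) → K), finrank K W = 2^k ∧ ∀ x ∈ W, ev (P.map i) x = 0 := by
    intro K _ i hx
    rw [hPK] at hx ⊢
    exact pf_lag (two_map i h2) _ _ hx
  have hnd : ∀ x, (∀ y, pl P x y = 0) → x = 0 := pf_nd h2 A C hslots
  -- g over K
  let gK : ∀ {K : Type} [Field K] (i : F →+* K), (Fin (2^k+m) → K) →ₗ[K] (Fin (2^k*2) → K) :=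
    fun {K} _ i => Fintype.linearCombination K (fun t l => i (γ t l))
  have hgKi : ∀ {K : Type} [Field K] (i : F →+* K), Function.Injective (gK i) := by
    intro K _ i
    exact linearIndependent_iff_injective_fintypeLinearCombination.1 (li_map i γ hγ)
  have hgKq : ∀ {K : Type} [Field K] (i : F →+* K) (x), i d * ev (P.map i) (gK i x) = ev (q.map i) x := by
    intro K _ i x
    have := gram_mat (q.map i) ((d • P).map i) (fun t l => i (γ t l)) (fun t => by
      rw [← map_ev, ev_smul_mat, hgq, ev_single]; rfl) (fun t t' _ => by
      rw [← map_pl, pl_smul_mat, hgpl, pl_single, map_add]; rfl) x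
    have hdP : (d • P).map i = i d • P.map i := by ext; simp
    rw [hdP, ev_smul_mat] at this
    exact this
  have hdK : ∀ {K : Type} [Field K] (i : F →+* K), i d ≠ 0 := fun i => by simpa using hd
  have hgK0 : ∀ {K : Type} [Field K] (i : F →+* K) (x), ev (P.map i) (gK i x) = 0 ↔ ev (q.map i) x = 0 := by
    intro K _ i x
    rw [← hgKq i]; simp [hd]
  have hql := hT.ql haniso
  -- r + s ≤ 2^k
  have hrs : r + s ≤ 2 ^ k := by
    set S := Submodule.span F (Set.range fun j => g (u (Sum.inr j))) with hS
    have hli : LinearIndependent F (fun j => g (u (Sum.inr j))) :=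
      (hT.li.comp _ Sum.inr_injective).map' g (LinearMap.ker_eq_bot.2 hgi)
    have hle : LinearMap.range g ≤ (plB P).orthogonal S := by
      rintro _ ⟨x, rfl⟩
      rw [mem_orth]
      intro y hy
      obtain ⟨t, rfl⟩ := (Submodule.mem_span_range_iff_exists_fun F).1 hy
      rw [pl_sum_left]
      refine Finset.sum_eq_zero fun j _ => ?_
      have := hgpl (u (Sum.inr j)) x
      rw [hT.zrad h2] at this
      rw [pl_smul_left, (mul_eq_zero.1 this).resolve_left hd, mul_zero]
    have h3 := Submodule.finrank_mono hle
    rw [LinearMap.finrank_range_of_inj hgi, LinearMap.BilinForm.finrank_orthogonal (nd_of P hnd), finrank_span_eq_card hli] at h3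
    simp at h3
    omega
  refine ⟨hrs, ?_⟩
  -- the splitting pattern
  have hsepK : ∀ (K : Type) (hK : Field K) (i : F →+* K), Sep i → QF.wittIndex (q.map i) ∈ QF.splittingPattern q := by
    intro K hK i hi
    letI := i.toAlgebra
    exact ⟨⟨K⟩, sep_isSep h2 hi, rfl⟩
  have hmem0 : 0 ∈ QF.splittingPattern q := by
    have := hsepK F inferInstance (RingHom.id F) Sep.refl
    rw [map_id_form] at this
    obtain ⟨W, hW, hW0⟩ := witt_sub q
    have hb : W = ⊥ := by
      rw [Submodule.eq_bot_iff]
      exact fun x hx => haniso x (hW0 x hx)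
    rw [hb, finrank_bot] at hW
    rwa [← hW] at this
  have hmemr : r ∈ QF.splittingPattern q := by
    obtain ⟨K, _, i, hi, hw⟩ := hT.split h2 haniso
    have := hsepK K inferInstance i hi
    rwa [hw] at this
  have hsub : ({0, r} : Set ℕ) ⊆ QF.splittingPattern q := by
    rintro x (rfl | rfl)
    · exact hmem0
    · exact hmemr
  have hc2 : ({0, r} : Set ℕ).ncard = 2 := Set.ncard_pair (by omega)
  have hiff : QF.hnd q = 1 ↔ QF.splittingPattern q = {0, r} := by
    constructor
    · intro h
      have h3 : (QF.splittingPattern q).ncard = 2 := by unfold QF.hnd at h; omega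
      have hfin : (QF.splittingPattern q).Finite := Set.finite_of_ncard_ne_zero (by omega)
      exact (Set.eq_of_subset_of_ncard_le hsub (by omega) hfin).symm
    · intro h
      unfold QF.hnd; rw [h, hc2]
  rw [hiff]
  constructor
  · intro hpat
    by_contra hne
    have hlt : r + s < 2 ^ k := by omega
    obtain ⟨w, hw, hwγ⟩ := perp_basis P hnd γ hγ (2^k - m) (by simp; omega)
    let J : Matrix (Fin (2^k*2)) (Fin (2^k-m)) F := Matrix.of fun t j => w j t
    let p : Matrix (Fin (2^k-m)) (Fin (2^k-m)) F := J.transpose * P * J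
    have hpK : ∀ {K : Type} [Field K] (i : F →+* K) (x), ev (p.map i) x = ev (P.map i) (∑ j, x j • (fun t => i (w j t))) := by
      intro K _ i x
      have h3 : p.map i = (J.map i).transpose * P.map i * J.map i := by
        simp only [p, Matrix.map_mul, Matrix.transpose_map]
      rw [h3, ev_conj]
      congr 1
      funext t
      simp [Matrix.mulVec, dotProduct, J, Finset.sum_apply, mul_comm]
    obtain ⟨K, _, i, hsep, hPi, hpan⟩ := sep_thm h2 A C p hPan (Nat.sub_le _ _) (fun L _ i hi x hx => by
      rw [hpK] at hx
      have := hi _ hx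
      funext j
      exact Fintype.linearIndependent_iff.1 (li_map i w hw) x this j)
    obtain ⟨Λ, hΛd, hΛ⟩ := hlagK i hPi
    have hqlK : ∀ x : Fin s → K, ∑ j, i (c j) * x j ^ 2 = 0 → x = 0 := by
      have := hsep 1 s c (by simpa using hql)
      simpa using this
    have h3 := comap_dim (gK i) (hgKi i) Λ
    have h4 := (hT.map i).sub_witt (two_map i h2) hqlK (Λ.comap (gK i)) (fun x hx => (hgK0 i x).1 (hΛ _ hx))
    have h5 := hsepK K inferInstance i hsep
    rw [hpat] at h5
    have h6 : QF.wittIndex (q.map i) = r := by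
      rcases h5 with h5 | h5
      · rw [h5] at h4; omega
      · exact h5
    obtain ⟨I0, hI0, hI00⟩ := witt_sub (q.map i)
    rw [h6] at hI0
    set I := I0.map (gK i) with hI
    have hId : finrank K I = r := by
      rw [← hI0]; exact (LinearEquiv.finrank_eq (Submodule.equivMapOfInjective (gK i) (hgKi i) I0)).symm
    obtain ⟨Λ', g1, g2, g3⟩ := lag_ext (P.map i) (hndK i) (M := 2^k) (by omega) Λ I hΛ (by
      rintro _ ⟨x, hx, rfl⟩
      exact (hgK0 i x).2 (hI00 x hx)) hΛd
    set Ψ := Submodule.span K (Set.range fun j t => i (w j t)) with hΨ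
    have hwK := li_map i w hw
    have hΨd : finrank K Ψ = 2^k - m := by rw [hΨ, finrank_span_eq_card hwK, Fintype.card_fin]
    have hΛ'le : Λ' ≤ (plB (P.map i)).orthogonal I := fun x hx => (mem_orth _ _ _).2 fun y hy => g3 x hx y hy
    have hΨle : Ψ ≤ (plB (P.map i)).orthogonal I := by
      intro x hx
      rw [mem_orth]
      rintro _ ⟨y, hy, rfl⟩
      obtain ⟨t, rfl⟩ := (Submodule.mem_span_range_iff_exists_fun K).1 hx
      simp only [gK, Fintype.linearCombination_apply]
      rw [pl_sum_right]
      refine Finset.sum_eq_zero fun j _ => ?_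
      rw [pl_smul_right, pl_sum_left]
      have : ∀ l, pl (P.map i) (y l • fun t => i (γ l t)) (fun t => i (w j t)) = 0 := by
        intro l
        rw [pl_smul_left, pl_comm, ← map_pl, hwγ]; simp
      simp [this]
    have e1 := Submodule.finrank_sup_add_finrank_inf_eq Λ' Ψ
    have e2 := Submodule.finrank_mono (sup_le hΛ'le hΨle)
    rw [LinearMap.BilinForm.finrank_orthogonal (nd_of _ (hndK i)), hId, Module.finrank_fintype_fun_eq_card, Fintype.card_fin] at e2
    have e3 : 0 < finrank K (Λ' ⊓ Ψ : Submodule K (Fin (2^k*2) → K)) := by omega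
    have e4 : Λ' ⊓ Ψ ≠ ⊥ := by
      intro h; rw [h, finrank_bot] at e3; omega
    obtain ⟨x, hx, hx0⟩ := Submodule.exists_mem_ne_zero_of_ne_bot e4
    obtain ⟨t, rfl⟩ := (Submodule.mem_span_range_iff_exists_fun K).1 hx.2
    have e5 := g2 _ hx.1
    rw [← hpK] at e5
    apply hx0
    rw [hpan t e5]; simp
  · intro hrs2
    refine Set.Subset.antisymm ?_ hsub
    rintro w ⟨K, hsep, hw⟩
    set i := algebraMap F K.carrier with hi
    have hw' : QF.wittIndex (q.map i) = w := hw
    have hTK := hT.map i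
    by_cases h0 : w = 0
    · exact Or.inl h0
    right
    have hqlK : ∀ x : Fin s → K.carrier, ∑ j, i (c j) * x j ^ 2 = 0 → x = 0 := fun x hx => isSep_ql h2 hsep c hql x hx
    obtain ⟨W, hW, hW0⟩ := witt_sub (q.map i)
    have hPi : Is (P.map i) := by
      have : W ≠ ⊥ := by
        intro h; rw [h, finrank_bot] at hW; omega
      obtain ⟨x, hx, hx0⟩ := Submodule.exists_mem_ne_zero_of_ne_bot this
      refine ⟨gK i x, ?_, (hgK0 i x).2 (hW0 x hx)⟩
      intro h
      exact hx0 ((map_eq_zero_iff _ (hgKi i)).1 h)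
    obtain ⟨Λ, hΛd, hΛ⟩ := hlagK i hPi
    have h3 := comap_dim (gK i) (hgKi i) Λ
    have h4 := hTK.sub_witt (two_map i h2) hqlK (Λ.comap (gK i)) (fun x hx => (hgK0 i x).1 (hΛ _ hx))
    have h5 := hTK.witt_le (two_map i h2)
    show w = r
    omega

end Main
end QX

/-- Lemma 7.20: let `φ` be an anisotropic nonquasilinear quadratic form
of type `(r, s)` over a field `F` of characteristic 2 with `dim φ = 2 ^ n + m`,
`1 ≤ m ≤ 2 ^ n`.  If `φ` is a Pfister neighbour, then `r + s ≤ 2 ^ n` and the following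
are equivalent: (1) `h_nd(φ) = 1`; (2) `r + s = 2 ^ n`; (3) `dim φ = 2 ^ (n+1) - s`. -/
theorem statement11 (F : Type) [Field F] [CharP F 2] {n m r s : ℕ}
    (q : QF F (2 ^ n + m)) (hm : 1 ≤ m) (hm' : m ≤ 2 ^ n)
    (hty : QF.HasType q r s) (hr : 1 ≤ r) (haniso : QF.Anisotropic q)
    (hpn : QF.IsPfisterNeighbour q) :
    r + s ≤ 2 ^ n ∧
    (QF.hnd q = 1 ↔ r + s = 2 ^ n) ∧
    (QF.hnd q = 1 ↔ 2 ^ n + m = 2 ^ (n + 1) - s) := by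
  obtain ⟨h1, h2⟩ := QX.main F q hm hm' hty hr haniso hpn
  refine ⟨h1, h2, h2.trans ?_⟩
  obtain ⟨a, b, c, u, hT⟩ := QX.TB.ex hty
  have hc := hT.card
  have hp : 2 ^ (n + 1) = 2 ^ n * 2 := pow_succ 2 n
  omega
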